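/- There exist absolute constants ε₀ > 0 and c > 0 with the following property. Let 0 < ε < ε₀ and d > 0, and let u be a classical solution of the one-phase free boundary problem in the annulus A = B₁ ∖ closure(B_d) ⊆ ℝ² ≅ ℂ satisfying condition (A), whose free boundary is flat on all scales in the sense that for every r ∈ (d,1) there is a rotation ρ_r of ℝ² with |u(ρ_r x) − P(x)| ≤ ε r for all x ∈ B_r ∖ B_d. Then there is a function g : [−1,1] → ℝ with g(0) = 0 and |g′(x)| ≤ cε for all x ∈ [−1,1] such that, after a rotation, {z ∈ ℂ : cd < |z| < 1/c} ∩ A⁺(u) = {z ∈ ℂ : cd < |z| < 1/c} ∩ {z = x₁ + ix₂ : x₁ > g(x₂)}, where A⁺(u) = {z ∈ A : u(z) > 0}. -/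

import Mathlib

open Complex Metric Set Filter MeasureTheory
open scoped Topology Classical NNReal

noncomputable section

/-- The positive phase of `u` in `Ω`. -/
def posSet (Ω : Set ℂ) (u : ℂ → ℝ) : Set ℂ := {z ∈ Ω | 0 < u z}

/-- The free boundary of `u` in `Ω`. -/
def FB (Ω : Set ℂ) (u : ℂ → ℝ) : Set ℂ := Ω ∩ frontier (posSet Ω u)

/-- The gradient of `u : ℂ → ℝ`, viewed as a complex number `∂ₓu + i ∂ᵧu`. -/
def grad2 (u : ℂ → ℝ) (z : ℂ) : ℂ :=
  ((fderiv ℝ u z 1 : ℝ) : ℂ) + ((fderiv ℝ u z Complex.I : ℝ) : ℂ) * Complex.I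

/-- Second derivative (Hessian) of `u : ℂ → ℝ` at `z` in directions `v, w`. -/
def hess (u : ℂ → ℝ) (z v w : ℂ) : ℝ := fderiv ℝ (fun x => fderiv ℝ u x v) z w

/-- `u` is harmonic on `s`: twice continuously differentiable with vanishing Laplacian. -/
def HarmonicOn2 (u : ℂ → ℝ) (s : Set ℂ) : Prop :=
  ContDiffOn ℝ 2 u s ∧ ∀ z ∈ s, hess u z 1 1 + hess u z Complex.I Complex.I = 0

/-- A classical solution of the one-phase free boundary problem `Δu = 0` in `{u>0}`,
`|∇u| = 1` on the free boundary, in the open set `Ω ⊆ ℝ² ≅ ℂ`. -/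
structure IsClassicalSolution (Ω : Set ℂ) (u : ℂ → ℝ) : Prop where
  contOn : ContinuousOn u Ω
  nonneg : ∀ z ∈ Ω, 0 ≤ u z
  harm : HarmonicOn2 u (posSet Ω u)
  smooth_ext : ∃ v : ℂ → ℝ, ContDiffOn ℝ (⊤ : ℕ∞) v (Ω ∩ closure (posSet Ω u)) ∧
    Set.EqOn u v (Ω ∩ closure (posSet Ω u))
  fb_manifold : ∀ z ∈ FB Ω u, ∃ V : Set ℂ, IsOpen V ∧ z ∈ V ∧ V ⊆ Ω ∧
    ∃ φ : ℂ → ℝ, ContDiffOn ℝ (⊤ : ℕ∞) φ V ∧ (∀ w ∈ V, fderiv ℝ φ w ≠ 0) ∧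
      V ∩ posSet Ω u = {w ∈ V | 0 < φ w} ∧
      V ∩ {w | u w = 0} = {w ∈ V | φ w ≤ 0} ∧
      V ∩ FB Ω u = {w ∈ V | φ w = 0}
  grad_one : ∀ z ∈ FB Ω u,
    Filter.Tendsto (fun w => ‖grad2 u w‖) (nhdsWithin z (posSet Ω u)) (nhds 1)

/-- One-plane solution `P(z) = max (Re z) 0`. -/
def Pfun (z : ℂ) : ℝ := max z.re 0

/-- Wedge solution `W_s(z) = s |Re z|`. -/
def Wfun (s : ℝ) (z : ℂ) : ℝ := s * |z.re|

/-- Two-plane solution `TP_a`. -/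
def TPfun (a : ℝ) (z : ℂ) : ℝ := max z.re 0 + max (-z.re - a) 0

/-- Rotation of the plane by angle `θ`. -/
def rot (θ : ℝ) (z : ℂ) : ℂ := Complex.exp (θ * Complex.I) * z

/-- The strip `S = {|Im ζ| < π/2}`. -/
def Sstrip : Set ℂ := {ζ : ℂ | |ζ.im| < Real.pi / 2}

/-- The hairpin domain `Ω₁ = {|x₂| < π/2 + cosh x₁}`. -/
def Omega1 : Set ℂ := {z : ℂ | |z.im| < Real.pi / 2 + Real.cosh z.re}

/-- Dilated hairpin domain `Ω_a = aΩ₁`. -/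
def OmegaA (a : ℝ) : Set ℂ := {z : ℂ | z / (a : ℂ) ∈ Omega1}

/-- The Hauswirth–Hélein–Pacard double hairpin solution `H = H₁`:
`H(z) = Re (cosh w)` where `w` is the unique point of the strip `S` with `w + sinh w = z`,
and `H(z) = 0` if there is no such point. -/
def hairpinH (z : ℂ) : ℝ :=
  if h : ∃ w : ℂ, w ∈ Sstrip ∧ w + Complex.sinh w = z then (Complex.cosh h.choose).re else 0

/-- The double hairpin solution `H_a(z) = a H(z/a)`. -/
def hairpin (a : ℝ) (z : ℂ) : ℝ := a * hairpinH (z / (a : ℂ))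

/-- Euclidean dot product of two complex numbers viewed as vectors in ℝ². -/
def dot2 (a b : ℂ) : ℝ := a.re * b.re + a.im * b.im

/-- Divergence of a vector field `ψ : ℂ → ℂ` on ℝ². -/
def div2 (ψ : ℂ → ℂ) (z : ℂ) : ℝ := (fderiv ℝ ψ z 1).re + (fderiv ℝ ψ z Complex.I).im

/-- A variational (weak) solution of the one-phase free boundary problem in `Ω`:
`u ∈ H¹_loc(Ω) ∩ C(Ω)`, `u ≥ 0`, `u ∈ C²({u>0})`, and the domain-variation
Euler–Lagrange identity holds for all compactly supported smooth vector fields. -/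
def VariationalSolution (Ω : Set ℂ) (u : ℂ → ℝ) : Prop :=
  ContinuousOn u Ω ∧ (∀ z ∈ Ω, 0 ≤ u z) ∧
  (∀ K : Set ℂ, K ⊆ Ω → IsCompact K →
    MeasureTheory.IntegrableOn (fun z => (u z) ^ 2 + ‖grad2 u z‖ ^ 2) K) ∧
  ContDiffOn ℝ 2 u (posSet Ω u) ∧
  ∀ ψ : ℂ → ℂ, ContDiff ℝ (⊤ : ℕ∞) ψ → HasCompactSupport ψ → tsupport ψ ⊆ Ω →
    ∫ z in Ω, ((‖grad2 u z‖ ^ 2 + Set.indicator {w | 0 < u w} (fun _ => (1 : ℝ)) z) * div2 ψ z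
      - 2 * dot2 (grad2 u z) (fderiv ℝ ψ z (grad2 u z))) = 0

/-- Average of `w` over the circle of radius `r` around `z`. -/
def circleAvg (w : ℂ → ℝ) (z : ℂ) (r : ℝ) : ℝ :=
  (1 / (2 * Real.pi)) * ∫ θ in (0 : ℝ)..(2 * Real.pi), w (z + r * Complex.exp (θ * Complex.I))

/-- Superharmonicity on `s` via the super-mean-value property. -/
def SuperharmonicOn2 (w : ℂ → ℝ) (s : Set ℂ) : Prop :=
  ∀ z ∈ s, ∀ r : ℝ, 0 < r → Metric.closedBall z r ⊆ s → circleAvg w z r ≤ w z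

/-- Subharmonicity on `s` via the sub-mean-value property. -/
def SubharmonicOn2 (w : ℂ → ℝ) (s : Set ℂ) : Prop :=
  ∀ z ∈ s, ∀ r : ℝ, 0 < r → Metric.closedBall z r ⊆ s → w z ≤ circleAvg w z r

/-- Non-tangential approach region in `B` at `x₀` with aperture `C`. -/
def NontangentialIn (B : Set ℂ) (x₀ : ℂ) (C : ℝ) : Set ℂ :=
  {x ∈ B | ‖x - x₀‖ ≤ C * Metric.infDist x Bᶜ}

/-- `w(x) = α ⟨x − x₀, ν⟩⁺ + o(|x − x₀|)` as `x → x₀` within the region `R`. -/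
def HasSlopeAt (w : ℂ → ℝ) (x₀ ν : ℂ) (α : ℝ) (R : Set ℂ) : Prop :=
  Filter.Tendsto (fun x => (w x - α * max (dot2 (x - x₀) ν) 0) / ‖x - x₀‖)
    (nhdsWithin x₀ R) (nhds 0)

/-- Viscosity supersolution of the one-phase free boundary problem in `Ω`. -/
structure ViscositySupersolution (Ω : Set ℂ) (w : ℂ → ℝ) : Prop where
  contOn : ContinuousOn w Ω
  nonneg : ∀ z ∈ Ω, 0 ≤ w z
  superharm : SuperharmonicOn2 w (posSet Ω w)
  slope : ∀ x₀ ∈ FB Ω w, ∀ (y : ℂ) (ρ : ℝ), 0 < ρ → Metric.ball y ρ ⊆ posSet Ω w →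
    dist x₀ y = ρ → ∃ α : ℝ, α ≤ 1 ∧ ∀ C : ℝ, 1 < C →
      HasSlopeAt w x₀ ((y - x₀) / (ρ : ℂ)) α (NontangentialIn (Metric.ball y ρ) x₀ C)

/-- Viscosity subsolution of the one-phase free boundary problem in `Ω`. -/
structure ViscositySubsolution (Ω : Set ℂ) (w : ℂ → ℝ) : Prop where
  contOn : ContinuousOn w Ω
  nonneg : ∀ z ∈ Ω, 0 ≤ w z
  subharm : SubharmonicOn2 w (posSet Ω w)
  slope : ∀ x₀ ∈ FB Ω w, ∀ (y : ℂ) (ρ : ℝ), 0 < ρ →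
    Metric.ball y ρ ⊆ {z ∈ Ω | w z = 0} → dist x₀ y = ρ →
    ∃ α : ℝ, 1 ≤ α ∧ ∀ C : ℝ, 1 < C →
      HasSlopeAt w x₀ ((x₀ - y) / (ρ : ℂ)) α
        (NontangentialIn (closure (Metric.ball y ρ))ᶜ x₀ C)

/-- Viscosity solution: both a supersolution and a subsolution. -/
def ViscositySolution (Ω : Set ℂ) (w : ℂ → ℝ) : Prop :=
  ViscositySupersolution Ω w ∧ ViscositySubsolution Ω w

/-- Non-degeneracy with constant `c`: linear growth away from the free boundary. -/
def Nondegenerate (Ω : Set ℂ) (w : ℂ → ℝ) (c : ℝ) : Prop :=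
  ∀ x ∈ FB Ω w, ∀ r : ℝ, 0 < r → Metric.ball x r ⊆ Ω → c * r ≤ sSup (w '' Metric.ball x r)

/-- The open annulus `{δ < |z| < R}`. -/
def ann (δ R : ℝ) : Set ℂ := {z : ℂ | δ < ‖z‖ ∧ ‖z‖ < R}

/-- Condition (A): the free boundary of `u` in the annulus `{δ < |z| < R}` consists of
exactly two connected components, each non-compact with closure meeting both boundary
circles. -/
def ConditionA (δ R : ℝ) (u : ℂ → ℝ) : Prop :=
  ∃ F₁ F₂ : Set ℂ,
    F₁.Nonempty ∧ F₂.Nonempty ∧ Disjoint F₁ F₂ ∧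
    F₁ ∪ F₂ = FB (ann δ R) u ∧
    (∀ z ∈ F₁, connectedComponentIn (FB (ann δ R) u) z = F₁) ∧
    (∀ z ∈ F₂, connectedComponentIn (FB (ann δ R) u) z = F₂) ∧
    ¬ IsCompact F₁ ∧ ¬ IsCompact F₂ ∧
    (closure F₁ ∩ Metric.sphere 0 δ).Nonempty ∧
    (closure F₁ ∩ Metric.sphere 0 R).Nonempty ∧
    (closure F₂ ∩ Metric.sphere 0 δ).Nonempty ∧
    (closure F₂ ∩ Metric.sphere 0 R).Nonempty

/-- `k` is the curvature of the set `S` at the point `p`, computed via an arc-length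
parametrization. -/
def IsCurvatureAt (S : Set ℂ) (p : ℂ) (k : ℝ) : Prop :=
  ∃ γ : ℝ → ℂ, ContDiff ℝ 2 γ ∧ γ 0 = p ∧ (∀ s : ℝ, ‖deriv γ s‖ = 1) ∧
    (∃ ε > 0, ∀ s ∈ Set.Ioo (-ε) ε, γ s ∈ S) ∧ ‖deriv (deriv γ) 0‖ = k

/-- A set has exactly two connected components. -/
def HasExactlyTwoComponents (S : Set ℂ) : Prop :=
  ∃ z₁ ∈ S, ∃ z₂ ∈ S, connectedComponentIn S z₁ ≠ connectedComponentIn S z₂ ∧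
    ∀ z ∈ S, connectedComponentIn S z = connectedComponentIn S z₁ ∨
      connectedComponentIn S z = connectedComponentIn S z₂

end

def J2 (g : ℝ → ℝ) (a b : ℝ) : Prop :=
  ∃ g' : ℝ → ℝ, (∀ᶠ t in 𝓝 0, HasDerivAt g (g' t) t) ∧ g' 0 = a ∧ HasDerivAt g' b 0

theorem J2.const (c : ℝ) : J2 (fun _ => c) 0 0 :=
  ⟨fun _ => 0, Eventually.of_forall fun t => hasDerivAt_const t c, rfl, hasDerivAt_const _ _⟩

theorem J2.add {g h : ℝ → ℝ} {a b a' b' : ℝ} (hg : J2 g a b) (hh : J2 h a' b') :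
    J2 (fun t => g t + h t) (a + a') (b + b') := by
  obtain ⟨g', h1, h2, h3⟩ := hg
  obtain ⟨k', k1, k2, k3⟩ := hh
  refine ⟨fun t => g' t + k' t, ?_, by simp [h2, k2], h3.add k3⟩
  filter_upwards [h1, k1] with t ht kt using ht.add kt

theorem J2.mul {g h : ℝ → ℝ} {a b a' b' : ℝ} (hg : J2 g a b) (hh : J2 h a' b') :
    J2 (fun t => g t * h t) (a * h 0 + g 0 * a') (b * h 0 + 2 * (a * a') + g 0 * b') := by
  obtain ⟨g', h1, h2, h3⟩ := hg
  obtain ⟨k', k1, k2, k3⟩ := hh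
  refine ⟨fun t => g' t * h t + g t * k' t, ?_, by simp [h2, k2], ?_⟩
  · filter_upwards [h1, k1] with t ht kt using ht.mul kt
  · have := (h3.mul k1.self_of_nhds).add (h1.self_of_nhds.mul k3)
    rw [h2, k2] at this
    exact this.congr_deriv (by ring)

theorem J2.comp {g : ℝ → ℝ} {a b : ℝ} {F F' : ℝ → ℝ} {F'' : ℝ} (hg : J2 g a b)
    (hF : ∀ᶠ s in 𝓝 (g 0), HasDerivAt F (F' s) s) (hF' : HasDerivAt F' F'' (g 0)) :
    J2 (fun t => F (g t)) (F' (g 0) * a) (F'' * a ^ 2 + F' (g 0) * b) := by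
  obtain ⟨g', h1, h2, h3⟩ := hg
  have hd := h1.self_of_nhds
  refine ⟨fun t => F' (g t) * g' t, ?_, by simp [h2], ?_⟩
  · filter_upwards [h1, hd.continuousAt.eventually hF] with t ht kt
    exact kt.comp t ht
  · have := (hF'.comp 0 hd).mul h3
    rw [h2] at this
    exact this.congr_deriv (by simp only [Function.comp]; ring)

theorem J2.congr {g h : ℝ → ℝ} {a b : ℝ} (hg : J2 g a b) (e : h =ᶠ[𝓝 0] g) : J2 h a b := by
  obtain ⟨g', h1, h2, h3⟩ := hg
  refine ⟨g', ?_, h2, h3⟩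
  filter_upwards [h1, e.eventuallyEq_nhds] with t ht et
  exact ht.congr_of_eventuallyEq et

theorem J2.max {g : ℝ → ℝ} {a b : ℝ} (hg : J2 g a b) (hm : IsLocalMax g 0) : a = 0 ∧ b ≤ 0 := by
  obtain ⟨g', h1, h2, h3⟩ := hg
  have ha : a = 0 := by rw [← h2]; exact hm.hasDerivAt_eq_zero h1.self_of_nhds
  refine ⟨ha, ?_⟩
  by_contra hb
  push Not at hb
  have h4 : ∀ᶠ t in 𝓝[>] (0:ℝ), 0 < g' t := by
    have := (hasDerivAt_iff_tendsto_slope.1 h3)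
    have h5 : ∀ᶠ t in 𝓝[≠] (0:ℝ), 0 < slope g' 0 t := this.eventually (lt_mem_nhds hb)
    have h6 : ∀ᶠ t in 𝓝[>] (0:ℝ), 0 < slope g' 0 t :=
      h5.filter_mono (nhdsWithin_mono _ (fun x hx => ne_of_gt hx))
    filter_upwards [h6, self_mem_nhdsWithin] with t ht htp
    rw [slope_def_field, h2, ha] at ht
    simp only [sub_zero] at ht
    have htp' : (0:ℝ) < t := htp
    by_contra hneg
    push Not at hneg
    have := div_nonpos_of_nonpos_of_nonneg hneg htp'.le
    linarith
  obtain ⟨δ1, hδ1, hA⟩ := Metric.eventually_nhds_iff.1 (h1.and hm)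
  obtain ⟨δ2, hδ2, hB⟩ := mem_nhdsGT_iff_exists_Ioo_subset.1 h4
  have hδ2' : (0:ℝ) < δ2 := hδ2
  set s := min (δ1/2) (δ2/2) with hs
  have hs0 : 0 < s := by positivity
  have hs1 : s ≤ δ1/2 := min_le_left _ _
  have hs2 : s ≤ δ2/2 := min_le_right _ _
  have hmono : StrictMonoOn g (Icc 0 s) := by
    apply strictMonoOn_of_deriv_pos (convex_Icc _ _)
    · intro x hx
      refine (HasDerivAt.continuousAt (hA ?_).1).continuousWithinAt
      rw [Real.dist_eq, sub_zero, abs_of_nonneg hx.1]; linarith [hx.2]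
    · intro x hx
      rw [interior_Icc] at hx
      have : dist x 0 < δ1 := by rw [Real.dist_eq, sub_zero, abs_of_nonneg hx.1.le]; linarith [hx.2]
      rw [(hA this).1.deriv]
      exact hB ⟨hx.1, by linarith [hx.2]⟩
  have h7 := hmono (left_mem_Icc.2 hs0.le) (right_mem_Icc.2 hs0.le) hs0
  have h8 := (hA (show dist s 0 < δ1 by rw [Real.dist_eq, sub_zero, abs_of_nonneg hs0.le]; linarith)).2
  linarith

def JL (Φ : ℂ → ℝ) (z : ℂ) (p q L : ℝ) : Prop :=
  ∃ b c, J2 (fun t => Φ (z + t)) p b ∧ J2 (fun t => Φ (z + t * I)) q c ∧ b + c = L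

theorem JL.const (c : ℝ) (z : ℂ) : JL (fun _ => c) z 0 0 0 :=
  ⟨0, 0, J2.const c, J2.const c, by simp⟩

theorem JL.add {Φ Ψ : ℂ → ℝ} {z : ℂ} {p q L p' q' L' : ℝ} (h : JL Φ z p q L) (k : JL Ψ z p' q' L') :
    JL (fun w => Φ w + Ψ w) z (p + p') (q + q') (L + L') := by
  obtain ⟨b, c, h1, h2, h3⟩ := h
  obtain ⟨b', c', k1, k2, k3⟩ := k
  exact ⟨b + b', c + c', h1.add k1, h2.add k2, by rw [← h3, ← k3]; ring⟩

theorem JL.mul {Φ Ψ : ℂ → ℝ} {z : ℂ} {p q L p' q' L' : ℝ} (h : JL Φ z p q L) (k : JL Ψ z p' q' L') :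
    JL (fun w => Φ w * Ψ w) z (p * Ψ z + Φ z * p') (q * Ψ z + Φ z * q')
      (L * Ψ z + 2 * (p * p' + q * q') + Φ z * L') := by
  obtain ⟨b, c, h1, h2, h3⟩ := h
  obtain ⟨b', c', k1, k2, k3⟩ := k
  have e1 := h1.mul k1
  have e2 := h2.mul k2
  simp only [ofReal_zero, add_zero, zero_mul] at e1 e2
  exact ⟨_, _, e1, e2, by rw [← h3, ← k3]; ring⟩

theorem JL.cmul {Φ : ℂ → ℝ} {z : ℂ} {p q L : ℝ} (c : ℝ) (h : JL Φ z p q L) :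
    JL (fun w => c * Φ w) z (c * p) (c * q) (c * L) := by
  have := (JL.const c z).mul h
  simpa using this

theorem JL.sub {Φ Ψ : ℂ → ℝ} {z : ℂ} {p q L p' q' L' : ℝ} (h : JL Φ z p q L) (k : JL Ψ z p' q' L') :
    JL (fun w => Φ w - Ψ w) z (p - p') (q - q') (L - L') := by
  have := h.add (k.cmul (-1))
  simpa [sub_eq_add_neg] using this

theorem JL.sq {Φ : ℂ → ℝ} {z : ℂ} {p q L : ℝ} (h : JL Φ z p q L) :
    JL (fun w => Φ w ^ 2) z (2 * Φ z * p) (2 * Φ z * q) (2 * Φ z * L + 2 * (p ^ 2 + q ^ 2)) := by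
  have := h.mul h
  simp only [← pow_two] at this
  convert this using 1 <;> ring

theorem JL.comp {Φ : ℂ → ℝ} {z : ℂ} {p q L : ℝ} {F F' : ℝ → ℝ} {F'' : ℝ} (h : JL Φ z p q L)
    (hF : ∀ᶠ s in 𝓝 (Φ z), HasDerivAt F (F' s) s) (hF' : HasDerivAt F' F'' (Φ z)) :
    JL (fun w => F (Φ w)) z (F' (Φ z) * p) (F' (Φ z) * q) (F'' * (p ^ 2 + q ^ 2) + F' (Φ z) * L) := by
  obtain ⟨b, c, h1, h2, h3⟩ := h
  have e1 := h1.comp (F := F) (F' := F') (F'' := F'') (by simpa using hF) (by simpa using hF')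
  have e2 := h2.comp (F := F) (F' := F') (F'' := F'') (by simpa using hF) (by simpa using hF')
  simp only [ofReal_zero, add_zero, zero_mul] at e1 e2
  exact ⟨_, _, e1, e2, by rw [← h3]; ring⟩

theorem tendsto_line (z ω : ℂ) : Tendsto (fun t : ℝ => z + t * ω) (𝓝 0) (𝓝 z) := by
  have : Continuous (fun t : ℝ => z + t * ω) := by fun_prop
  simpa using this.tendsto 0

theorem JL.congr {Φ Ψ : ℂ → ℝ} {z : ℂ} {p q L : ℝ} (h : JL Φ z p q L) (e : Ψ =ᶠ[𝓝 z] Φ) :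
    JL Ψ z p q L := by
  obtain ⟨b, c, h1, h2, h3⟩ := h
  refine ⟨b, c, h1.congr ?_, h2.congr ?_, h3⟩
  · have := (tendsto_line z 1).eventually e
    simpa [Filter.EventuallyEq] using this
  · exact (tendsto_line z I).eventually e

theorem JL.max {Φ : ℂ → ℝ} {z : ℂ} {p q L : ℝ} (h : JL Φ z p q L) (hm : IsLocalMax Φ z) :
    p = 0 ∧ q = 0 ∧ L ≤ 0 := by
  obtain ⟨b, c, h1, h2, h3⟩ := h
  have m1 : IsLocalMax (fun t : ℝ => Φ (z + t)) 0 := by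
    have := (tendsto_line z 1).eventually hm
    simpa [IsLocalMax, IsMaxFilter] using this
  have m2 : IsLocalMax (fun t : ℝ => Φ (z + t * I)) 0 := by
    have := (tendsto_line z I).eventually hm
    simpa [IsLocalMax, IsMaxFilter] using this
  have a1 := h1.max m1
  have a2 := h2.max m2
  exact ⟨a1.1, a2.1, by linarith [a1.2, a2.2]⟩

def HarmAt (h : ℂ → ℝ) (F : ℂ → ℂ) (z : ℂ) : Prop :=
  ∃ U : ℂ → ℂ, ∀ᶠ w in 𝓝 z, HasDerivAt U (F w) w ∧ h w = (U w).re

theorem HarmAt.eventually {h F z} (H : HarmAt h F z) : ∀ᶠ w in 𝓝 z, HarmAt h F w := by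
  obtain ⟨U, hU⟩ := H
  filter_upwards [hU.eventually_nhds] with w hw using ⟨U, hw⟩

theorem HarmAt.analyticAt {h F z} (H : HarmAt h F z) : AnalyticAt ℂ F z := by
  obtain ⟨U, hU⟩ := H
  have h1 : AnalyticAt ℂ U z := by
    rw [Complex.analyticAt_iff_eventually_differentiableAt]
    filter_upwards [hU] with w hw using hw.1.differentiableAt
  have h2 := h1.deriv
  refine h2.congr ?_
  filter_upwards [hU] with w hw using hw.1.deriv

theorem hasDerivAt_re_line {U : ℂ → ℂ} {F z ω : ℂ} {t : ℝ} (h : HasDerivAt U F (z + t * ω)) :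
    HasDerivAt (fun s : ℝ => (U (z + s * ω)).re) (F * ω).re t := by
  have h1 : HasDerivAt (fun s : ℂ => U (z + s * ω)) (F * ω) (t : ℂ) := by
    have h2 : HasDerivAt (fun s : ℂ => z + s * ω) ω (t : ℂ) := by
      simpa using ((hasDerivAt_id (t:ℂ)).mul_const ω).const_add z
    exact h.comp (t : ℂ) h2
  exact h1.real_of_complex

theorem J2_re_line {U F : ℂ → ℂ} {G z : ℂ} (ω : ℂ) (h : ∀ᶠ w in 𝓝 z, HasDerivAt U (F w) w)
    (hG : HasDerivAt F G z) :
    J2 (fun t : ℝ => (U (z + t * ω)).re) (F z * ω).re (G * ω * ω).re := by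
  refine ⟨fun t => (F (z + t * ω) * ω).re, ?_, by simp, ?_⟩
  · filter_upwards [(tendsto_line z ω).eventually h] with t ht using hasDerivAt_re_line ht
  · have h1 : HasDerivAt (fun w => F w * ω) (G * ω) (z + (0:ℝ) * ω) := by
      simpa using hG.mul_const ω
    exact hasDerivAt_re_line h1

theorem HarmAt.JL {h : ℂ → ℝ} {F : ℂ → ℂ} {z : ℂ} (H : HarmAt h F z) :
    JL h z (F z).re (-(F z).im) 0 := by
  have ha := H.analyticAt.differentiableAt.hasDerivAt
  obtain ⟨U, hU⟩ := H
  have h1 : ∀ᶠ w in 𝓝 z, HasDerivAt U (F w) w := hU.mono fun w hw => hw.1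
  have e1 := J2_re_line 1 h1 ha
  have e2 := J2_re_line I h1 ha
  simp only [mul_one] at e1
  have e3 : (F z * I).re = -(F z).im := by simp
  rw [e3] at e2
  refine JL.congr (Φ := fun w => (U w).re) ⟨_, _, e1, e2, ?_⟩ (hU.mono fun w hw => hw.2)
  simp [mul_assoc]

theorem HarmAt.continuousAt {h F z} (H : HarmAt h F z) : ContinuousAt h z := by
  obtain ⟨U, hU⟩ := H
  have : ContinuousAt (fun w => (U w).re) z :=
    continuous_re.continuousAt.comp hU.self_of_nhds.1.continuousAt
  exact this.congr (hU.mono fun w hw => hw.2.symm)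

theorem JL.normSq (c z : ℂ) :
    JL (fun w => Complex.normSq (w - c)) z (2 * (z - c).re) (2 * (z - c).im) 4 := by
  have h1 : HarmAt (fun w => (w - c).re) (fun _ => 1) z :=
    ⟨fun w => w - c, Eventually.of_forall fun w => ⟨(hasDerivAt_id w).sub_const c, rfl⟩⟩
  have h2 : HarmAt (fun w => (w - c).im) (fun _ => -I) z :=
    ⟨fun w => -I * (w - c), Eventually.of_forall fun w =>
      ⟨by simpa using ((hasDerivAt_id w).sub_const c).const_mul (-I), by simp⟩⟩
  have := h1.JL.sq.add h2.JL.sq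
  have h := this.congr (Ψ := fun w => Complex.normSq (w - c))
    (Eventually.of_forall fun w => by simp only [normSq_apply]; ring)
  convert h using 1 <;> (simp; try norm_num)

theorem HarmAt.re_mul (a b z : ℂ) : HarmAt (fun w => (a * w + b).re) (fun _ => a) z :=
  ⟨fun w => a * w + b, Eventually.of_forall fun w =>
    ⟨by simpa using ((hasDerivAt_id w).const_mul a).add_const b, rfl⟩⟩

theorem HarmAt.add {h k : ℂ → ℝ} {F G : ℂ → ℂ} {z : ℂ} (H : HarmAt h F z) (K : HarmAt k G z) :
    HarmAt (fun w => h w + k w) (fun w => F w + G w) z := by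
  obtain ⟨U, hU⟩ := H
  obtain ⟨V, hV⟩ := K
  refine ⟨fun w => U w + V w, ?_⟩
  filter_upwards [hU, hV] with w h1 h2 using ⟨h1.1.add h2.1, by simp [h1.2, h2.2]⟩

theorem HarmAt.sub {h k : ℂ → ℝ} {F G : ℂ → ℂ} {z : ℂ} (H : HarmAt h F z) (K : HarmAt k G z) :
    HarmAt (fun w => h w - k w) (fun w => F w - G w) z := by
  obtain ⟨U, hU⟩ := H
  obtain ⟨V, hV⟩ := K
  refine ⟨fun w => U w - V w, ?_⟩
  filter_upwards [hU, hV] with w h1 h2 using ⟨h1.1.sub h2.1, by simp [h1.2, h2.2]⟩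

theorem HarmAt.congr {h k : ℂ → ℝ} {F : ℂ → ℂ} {z : ℂ} (H : HarmAt h F z) (e : k =ᶠ[𝓝 z] h) :
    HarmAt k F z := by
  obtain ⟨U, hU⟩ := H
  refine ⟨U, ?_⟩
  filter_upwards [hU, e] with w h1 h2 using ⟨h1.1, h2.trans h1.2⟩

theorem max_principle {K : Set ℂ} (hK : IsCompact K) {Φ : ℂ → ℝ} (hc : ContinuousOn Φ K) {B : ℝ}
    (h : ∀ z ∈ K, B < Φ z → K ∈ 𝓝 z ∧ ∃ p q L, JL Φ z p q L ∧ (p = 0 → q = 0 → 0 < L)) :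
    ∀ z ∈ K, Φ z ≤ B := by
  intro z hz
  by_contra hB
  push Not at hB
  obtain ⟨m, hm, hmax⟩ := hK.exists_isMaxOn ⟨z, hz⟩ hc
  have h1 : B < Φ m := hB.trans_le (hmax hz)
  obtain ⟨hn, p, q, L, hJ, hL⟩ := h m hm h1
  have h2 : IsLocalMax Φ m := hmax.isLocalMax hn
  obtain ⟨hp, hq, hL'⟩ := hJ.max h2
  linarith [hL hp hq]

theorem bernst {h e : ℂ → ℝ} {Fh Fe : ℂ → ℂ} {z₀ : ℂ} {ρ η : ℝ} (hρ : 0 < ρ) (hη : 0 ≤ η)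
    (hc : ContinuousOn h (closedBall z₀ ρ)) (ec : ContinuousOn e (closedBall z₀ ρ))
    (hh : ∀ z ∈ ball z₀ ρ, 0 < h z → HarmAt h Fh z) (he : ∀ z ∈ ball z₀ ρ, 0 < h z → HarmAt e Fe z)
    (hle : ∀ z ∈ ball z₀ ρ, 0 < h z → h z ≤ ‖Fe z‖)
    (heη : ∀ z ∈ closedBall z₀ ρ, |e z| ≤ η) : h z₀ ≤ 5 * η / ρ := by
  by_cases h0 : h z₀ ≤ 0
  · exact h0.trans (by positivity)
  push Not at h0
  set Φ : ℂ → ℝ := fun w => (ρ ^ 2 - Complex.normSq (w - z₀)) ^ 2 * (max (h w) 0) ^ 2 + 17 * ρ ^ 2 * (e w) ^ 2 with hΦ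
  have key : ∀ z ∈ closedBall z₀ ρ, Φ z ≤ 17 * ρ ^ 2 * η ^ 2 := by
    apply max_principle (isCompact_closedBall z₀ ρ)
    · have h1 : ContinuousOn (fun w => max (h w) 0) (closedBall z₀ ρ) := hc.sup continuousOn_const
      have h2 : Continuous (fun w => (ρ ^ 2 - Complex.normSq (w - z₀)) ^ 2) := by
        have := Complex.continuous_normSq
        fun_prop
      exact (h2.continuousOn.mul (h1.pow 2)).add (continuousOn_const.mul (ec.pow 2))
    · intro z hz hB
      have he2 : (e z) ^ 2 ≤ η ^ 2 := sq_le_sq' (by linarith [abs_le.1 (heη z hz)]) (abs_le.1 (heη z hz)).2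
      have hpos : 0 < (ρ ^ 2 - Complex.normSq (z - z₀)) ^ 2 * (max (h z) 0) ^ 2 := by
        have : 17 * ρ ^ 2 * (e z) ^ 2 ≤ 17 * ρ ^ 2 * η ^ 2 := by gcongr
        simp only [hΦ] at hB
        linarith
      have hhz : 0 < h z := by
        by_contra hn
        push Not at hn
        rw [max_eq_right hn] at hpos
        simp at hpos
      have hzb : z ∈ ball z₀ ρ := by
        rw [mem_closedBall, dist_eq_norm] at hz
        rw [mem_ball, dist_eq_norm]
        refine lt_of_le_of_ne hz ?_
        intro hq
        rw [Complex.normSq_eq_norm_sq, hq] at hpos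
        simp at hpos
      refine ⟨mem_of_superset (isOpen_ball.mem_nhds hzb) ball_subset_closedBall, ?_⟩
      have H := hh z hzb hhz
      have E := he z hzb hhz
      have hev : (fun w => max (h w) 0) =ᶠ[𝓝 z] h := by
        filter_upwards [H.continuousAt.eventually (lt_mem_nhds hhz)] with w hw
        exact max_eq_left hw.le
      have JH : JL (fun w => max (h w) 0) z _ _ _ := H.JL.congr hev
      have Jm := (JL.const (ρ ^ 2) z).sub (JL.normSq z₀ z)
      have J := (Jm.sq.mul JH.sq).add (E.JL.sq.cmul (17 * ρ ^ 2))
      refine ⟨_, _, _, J, fun _ _ => ?_⟩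
      have hF := hle z hzb hhz
      have hF2 : h z ^ 2 ≤ (Fe z).re ^ 2 + (Fe z).im ^ 2 := by
        have : h z ^ 2 ≤ ‖Fe z‖ ^ 2 := by gcongr
        rw [← Complex.normSq_eq_norm_sq, normSq_apply] at this
        nlinarith
      have hzn : Complex.normSq (z - z₀) ≤ ρ ^ 2 := by
        rw [Complex.normSq_eq_norm_sq]
        rw [mem_closedBall, dist_eq_norm] at hz
        gcongr
      simp only [max_eq_left hhz.le]
      have hns : Complex.normSq (z - z₀) = (z - z₀).re ^ 2 + (z - z₀).im ^ 2 := by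
        rw [normSq_apply]; ring
      rw [hns] at hzn ⊢
      generalize (z - z₀).re = x at *
      generalize (z - z₀).im = y at *
      generalize (Fh z).re = a at *
      generalize (Fh z).im = b at *
      generalize (Fe z).re = c at *
      generalize (Fe z).im = d at *
      generalize h z = H at *
      have hH2 : 0 < H ^ 2 := by positivity
      have hr : 0 < ρ ^ 2 := by positivity
      set m := ρ ^ 2 - (x ^ 2 + y ^ 2) with hm
      have hρ2 : ρ ^ 2 = m + (x ^ 2 + y ^ 2) := by rw [hm]; ring
      have hm0 : 0 ≤ m := by rw [hm]; linarith
      have e1 : 34 * ρ ^ 2 * H ^ 2 ≤ 34 * ρ ^ 2 * (c ^ 2 + d ^ 2) := by gcongr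
      have e2 : 0 ≤ 2 * ((m * a - 4 * H * x) ^ 2 + (m * b + 4 * H * y) ^ 2) := by positivity
      have e3 : 0 ≤ m * H ^ 2 := by positivity
      have e4 : 0 ≤ (x ^ 2 + y ^ 2) * H ^ 2 := by positivity
      have e5 : 0 < ρ ^ 2 * H ^ 2 := by positivity
      rw [hρ2] at e1 e5 ⊢
      linarith only [e1, e2, e3, e4, e5]
  have h2 := key z₀ (mem_closedBall_self hρ.le)
  simp only [hΦ, sub_self, map_zero, sub_zero, max_eq_left h0.le] at h2
  have h3 : (ρ ^ 2) ^ 2 * h z₀ ^ 2 ≤ 17 * ρ ^ 2 * η ^ 2 := by nlinarith [sq_nonneg (e z₀), sq_nonneg ρ, mul_nonneg (sq_nonneg ρ) (sq_nonneg (e z₀))]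
  have h4 : ρ ^ 2 * h z₀ ^ 2 ≤ 17 * η ^ 2 := by
    have : 0 < ρ ^ 2 := by positivity
    have h5 : ρ ^ 2 * (ρ ^ 2 * h z₀ ^ 2) ≤ ρ ^ 2 * (17 * η ^ 2) := by nlinarith
    exact le_of_mul_le_mul_left h5 this
  rw [le_div_iff₀ hρ]
  have h5 : (h z₀ * ρ) ^ 2 ≤ (5 * η) ^ 2 := by nlinarith [sq_nonneg η]
  exact le_of_sq_le_sq h5 (by positivity)

def NrmAt (Ω : Set ℂ) (u : ℂ → ℝ) (p n : ℂ) : Prop :=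
  ‖n‖ = 1 ∧ ∃ (φ : ℂ → ℝ) (l : ℝ) (L : ℂ →L[ℝ] ℝ), 0 < l ∧ HasStrictFDerivAt φ L p ∧ φ p = 0 ∧
    (∀ w, L w = l * ((starRingEnd ℂ) n * w).re) ∧
    ∀ᶠ w in 𝓝 p, w ∈ Ω ∧ (0 < u w ↔ 0 < φ w) ∧ (w ∈ FB Ω u ↔ φ w = 0)

structure Sol (Ω : Set ℂ) (u : ℂ → ℝ) (f N : ℂ → ℂ) : Prop where
  op : IsOpen Ω
  cont : ContinuousOn u Ω
  nonneg : ∀ z ∈ Ω, 0 ≤ u z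
  harm : ∀ z ∈ Ω, 0 < u z → HarmAt u f z
  fb1 : ∀ z ∈ FB Ω u, ∀ σ > 0, ∀ᶠ w in 𝓝 z, 0 < u w → |‖f w‖ - 1| < σ
  nrm : ∀ p ∈ FB Ω u, NrmAt Ω u p (N p)

theorem posSet_open {Ω : Set ℂ} {u : ℂ → ℝ} (op : IsOpen Ω) (hc : ContinuousOn u Ω) :
    IsOpen (posSet Ω u) := hc.isOpen_inter_preimage op isOpen_Ioi

theorem mem_FB {Ω : Set ℂ} {u : ℂ → ℝ} (op : IsOpen Ω) (hc : ContinuousOn u Ω)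
    (hn : ∀ z ∈ Ω, 0 ≤ u z) {z : ℂ} :
    z ∈ FB Ω u ↔ z ∈ Ω ∧ u z = 0 ∧ z ∈ closure (posSet Ω u) := by
  have ho := posSet_open op hc
  rw [FB, ho.frontier_eq]
  constructor
  · rintro ⟨h1, h2, h3⟩
    refine ⟨h1, ?_, h2⟩
    have : ¬ 0 < u z := fun h => h3 ⟨h1, h⟩
    linarith [hn z h1]
  · rintro ⟨h1, h2, h3⟩
    exact ⟨h1, h3, fun h => by have := h.2; linarith⟩

theorem sol_of_classical {Ω : Set ℂ} {u : ℂ → ℝ} (op : IsOpen Ω) (h : IsClassicalSolution Ω u) :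
    ∃ f N, Sol Ω u f N := by
  have ho := posSet_open op h.contOn
  have hN : ∀ p, ∃ n, p ∈ FB Ω u → NrmAt Ω u p n := by
    intro p
    by_cases hp : p ∈ FB Ω u
    swap
    · exact ⟨0, fun h => absurd h hp⟩
    obtain ⟨V, hVo, hpV, hVΩ, φ, hφ, hd, e1, e2, e3⟩ := h.fb_manifold p hp
    have hst : HasStrictFDerivAt φ (fderiv ℝ φ p) p := by
      have : ContDiffAt ℝ (⊤ : ℕ∞) φ p := hφ.contDiffAt (hVo.mem_nhds hpV)
      exact this.hasStrictFDerivAt (by simp)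
    set L := fderiv ℝ φ p with hL
    set n : ℂ := (L 1 : ℂ) + (L I : ℂ) * I with hn
    have hLw : ∀ w, L w = ((starRingEnd ℂ) n * w).re := by
      intro w
      have : w = w.re • (1:ℂ) + w.im • I := by
        apply Complex.ext <;> simp
      conv_lhs => rw [this]
      rw [map_add, map_smul, map_smul]
      simp [hn]; ring
    have hn0 : n ≠ 0 := by
      intro h0
      apply hd p hpV
      ext w
      have := hLw w
      rw [h0] at this
      simpa using this
    have hn1 : 0 < ‖n‖ := norm_pos_iff.2 hn0
    have hφ0 : φ p = 0 := by
      have : p ∈ V ∩ FB Ω u := ⟨hpV, hp⟩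
      rw [e3] at this
      exact this.2
    refine ⟨n / ‖n‖, fun _ => ⟨by simp [hn0], φ, ‖n‖, L, hn1, hst, hφ0, ?_, ?_⟩⟩
    · intro w
      rw [hLw]
      have : (starRingEnd ℂ) (n / ‖n‖) * w = ((starRingEnd ℂ) n * w) / (‖n‖ : ℝ) := by
        rw [map_div₀, conj_ofReal]; ring
      rw [this, div_ofReal_re]
      field_simp
    · filter_upwards [hVo.mem_nhds hpV] with w hw
      refine ⟨hVΩ hw, ?_, ?_⟩
      · have : w ∈ V ∩ posSet Ω u ↔ w ∈ {w ∈ V | 0 < φ w} := by rw [e1]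
        simp only [mem_inter_iff, hw, true_and, posSet, mem_setOf_eq, hVΩ hw] at this
        exact this
      · have : w ∈ V ∩ FB Ω u ↔ w ∈ {w ∈ V | φ w = 0} := by rw [e3]
        simpa [hw] using this
  choose N hN using hN
  refine ⟨fun w => (starRingEnd ℂ) (grad2 u w), N, op, h.contOn, h.nonneg, ?_, ?_, hN⟩
  · intro z hz hu
    have hzp : z ∈ posSet Ω u := ⟨hz, hu⟩
    obtain ⟨R, hR, hball⟩ := Metric.isOpen_iff.1 ho z hzp
    have hharm : InnerProductSpace.HarmonicOnNhd u (ball z R) := by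
      intro w hw
      have hcd : ∀ y ∈ posSet Ω u, ContDiffAt ℝ 2 u y := fun y hy =>
        h.harm.1.contDiffAt (ho.mem_nhds hy)
      refine ⟨hcd w (hball hw), ?_⟩
      filter_upwards [ho.mem_nhds (hball hw)] with y hy
      rw [InnerProductSpace.laplacian_eq_iteratedFDeriv_complexPlane]
      simp only [iteratedFDeriv_two_apply]
      have h2 := h.harm.2 y hy
      have hdiff : DifferentiableAt ℝ (fderiv ℝ u) y := by
        have := (hcd y hy).fderiv_right (m := 1) (by norm_num)
        exact this.differentiableAt (by norm_num)
      simp only [hess] at h2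
      rw [fderiv_clm_apply hdiff (by fun_prop), fderiv_clm_apply hdiff (by fun_prop)] at h2
      simpa using h2
    obtain ⟨F, hF, hFu⟩ := hharm.exists_analyticOnNhd_ball_re_eq
    refine ⟨F, ?_⟩
    filter_upwards [isOpen_ball.mem_nhds (mem_ball_self hR)] with w hw
    have hFd : HasDerivAt F (deriv F w) w := (hF w hw).differentiableAt.hasDerivAt
    refine ⟨?_, (hFu hw).symm⟩
    refine hFd.congr_deriv ?_
    symm
    have hr : HasFDerivAt u (reCLM.comp ((deriv F w) • (1 : ℂ →L[ℝ] ℂ))) w := by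
      have h1 := (hFd.hasFDerivAt.restrictScalars ℝ)
      have h2 := reCLM.hasFDerivAt.comp w h1
      have h3 := h2.congr_of_eventuallyEq (f₁ := u) (by
        filter_upwards [isOpen_ball.mem_nhds hw] with y hy using (hFu hy).symm)
      refine h3.congr_fderiv ?_
      ext v <;> simp [mul_comm]
    rw [grad2, hr.fderiv]
    apply Complex.ext <;> simp
  · intro z hz σ hσ
    have h1 := h.grad_one z hz
    have h2 := h1.eventually (Metric.ball_mem_nhds 1 hσ)
    rw [eventually_nhdsWithin_iff] at h2
    filter_upwards [h2, op.mem_nhds hz.1] with w hw hwo hu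
    have := hw ⟨hwo, hu⟩
    rw [Real.dist_eq] at this
    simpa using this

section transport

variable {Ω : Set ℂ} {u : ℂ → ℝ} {f N : ℂ → ℂ}

theorem FB_preimage (e : ℂ ≃ₜ ℂ) (k : ℝ) (hk : 0 < k) :
    FB (e ⁻¹' Ω) (fun z => u (e z) / k) = e ⁻¹' FB Ω u := by
  have : posSet (e ⁻¹' Ω) (fun z => u (e z) / k) = e ⁻¹' posSet Ω u := by
    ext z; simp [posSet, div_pos_iff, hk, hk.le.not_gt]
  rw [FB, this, ← e.preimage_frontier, ← preimage_inter]; rfl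

noncomputable def affH (a b : ℂ) (ha : a ≠ 0) : ℂ ≃ₜ ℂ := (Homeomorph.mulLeft₀ a ha).trans (Homeomorph.addRight b)

theorem Sol.affine (S : Sol Ω u f N) (a b : ℂ) (ha : a ≠ 0) :
    Sol ((fun z => a * z + b) ⁻¹' Ω) (fun z => u (a * z + b) / ‖a‖)
      (fun z => f (a * z + b) * a / ‖a‖) (fun z => N (a * z + b) * (starRingEnd ℂ) a / ‖a‖) := by
  have hk : 0 < ‖a‖ := norm_pos_iff.2 ha
  have hA : Continuous (fun z => a * z + b) := by fun_prop
  have hFB : FB ((fun z => a * z + b) ⁻¹' Ω) (fun z => u (a * z + b) / ‖a‖) =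
      (fun z => a * z + b) ⁻¹' FB Ω u := FB_preimage (affH a b ha) ‖a‖ hk
  have hpos : ∀ z, 0 < u (a * z + b) / ‖a‖ ↔ 0 < u (a * z + b) := by
    intro z; simp [div_pos_iff, hk, hk.le.not_gt]
  refine ⟨S.op.preimage hA, ?_, ?_, ?_, ?_, ?_⟩
  · exact (S.cont.comp hA.continuousOn (fun z hz => hz)).div_const _
  · intro z hz; exact div_nonneg (S.nonneg _ hz) hk.le
  · intro z hz hu
    obtain ⟨U, hU⟩ := S.harm _ hz ((hpos z).1 hu)
    refine ⟨fun w => U (a * w + b) / ‖a‖, ?_⟩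
    filter_upwards [hA.continuousAt.eventually hU] with w hw
    refine ⟨?_, by rw [hw.2, div_ofReal_re]⟩
    have h2 : HasDerivAt (fun w : ℂ => a * w + b) a w := by
      simpa using ((hasDerivAt_id w).const_mul a).add_const b
    exact (hw.1.comp w h2).div_const _
  · intro z hz σ hσ
    rw [hFB] at hz
    filter_upwards [hA.continuousAt.eventually (S.fb1 _ hz σ hσ)] with w hw hu
    have := hw ((hpos w).1 hu)
    simpa [hk.ne'] using this
  · intro p hp
    rw [hFB] at hp
    obtain ⟨hn, φ, l, L, hl, hst, hφ0, hL, hev⟩ := S.nrm _ hp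
    refine ⟨by simp [hn, hk.ne'], fun w => φ (a * w + b), l * ‖a‖,
      L.comp (a • (1 : ℂ →L[ℝ] ℂ)), by positivity, ?_, hφ0, ?_, ?_⟩
    · have h2 : HasStrictFDerivAt (fun w : ℂ => a * w + b) (a • (1 : ℂ →L[ℝ] ℂ)) p := by
        exact ((hasStrictFDerivAt_id (𝕜 := ℝ) p).const_smul a).add_const b
      exact hst.comp p h2
    · intro w
      simp only [ContinuousLinearMap.comp_apply, ContinuousLinearMap.smul_apply,
        ContinuousLinearMap.one_apply, smul_eq_mul, hL]
      have : (starRingEnd ℂ) (N (a * p + b) * (starRingEnd ℂ) a / ‖a‖) * w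
        = ((starRingEnd ℂ) (N (a * p + b)) * (a * w)) / (‖a‖ : ℝ) := by
        rw [map_div₀, conj_ofReal, map_mul, conj_conj]; ring
      rw [this, div_ofReal_re]; field_simp
    · filter_upwards [hA.continuousAt.eventually hev] with w hw
      rw [hFB, hpos]
      exact hw

theorem hasDerivAt_conj_conj' {U : ℂ → ℂ} {F w : ℂ} (h : HasDerivAt U F ((starRingEnd ℂ) w)) :
    HasDerivAt (fun z => (starRingEnd ℂ) (U ((starRingEnd ℂ) z))) ((starRingEnd ℂ) F) w := by
  have := h.conj_conj
  simpa [Function.comp_def] using this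

theorem Sol.conj (S : Sol Ω u f N) :
    Sol ((starRingEnd ℂ) ⁻¹' Ω) (fun z => u ((starRingEnd ℂ) z))
      (fun z => (starRingEnd ℂ) (f ((starRingEnd ℂ) z)))
      (fun z => (starRingEnd ℂ) (N ((starRingEnd ℂ) z))) := by
  have hA : Continuous (fun z => (starRingEnd ℂ) z) := continuous_conj
  have hFB : FB ((starRingEnd ℂ) ⁻¹' Ω) (fun z => u ((starRingEnd ℂ) z)) =
      (starRingEnd ℂ) ⁻¹' FB Ω u := by
    have := FB_preimage (Ω := Ω) (u := u) conjCLE.toHomeomorph 1 one_pos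
    simp only [div_one] at this
    exact this
  refine ⟨S.op.preimage hA, ?_, ?_, ?_, ?_, ?_⟩
  · exact (S.cont.comp hA.continuousOn (fun z hz => hz))
  · intro z hz; exact (S.nonneg _ hz)
  · intro z hz hu
    obtain ⟨U, hU⟩ := S.harm _ hz hu
    refine ⟨fun w => (starRingEnd ℂ) (U ((starRingEnd ℂ) w)), ?_⟩
    filter_upwards [hA.continuousAt.eventually hU] with w hw
    exact ⟨hasDerivAt_conj_conj' hw.1, by simpa using hw.2⟩
  · intro z hz σ hσ
    rw [hFB] at hz
    filter_upwards [hA.continuousAt.eventually (S.fb1 _ hz σ hσ)] with w hw hu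
    have := hw hu
    simpa using this
  · intro p hp
    rw [hFB] at hp
    obtain ⟨hn, φ, l, L, hl, hst, hφ0, hL, hev⟩ := S.nrm _ hp
    refine ⟨by simpa using hn, fun w => φ ((starRingEnd ℂ) w), l,
      L.comp (conjCLE : ℂ →L[ℝ] ℂ), hl, ?_, hφ0, ?_, ?_⟩
    · exact hst.comp p (conjCLE : ℂ →L[ℝ] ℂ).hasStrictFDerivAt
    · intro w
      simp [hL]
    · filter_upwards [hA.continuousAt.eventually hev] with w hw
      rw [hFB]
      exact hw

end transport

section basic
variable {Ω : Set ℂ} {u : ℂ → ℝ} {f N : ℂ → ℂ}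

theorem Sol.memFB (S : Sol Ω u f N) {z : ℂ} :
    z ∈ FB Ω u ↔ z ∈ Ω ∧ u z = 0 ∧ z ∈ closure (posSet Ω u) := mem_FB S.op S.cont S.nonneg

theorem Sol.cAt (S : Sol Ω u f N) {z : ℂ} (hz : z ∈ Ω) : ContinuousAt u z :=
  S.cont.continuousAt (S.op.mem_nhds hz)

theorem Sol.fcont (S : Sol Ω u f N) {z : ℂ} (hz : z ∈ Ω) (hu : 0 < u z) : ContinuousAt f z :=
  (S.harm z hz hu).analyticAt.continuousAt

theorem Sol.not_fb (S : Sol Ω u f N) {z : ℂ} (hz : z ∈ Ω) (hu : u z = 0) (h : z ∉ FB Ω u) :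
    ∀ᶠ w in 𝓝 z, w ∈ Ω ∧ u w = 0 := by
  have : z ∉ closure (posSet Ω u) := fun h' => h (S.memFB.2 ⟨hz, hu, h'⟩)
  filter_upwards [isClosed_closure.isOpen_compl.mem_nhds this, S.op.mem_nhds hz] with w h1 h2
  refine ⟨h2, ?_⟩
  have : ¬ 0 < u w := fun h' => h1 (subset_closure ⟨h2, h'⟩)
  linarith [S.nonneg w h2]

noncomputable def qf (u : ℂ → ℝ) (f : ℂ → ℂ) (z : ℂ) : ℝ := if 0 < u z then Real.log (max ‖f z‖ 1) else 0

theorem qf_nonneg (z : ℂ) : 0 ≤ qf u f z := by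
  unfold qf; split_ifs
  · exact Real.log_nonneg (le_max_right _ _)
  · rfl

theorem qf_pos {z : ℂ} (h : 0 < qf u f z) : 0 < u z ∧ 1 < ‖f z‖ ∧ qf u f z = Real.log ‖f z‖ := by
  unfold qf at h ⊢; split_ifs at h ⊢ with h1
  · have : 1 < ‖f z‖ := by
      by_contra hn
      push Not at hn
      rw [max_eq_right hn] at h; simp at h
    exact ⟨h1, this, by rw [max_eq_left this.le]⟩
  · exact absurd h (lt_irrefl _)

theorem qf_zero {z : ℂ} (h : u z ≤ 0) : qf u f z = 0 := by
  unfold qf; rw [if_neg h.not_gt]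

theorem f_le_exp {z : ℂ} (h : 0 < u z) : ‖f z‖ ≤ Real.exp (qf u f z) := by
  unfold qf; rw [if_pos h, Real.exp_log (by positivity)]; exact le_max_left _ _

theorem Sol.q_cont (S : Sol Ω u f N) : ContinuousOn (qf u f) Ω := by
  intro z hz
  refine ContinuousAt.continuousWithinAt ?_
  rcases (S.nonneg z hz).lt_or_eq with hu | hu
  · have h1 : ContinuousAt (fun w => Real.log (max ‖f w‖ 1)) z := by
      have := S.fcont hz hu
      have h2 : ContinuousAt (fun w => max ‖f w‖ 1) z := this.norm.sup continuousAt_const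
      exact h2.log (by positivity)
    refine h1.congr ?_
    filter_upwards [(S.cAt hz).eventually (lt_mem_nhds hu)] with w hw
    rw [qf, if_pos hw]
  · by_cases hF : z ∈ FB Ω u
    · rw [ContinuousAt, qf_zero hu.symm.le]
      rw [Metric.tendsto_nhds]
      intro ε hε
      filter_upwards [S.fb1 z hF (Real.exp ε - 1) (by simpa using hε)] with w hw
      rw [Real.dist_eq, sub_zero, abs_of_nonneg (qf_nonneg w)]
      by_cases h0 : 0 < qf u f w
      · obtain ⟨h1, h2, h3⟩ := qf_pos h0
        rw [h3, Real.log_lt_iff_lt_exp (by linarith)]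
        linarith [(abs_lt.1 (hw h1)).2]
      · linarith
    · have := S.not_fb hz hu.symm hF
      have h0 : (fun _ => (0:ℝ)) =ᶠ[𝓝 z] qf u f := by
        filter_upwards [this] with w hw
        rw [qf_zero hw.2.le]
      exact continuousAt_const.congr h0

theorem Sol.q_harm (S : Sol Ω u f N) {z : ℂ} (hz : z ∈ Ω) (hq : 0 < qf u f z) :
    HarmAt (qf u f) (fun w => deriv f w / f w) z := by
  obtain ⟨hu, h1, -⟩ := qf_pos hq
  have hf0 : f z ≠ 0 := by intro h; rw [h] at h1; simp at h1; linarith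
  have han := (S.harm z hz hu).analyticAt
  have hq' : ∀ᶠ w in 𝓝 z, 0 < qf u f w :=
    (S.q_cont.continuousAt (S.op.mem_nhds hz)).eventually (lt_mem_nhds hq)
  refine ⟨fun w => Complex.log (f w / f z) + Complex.log (f z), ?_⟩
  have hsl : ∀ᶠ w in 𝓝 z, f w / f z ∈ slitPlane := by
    have hc : ContinuousAt (fun w => f w / f z) z := han.continuousAt.div_const _
    refine hc.eventually (isOpen_slitPlane.mem_nhds ?_)
    show f z / f z ∈ slitPlane
    rw [div_self hf0]; exact one_mem_slitPlane
  filter_upwards [hsl, hq', han.eventually_analyticAt] with w h2 h3 h4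
  obtain ⟨-, h5, h6⟩ := qf_pos h3
  have hfw : f w ≠ 0 := by intro h; rw [h] at h5; simp at h5; linarith
  constructor
  · have h7 : HasDerivAt (fun w => f w / f z) (deriv f w / f z) w :=
      h4.differentiableAt.hasDerivAt.div_const _
    have h8 := (h7.clog h2).add_const (Complex.log (f z))
    refine h8.congr_deriv ?_
    field_simp
  · rw [h6, add_re, log_re, log_re, norm_div, Real.log_div (by simpa using hfw) (by simpa using hf0)]
    ring

end basic

section P3
variable {Ω : Set ℂ} {u : ℂ → ℝ} {f N : ℂ → ℂ}

theorem sq_re_im (a : ℂ) : a.re ^ 2 + (-a.im) ^ 2 = ‖a‖ ^ 2 := by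
  rw [← Complex.normSq_eq_norm_sq, normSq_apply]; ring

theorem Sol.q_growth (S : Sol Ω u f N) {z₀ : ℂ} {ρ K ε : ℝ} (hρ : 0 < ρ)
    (hsub : closedBall z₀ ρ ⊆ Ω) (hu : ∀ z ∈ closedBall z₀ ρ, u z ≤ K * ρ)
    (hq : ∀ z ∈ closedBall z₀ ρ, qf u f z ≤ ε) : qf u f z₀ ≤ 4 * K * ε * u z₀ / ρ := by
  have hε : 0 ≤ ε := (qf_nonneg z₀).trans (hq z₀ (mem_closedBall_self hρ.le))
  have key : ∀ z ∈ closedBall z₀ ρ, (qf u f z - (4 * ε / ρ ^ 2) *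
      (K * ρ * u z - u z ^ 2 + 1 / 4 * Complex.normSq (z - z₀))) ≤ 0 := by
    apply max_principle (isCompact_closedBall z₀ ρ)
    · have h1 := S.q_cont.mono hsub
      have h2 := S.cont.mono hsub
      have h3 : Continuous (fun z => Complex.normSq (z - z₀)) :=
        Complex.continuous_normSq.comp (continuous_id.sub continuous_const)
      exact h1.sub (continuousOn_const.mul (((continuousOn_const.mul h2).sub (h2.pow 2)).add
        (continuousOn_const.mul h3.continuousOn)))
    · intro z hz hpos
      have hu0 := S.nonneg z (hsub hz)
      have h1 : 0 ≤ K * ρ * u z - u z ^ 2 := by nlinarith [hu z hz]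
      have hns := Complex.normSq_nonneg (z - z₀)
      have hq0 : 0 < qf u f z := by
        have : 0 ≤ (4 * ε / ρ ^ 2) * (K * ρ * u z - u z ^ 2 + 1 / 4 * Complex.normSq (z - z₀)) := by
          positivity
        linarith
      have hε0 : 0 < ε := hq0.trans_le (hq z hz)
      obtain ⟨hup, hf, -⟩ := qf_pos hq0
      have hzb : z ∈ ball z₀ ρ := by
        rw [mem_closedBall, dist_eq_norm] at hz
        rw [mem_ball, dist_eq_norm]
        refine lt_of_le_of_ne hz ?_
        intro he
        rw [Complex.normSq_eq_norm_sq, he] at hpos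
        have h2 : (4 * ε / ρ ^ 2) * (1 / 4 * ρ ^ 2) = ε := by field_simp
        have h3 : 0 ≤ (4 * ε / ρ ^ 2) * (K * ρ * u z - u z ^ 2) := by positivity
        have := hq z (by rw [mem_closedBall, dist_eq_norm]; exact hz)
        nlinarith
      refine ⟨mem_of_superset (isOpen_ball.mem_nhds hzb) ball_subset_closedBall, ?_⟩
      have J1 := (S.q_harm (hsub hz) hq0).JL
      have J2 := (S.harm z (hsub hz) hup).JL
      have J := J1.sub ((((J2.cmul (K * ρ)).sub J2.sq).add ((JL.normSq z₀ z).cmul (1/4))).cmul (4 * ε / ρ ^ 2))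
      refine ⟨_, _, _, J, fun _ _ => ?_⟩
      rw [sq_re_im]
      have h4 : 0 < 4 * ε / ρ ^ 2 := by positivity
      have h5 : 1 < ‖f z‖ ^ 2 := by nlinarith
      nlinarith
  have h := key z₀ (mem_closedBall_self hρ.le)
  simp only [sub_self, map_zero, mul_zero, add_zero] at h
  have h2 : 4 * ε / ρ ^ 2 * (K * ρ * u z₀ - u z₀ ^ 2) = 4 * K * ε * u z₀ / ρ - 4 * ε / ρ ^ 2 * u z₀ ^ 2 := by
    field_simp
  have h3 : 0 ≤ 4 * ε / ρ ^ 2 * u z₀ ^ 2 := by positivity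
  linarith

theorem HarmAt.hasDerivAt_line {h : ℂ → ℝ} {F : ℂ → ℂ} {z ω : ℂ} {t : ℝ} (H : HarmAt h F (z + t * ω)) :
    HasDerivAt (fun s : ℝ => h (z + s * ω)) (F (z + t * ω) * ω).re t := by
  obtain ⟨U, hU⟩ := H
  have hc : ContinuousAt (fun s : ℝ => z + s * ω) t := by fun_prop
  exact (hasDerivAt_re_line hU.self_of_nhds.1).congr_of_eventuallyEq
    ((hc.eventually hU).mono fun s hs => hs.2)

theorem Sol.lip (S : Sol Ω u f N) {z ζ : ℂ} {L : ℝ} (hL : 0 ≤ L)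
    (hseg : ∀ t ∈ Icc (0:ℝ) 1, ζ + t * (z - ζ) ∈ Ω) (hζ : u ζ = 0)
    (hf : ∀ t ∈ Icc (0:ℝ) 1, 0 < u (ζ + t * (z - ζ)) → ‖f (ζ + t * (z - ζ))‖ ≤ L) :
    u z ≤ L * ‖z - ζ‖ := by
  set g : ℝ → ℝ := fun t => u (ζ + t * (z - ζ)) with hg
  have hgc : ContinuousOn g (Icc 0 1) := S.cont.comp (by fun_prop) hseg
  have hz1 : u z = g 1 := by simp [hg]
  set Z := Icc (0:ℝ) 1 ∩ g ⁻¹' {0} with hZ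
  have hZc : IsCompact Z := isCompact_Icc.of_isClosed_subset
    (hgc.preimage_isClosed_of_isClosed isClosed_Icc isClosed_singleton) inter_subset_left
  have hZ0 : (0:ℝ) ∈ Z := ⟨by simp, by simp [hg, hζ]⟩
  obtain ⟨t0, ht0, hmax⟩ := hZc.exists_isGreatest ⟨0, hZ0⟩
  have hpos : ∀ t ∈ Ioc t0 1, 0 < g t := by
    intro t ht
    have htI : t ∈ Icc (0:ℝ) 1 := ⟨ht0.1.1.trans ht.1.le, ht.2⟩
    refine lt_of_le_of_ne (S.nonneg _ (hseg t htI)) ?_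
    intro h0
    have := hmax (show t ∈ Z from ⟨htI, by simpa using h0.symm⟩)
    linarith [ht.1]
  have hd : ∀ t ∈ Ioo t0 1, HasDerivAt g (f (ζ + t * (z - ζ)) * (z - ζ)).re t := by
    intro t ht
    exact (S.harm _ (hseg t ⟨ht0.1.1.trans ht.1.le, ht.2.le⟩) (hpos t ⟨ht.1, ht.2.le⟩)).hasDerivAt_line
  have hsub : Icc t0 1 ⊆ Icc (0:ℝ) 1 := Icc_subset_Icc_left ht0.1.1
  have := Convex.image_sub_le_mul_sub_of_deriv_le (convex_Icc t0 1) (hgc.mono hsub)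
    (fun t ht => by
      rw [interior_Icc] at ht
      exact (hd t ht).differentiableAt.differentiableWithinAt)
    (C := L * ‖z - ζ‖) (fun t ht => by
      rw [interior_Icc] at ht
      rw [(hd t ht).deriv]
      refine (re_le_norm _).trans ?_
      rw [norm_mul]
      gcongr
      exact hf t ⟨ht0.1.1.trans ht.1.le, ht.2.le⟩ (hpos t ⟨ht.1, ht.2.le⟩))
    t0 (left_mem_Icc.2 ht0.1.2) 1 (right_mem_Icc.2 ht0.1.2) ht0.1.2
  have h0 : g t0 = 0 := ht0.2
  rw [h0, sub_zero] at this
  rw [hz1]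
  refine this.trans ?_
  have h1 : 0 ≤ L * ‖z - ζ‖ := by positivity
  nlinarith [ht0.1.1]

theorem deriv_le_of_right {g : ℝ → ℝ} {D k : ℝ} (h : HasDerivAt g D 0)
    (hk : ∀ᶠ t in 𝓝[>] (0:ℝ), g t ≤ g 0 + k * t) : D ≤ k := by
  have h1 := (hasDerivAt_iff_tendsto_slope.1 h).mono_left
    (nhdsWithin_mono (0:ℝ) (fun x (hx : x ∈ Ioi (0:ℝ)) => ne_of_gt hx))
  refine le_of_tendsto h1 ?_
  filter_upwards [hk, self_mem_nhdsWithin] with t ht htp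
  rw [slope_def_field, sub_zero, div_le_iff₀ htp]; linarith

theorem Sol.nondeg (S : Sol Ω u f N) {z₁ : ℂ} (hz₁ : z₁ ∈ FB Ω u) {σ : ℝ} (hσ : 0 < σ) (hσ1 : σ < 1) :
    ∀ᶠ η in 𝓝[>] (0:ℝ), ∃ z, ‖z - z₁‖ = η ∧ (1 - σ) * η ≤ u z ∧ 0 < u z := by
  obtain ⟨r, hr, hball⟩ := Metric.eventually_nhds_iff.1
    ((S.fb1 z₁ hz₁ (σ/2) (by positivity)).and (S.op.mem_nhds hz₁.1))
  filter_upwards [Ioo_mem_nhdsGT hr] with η hη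
  by_contra hno
  push Not at hno
  have hlt : ∀ z, ‖z - z₁‖ = η → u z ≤ (1 - σ) * η := by
    intro z hz
    by_contra hc
    push Not at hc
    have h2 : 0 < (1 - σ) * η := mul_pos (by linarith) hη.1
    linarith [hno z hz hc.le]
  obtain ⟨hzΩ, hu0, hcl⟩ := S.memFB.1 hz₁
  set τ := σ * η / 4 with hτ
  have hτ0 : 0 < τ := by have := hη.1; positivity
  obtain ⟨z', hz', hd⟩ := Metric.mem_closure_iff.1 hcl τ hτ0
  have hτη : τ < η := by rw [hτ]; nlinarith [hη.1]
  have hKsub : ∀ z ∈ closedBall z₁ η, dist z z₁ < r := fun z hz => (mem_closedBall.1 hz).trans_lt hη.2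
  have hcont : ContinuousOn (fun z => u z - (1 - σ/2) * ‖z - z'‖) (closedBall z₁ η) := by
    refine (S.cont.mono fun z hz => (hball (hKsub z hz)).2).sub ?_
    fun_prop
  have hz'K : z' ∈ closedBall z₁ η := by
    rw [mem_closedBall, dist_comm]; linarith
  obtain ⟨m, hm, hmax⟩ := (isCompact_closedBall z₁ η).exists_isMaxOn ⟨z', hz'K⟩ hcont
  have h1 : 0 < u m - (1 - σ/2) * ‖m - z'‖ := by
    have := hmax hz'K
    simp only [mem_setOf_eq, sub_self, norm_zero, mul_zero, sub_zero] at this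
    linarith [hz'.2]
  have hc0 : 0 < 1 - σ/2 := by linarith
  have hum : 0 < u m := by nlinarith [norm_nonneg (m - z')]
  have hmb : m ∈ ball z₁ η := by
    rw [mem_closedBall, dist_eq_norm] at hm
    rw [mem_ball, dist_eq_norm]
    refine lt_of_le_of_ne hm fun he => ?_
    have h2 := hlt m he
    have h3 : η - τ ≤ ‖m - z'‖ := by
      have : ‖m - z₁‖ ≤ ‖m - z'‖ + ‖z₁ - z'‖ := by
        have := norm_sub_le (m - z') (z₁ - z')
        simpa using this
      rw [dist_eq_norm] at hd
      linarith
    have h4 : (1 - σ/2) * (η - τ) ≤ (1 - σ/2) * ‖m - z'‖ := by gcongr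
    have : (1 - σ/2) * τ ≤ τ := by nlinarith
    nlinarith
  have hmr := hball (hKsub m hm)
  have hfm := (abs_lt.1 (hmr.1 hum)).1
  have hH := S.harm m hmr.2 hum
  set ω := (starRingEnd ℂ) (f m) with hω
  have hder : HasDerivAt (fun s : ℝ => u (m + s * ω)) (f m * ω).re 0 := by
    have := HarmAt.hasDerivAt_line (z := m) (ω := ω) (t := 0) (by simpa using hH)
    simpa using this
  have hle : (f m * ω).re ≤ (1 - σ/2) * ‖ω‖ := by
    apply deriv_le_of_right hder
    have : ∀ᶠ t : ℝ in 𝓝 0, m + t * ω ∈ ball z₁ η := (tendsto_line m ω).eventually (isOpen_ball.mem_nhds hmb)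
    filter_upwards [this.filter_mono nhdsWithin_le_nhds, self_mem_nhdsWithin] with t ht htp
    have h5 := hmax (ball_subset_closedBall ht)
    simp only [mem_setOf_eq] at h5
    have h6 : ‖m + t * ω - z'‖ ≤ ‖m - z'‖ + t * ‖ω‖ := by
      have : m + t * ω - z' = (m - z') + t * ω := by ring
      rw [this]
      refine (norm_add_le _ _).trans ?_
      rw [norm_mul, norm_real, Real.norm_of_nonneg (le_of_lt htp)]
    have h7 := mul_le_mul_of_nonneg_left h6 hc0.le
    simp only [ofReal_zero, zero_mul, add_zero]
    nlinarith
  rw [hω, mul_conj, ofReal_re, Complex.normSq_eq_norm_sq, norm_conj] at hle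
  have : 0 < ‖f m‖ := by linarith
  nlinarith

set_option maxHeartbeats 1000000 in
theorem Sol.no_touch (S : Sol Ω u f N) {z₁ c : ℂ} {ϱ M : ℝ} (hz₁ : z₁ ∈ FB Ω u) (hϱ : 0 < ϱ)
    (hc : ‖z₁ - c‖ = ϱ) (hM : 0 ≤ M) (hMϱ : M ≤ 0.01 / ϱ)
    (hpos : ∀ᶠ w in 𝓝 z₁, 0 < u w → ‖w - c‖ ≤ ϱ) (hq : ∀ᶠ w in 𝓝 z₁, qf u f w ≤ M * u w) : False := by
  obtain ⟨r, hr, hball⟩ := Metric.eventually_nhds_iff.1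
    ((((S.fb1 z₁ hz₁ 1 one_pos).and (S.op.mem_nhds hz₁.1)).and hpos).and hq)
  have hpos' : ∀ w, dist w z₁ < r → 0 < u w → ‖w - c‖ < ϱ := by
    intro w hw hu
    refine lt_of_le_of_ne ((hball hw).1.2 hu) fun he => ?_
    have hwc : w ∈ closure (closedBall c ϱ)ᶜ := by
      rw [closure_compl, interior_closedBall _ hϱ.ne', mem_compl_iff, mem_ball, dist_eq_norm]
      linarith
    have hev : ∀ᶠ y in 𝓝 w, dist y z₁ < r ∧ 0 < u y := by
      filter_upwards [isOpen_ball.mem_nhds (show w ∈ ball z₁ r from hw),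
        (S.cAt (hball hw).1.1.2).eventually (lt_mem_nhds hu)] with y h1 h2 using ⟨h1, h2⟩
    obtain ⟨y, hy, hy2⟩ := mem_closure_iff_nhds.1 hwc _ hev
    exact hy2 (by rw [mem_closedBall, dist_eq_norm]; exact (hball hy.1).1.2 hy.2)
  set η := min (r / 4) (min (0.1 * ϱ) (1 / (4 * M + 1))) with hη
  have hη0 : 0 < η := by positivity
  have hη1 : η ≤ r / 4 := min_le_left _ _
  have hη2 : η ≤ 0.1 * ϱ := (min_le_right _ _).trans (min_le_left _ _)
  have hη3 : 2 * M * η ≤ 1 := by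
    have h1 : η ≤ 1 / (4 * M + 1) := (min_le_right _ _).trans (min_le_right _ _)
    rw [le_div_iff₀ (by positivity)] at h1
    nlinarith
  have hzero : ∀ w, dist w z₁ < r → ϱ ≤ ‖w - c‖ → u w = 0 := by
    intro w hw h
    by_contra h0
    have := hpos' w hw (lt_of_le_of_ne (S.nonneg w (hball hw).1.1.2) (Ne.symm h0))
    linarith
  have hDη : ∀ z, ϱ - ‖z - c‖ ≤ ‖z - z₁‖ := by
    intro z
    have := norm_sub_norm_le (z₁ - c) (z - c)
    rw [hc, sub_sub_sub_cancel_right, norm_sub_rev z₁ z] at this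
    linarith
  have rad : ∀ L : ℝ, 0 ≤ L → ∀ z, ‖z - z₁‖ ≤ η → ‖z - c‖ ≤ ϱ →
      (∀ w, ‖w - z₁‖ ≤ 2 * ‖z - z₁‖ → ϱ - ‖w - c‖ ≤ ϱ - ‖z - c‖ → 0 < u w → ‖f w‖ ≤ L) →
      u z ≤ L * (ϱ - ‖z - c‖) := by
    intro L hL z hz hzc hf
    have hs : 0.9 * ϱ ≤ ‖z - c‖ := by
      have := norm_sub_norm_le (z₁ - c) (z₁ - z)
      rw [hc, norm_sub_rev z₁ z] at this
      have h2 : z₁ - c - (z₁ - z) = z - c := by ring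
      rw [h2] at this; linarith
    have hs0 : 0 < ‖z - c‖ := by nlinarith
    set ζ := c + (ϱ / ‖z - c‖ : ℝ) * (z - c) with hζ
    have e1 : ∀ t : ℝ, ζ + t * (z - ζ) = c + (ϱ / ‖z - c‖ + t * (1 - ϱ / ‖z - c‖) : ℝ) * (z - c) := by
      intro t; rw [hζ]; push_cast; ring
    have e2 : ∀ t ∈ Icc (0:ℝ) 1, ‖ζ + t * (z - ζ) - c‖ = ϱ - t * (ϱ - ‖z - c‖) := by
      intro t ht
      rw [e1, add_sub_cancel_left, norm_mul, norm_real, Real.norm_eq_abs, abs_of_nonneg]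
      · field_simp; ring
      · have h1 : 1 ≤ ϱ / ‖z - c‖ := by rw [le_div_iff₀ hs0]; linarith
        nlinarith [ht.1, ht.2]
    have e3 : ∀ t ∈ Icc (0:ℝ) 1, ‖ζ + t * (z - ζ) - z‖ = (1 - t) * (ϱ - ‖z - c‖) := by
      intro t ht
      have : ζ + t * (z - ζ) - z = (((1 - t) * (ϱ - ‖z - c‖) / ‖z - c‖ : ℝ) : ℂ) * (z - c) := by
        rw [e1]
        have : (‖z - c‖ : ℂ) ≠ 0 := by exact_mod_cast hs0.ne'
        push_cast; field_simp; ring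
      rw [this, norm_mul, norm_real, Real.norm_eq_abs, abs_of_nonneg]
      · field_simp
      · have : 0 ≤ (1 - t) * (ϱ - ‖z - c‖) := mul_nonneg (by linarith [ht.2]) (by linarith)
        positivity
    have hD := hDη z
    have e4 : ∀ t ∈ Icc (0:ℝ) 1, ‖ζ + t * (z - ζ) - z₁‖ ≤ 2 * ‖z - z₁‖ := by
      intro t ht
      have := norm_add_le (ζ + t * (z - ζ) - z) (z - z₁)
      rw [sub_add_sub_cancel, e3 t ht] at this
      nlinarith [ht.1, ht.2]
    have e5 : ∀ t ∈ Icc (0:ℝ) 1, dist (ζ + t * (z - ζ)) z₁ < r := by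
      intro t ht; rw [dist_eq_norm]; linarith [e4 t ht]
    have hz0 : u ζ = 0 := by
      have h0 : (0:ℝ) ∈ Icc (0:ℝ) 1 := by simp
      have h1 := e5 0 h0
      have h2 := e2 0 h0
      simp only [ofReal_zero, zero_mul, add_zero, sub_zero] at h1 h2
      exact hzero ζ h1 h2.ge
    have := S.lip (z := z) (ζ := ζ) hL (fun t ht => (hball (e5 t ht)).1.1.2) hz0 (by
      intro t ht hu
      refine hf _ (e4 t ht) ?_ hu
      rw [e2 t ht]
      nlinarith [ht.1, ht.2])
    have h3 := e3 0 (by simp)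
    simp only [ofReal_zero, zero_mul, add_zero, sub_zero, one_mul] at h3
    rwa [norm_sub_rev, h3] at this
  have b2 : ∀ w, ‖w - z₁‖ ≤ η → ‖w - c‖ ≤ ϱ → u w ≤ 2 * (ϱ - ‖w - c‖) := by
    intro w hw hwc
    refine rad 2 (by norm_num) w hw hwc fun y hy _ hu => ?_
    have := (abs_lt.1 ((hball (show dist y z₁ < r by rw [dist_eq_norm]; linarith)).1.1.1 hu)).2
    linarith
  have b3 : ∀ z, ‖z - z₁‖ ≤ η / 2 → ‖z - c‖ ≤ ϱ → u z ≤ (1 + 2 * M * η) * (ϱ - ‖z - c‖) := by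
    intro z hz hzc
    refine rad _ (by positivity) z (by linarith) hzc fun w hw hD hu => ?_
    have hw' : dist w z₁ < r := by rw [dist_eq_norm]; linarith
    have h1 := hpos' w hw' hu
    have h2 := b2 w (by linarith) h1.le
    have h3 := hDη z
    have h4 := (hball hw').2
    refine (f_le_exp hu).trans ?_
    have h5 : qf u f w ≤ M * η := h4.trans (by gcongr; linarith)
    have h6 := Real.exp_le_exp.2 h5
    have h7 : 0 ≤ M * η := by positivity
    have h8 := Real.abs_exp_sub_one_sub_id_le (x := M * η) (by rw [abs_of_nonneg h7]; linarith)
    have h9 := (abs_le.1 h8).2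
    nlinarith
  set κ := η / 2 with hκ
  have hκ0 : 0 < κ := by positivity
  set δ := 0.06 * κ / ϱ with hδ
  have hδ0 : 0 < δ := by positivity
  have hδ1 : δ ≤ 0.01 := by
    rw [hδ, div_le_iff₀ hϱ]; nlinarith
  set D' : ℂ → ℝ := fun w => 1 / (2 * ϱ) * (ϱ ^ 2 - Complex.normSq (w - c)) with hD'
  have hD'e : ∀ w, D' w = (ϱ - ‖w - c‖) - (ϱ - ‖w - c‖) ^ 2 / (2 * ϱ) := by
    intro w; simp only [hD', Complex.normSq_eq_norm_sq]; field_simp; ring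
  have hD'nn : ∀ w, ‖w - c‖ ≤ ϱ → 0 ≤ D' w := by
    intro w hw
    simp only [hD', Complex.normSq_eq_norm_sq]
    have : 0 ≤ ϱ ^ 2 - ‖w - c‖ ^ 2 := by nlinarith [norm_nonneg (w - c)]
    positivity
  have hD'le : ∀ w, D' w ≤ ϱ - ‖w - c‖ := by
    intro w; rw [hD'e]
    have : 0 ≤ (ϱ - ‖w - c‖) ^ 2 / (2 * ϱ) := by positivity
    linarith
  set W : ℂ → ℝ := fun w => (1 - δ) * D' w + 0.61 / ϱ * D' w ^ 2 + 0.1 / ϱ * Complex.normSq (w - z₁) with hW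
  have hWnn : ∀ w, ‖w - c‖ ≤ ϱ → 0 ≤ W w := by
    intro w hw
    have h1 := hD'nn w hw
    have h2 := Complex.normSq_nonneg (w - z₁)
    have h3 : 0 ≤ (1 - δ) * D' w := mul_nonneg (by linarith) h1
    simp only [hW]; positivity
  have key : ∀ z ∈ closedBall z₁ κ ∩ closedBall c ϱ, u z - W z ≤ 0 := by
    apply max_principle ((isCompact_closedBall z₁ κ).inter_right isClosed_closedBall)
    · have h1 : ContinuousOn u (closedBall z₁ κ ∩ closedBall c ϱ) := S.cont.mono fun z hz =>
        (hball (show dist z z₁ < r by have := mem_closedBall.1 hz.1; linarith)).1.1.2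
      have h2 : Continuous W := by
        have h3 : ∀ a : ℂ, Continuous (fun z => Complex.normSq (z - a)) := fun a =>
          Complex.continuous_normSq.comp (continuous_id.sub continuous_const)
        have h4 : Continuous D' := continuous_const.mul (continuous_const.sub (h3 c))
        exact ((continuous_const.mul h4).add (continuous_const.mul (h4.pow 2))).add
          (continuous_const.mul (h3 z₁))
      exact h1.sub h2.continuousOn
    · rintro z ⟨hz, hzc⟩ hgt
      rw [mem_closedBall, dist_eq_norm] at hz hzc
      have hzr : dist z z₁ < r := by rw [dist_eq_norm]; linarith
      have hup : 0 < u z := by linarith [hWnn z hzc]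
      have hzc' := hpos' z hzr hup
      have h1 := hD'nn z hzc
      have hzb : ‖z - z₁‖ < κ := by
        refine lt_of_le_of_ne hz fun he => ?_
        have h2 := b3 z hz hzc
        have h3 := hDη z
        have h4 := hD'le z
        set D := ϱ - ‖z - c‖ with hDdef
        have hD0 : 0 ≤ D := by linarith
        have h5 : D ≤ 1.1 * D' z := by
          rw [hD'e]
          have : D ^ 2 / (2 * ϱ) ≤ 0.05 * D := by
            rw [div_le_iff₀ (by positivity)]; nlinarith
          linarith
        have h6 : D ≤ D' z + 0.61 / ϱ * D' z ^ 2 := by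
          have e : D = D' z + D ^ 2 / (2 * ϱ) := by rw [hD'e]; ring
          have : D ^ 2 / (2 * ϱ) ≤ 0.61 / ϱ * D' z ^ 2 := by
            rw [div_le_iff₀ (by positivity)]
            have : 0.61 / ϱ * D' z ^ 2 * (2 * ϱ) = 1.22 * D' z ^ 2 := by field_simp; norm_num; ring
            rw [this]; nlinarith
          linarith
        simp only [hW, Complex.normSq_eq_norm_sq, he] at hgt
        have h7 : 2 * M * η * D ≤ 0.04 / ϱ * κ ^ 2 := by
          have : 2 * M * η * D ≤ 2 * (0.01 / ϱ) * (2 * κ) * κ := by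
            have : η = 2 * κ := by rw [hκ]; ring
            rw [this]
            gcongr
            linarith
          calc _ ≤ _ := this
            _ = _ := by ring
        have h8 : δ * D' z ≤ 0.06 / ϱ * κ ^ 2 := by
          calc δ * D' z ≤ δ * κ := by gcongr; linarith
            _ = _ := by rw [hδ]; ring
        have h9 : 0.1 / ϱ * κ ^ 2 = 0.04 / ϱ * κ ^ 2 + 0.06 / ϱ * κ ^ 2 := by ring
        linarith
      refine ⟨?_, ?_⟩
      · filter_upwards [isOpen_ball.mem_nhds (show z ∈ ball z₁ κ by rw [mem_ball, dist_eq_norm]; exact hzb),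
          isOpen_ball.mem_nhds (show z ∈ ball c ϱ by rw [mem_ball, dist_eq_norm]; exact hzc')] with w h1 h2
          using ⟨ball_subset_closedBall h1, ball_subset_closedBall h2⟩
      · have J1 := (S.harm z (hball hzr).1.1.2 hup).JL
        have JD := ((JL.const (ϱ ^ 2) z).sub (JL.normSq c z)).cmul (1 / (2 * ϱ))
        have JW := ((JD.cmul (1 - δ)).add (JD.sq.cmul (0.61 / ϱ))).add ((JL.normSq z₁ z).cmul (0.1 / ϱ))
        refine ⟨_, _, _, J1.sub JW, fun _ _ => ?_⟩
        have hn : (z - c).re ^ 2 + (z - c).im ^ 2 = ‖z - c‖ ^ 2 := by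
          rw [← Complex.normSq_eq_norm_sq, normSq_apply]; ring
        have hn2 : ‖z - c‖ ^ 2 ≤ ϱ ^ 2 := by gcongr
        change 0 < 0 - ((1 - δ) * (1 / (2 * ϱ) * (0 - 4)) + 0.61 / ϱ * (2 * D' z * (1 / (2 * ϱ) * (0 - 4)) +
          2 * ((1 / (2 * ϱ) * (0 - 2 * (z - c).re)) ^ 2 + (1 / (2 * ϱ) * (0 - 2 * (z - c).im)) ^ 2)) + 0.1 / ϱ * 4)
        have e1 : (1 / (2 * ϱ) * (0 - 2 * (z - c).re)) ^ 2 + (1 / (2 * ϱ) * (0 - 2 * (z - c).im)) ^ 2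
          = ‖z - c‖ ^ 2 / ϱ ^ 2 := by rw [← hn]; field_simp; ring
        rw [e1]
        have e2 : ‖z - c‖ ^ 2 / ϱ ^ 2 ≤ 1 := by rw [div_le_one (by positivity)]; exact hn2
        have e3 : 0 ≤ 0.61 / ϱ * (D' z * (1 / (2 * ϱ)) * 8) := by positivity
        have e4 : 0.61 / ϱ * (‖z - c‖ ^ 2 / ϱ ^ 2) ≤ 0.61 / ϱ * 1 := by gcongr
        have e5 : (1 - δ) * (1 / (2 * ϱ) * (0 - 4)) ≤ - 1.98 / ϱ := by
          have : (1 - δ) * (1 / (2 * ϱ) * (0 - 4)) = - (2 * (1 - δ)) / ϱ := by field_simp; ring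
          rw [this]; gcongr; linarith
        have e6 : 0 < 0.3 / ϱ := by positivity
        have e7 : - 1.98 / ϱ + 2 * (0.61 / ϱ * 1) + 0.1 / ϱ * 4 = - (0.3 / ϱ) - 0.06 / ϱ := by ring
        have e8 : 0 < 0.06 / ϱ := by positivity
        linarith
  have hnd := S.nondeg hz₁ (σ := δ / 2) (by positivity) (by linarith)
  have hsm : ∀ᶠ η' in 𝓝[>] (0:ℝ), η' ∈ Ioo 0 (min κ (δ * ϱ / 2)) := Ioo_mem_nhdsGT (by positivity)
  obtain ⟨t, ⟨z, hzt, hz1, hz2⟩, ht0, ht1⟩ := (hnd.and hsm).exists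
  have ht2 : t < κ := ht1.trans_le (min_le_left _ _)
  have ht3 : t < δ * ϱ / 2 := ht1.trans_le (min_le_right _ _)
  have hzc := hpos' z (by rw [dist_eq_norm]; linarith) hz2
  have := key z ⟨by rw [mem_closedBall, dist_eq_norm]; linarith, by rw [mem_closedBall, dist_eq_norm]; linarith⟩
  simp only [hW, Complex.normSq_eq_norm_sq, hzt] at this
  have h1 := hD'nn z hzc.le
  have h2 : D' z ≤ t := (hD'le z).trans (by rw [← hzt]; exact hDη z)
  have h3 : 0.61 / ϱ * D' z ^ 2 ≤ 0.61 / ϱ * t ^ 2 := by gcongr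
  have h4 : (1 - δ) * D' z ≤ (1 - δ) * t := by gcongr; linarith
  have h5 : (1 / ϱ) * t ^ 2 < δ / 2 * t := by
    rw [div_mul_eq_mul_div, one_mul, div_lt_iff₀ hϱ]; nlinarith
  have h6 : 0.61 / ϱ * t ^ 2 + 0.1 / ϱ * t ^ 2 ≤ (1 / ϱ) * t ^ 2 := by
    have : 0 ≤ 0.29 / ϱ * t ^ 2 := by positivity
    have e : (1 / ϱ) * t ^ 2 = 0.61 / ϱ * t ^ 2 + 0.1 / ϱ * t ^ 2 + 0.29 / ϱ * t ^ 2 := by ring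
    linarith
  linarith

theorem Sol.zero_cpt (S : Sol Ω u f N) {K : Set ℂ} {c : ℂ} {r : ℝ} (hK : IsCompact K) (hsub : K ⊆ Ω)
    (hb : K ⊆ closedBall c r) (h0 : ∀ z ∈ K, K ∉ 𝓝 z → u z = 0) : ∀ z ∈ K, u z = 0 := by
  intro z hz
  refine le_antisymm ?_ (S.nonneg z (hsub hz))
  by_contra hB
  push Not at hB
  have hr : 0 ≤ r := dist_nonneg.trans (mem_closedBall.1 (hb hz))
  set a := u z / (2 * (r + 1) ^ 2) with ha
  have ha0 : 0 < a := by positivity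
  have key : ∀ z ∈ K, u z + a * Complex.normSq (z - c) ≤ a * r ^ 2 := by
    apply max_principle hK
    · have h3 : Continuous (fun z => Complex.normSq (z - c)) :=
        Complex.continuous_normSq.comp (continuous_id.sub continuous_const)
      exact (S.cont.mono hsub).add (continuous_const.mul h3).continuousOn
    · intro w hw hgt
      have hwb := hb hw
      rw [mem_closedBall, dist_eq_norm] at hwb
      have h1 : a * Complex.normSq (w - c) ≤ a * r ^ 2 := by
        rw [Complex.normSq_eq_norm_sq]; gcongr
      have hup : 0 < u w := by linarith
      refine ⟨by_contra fun he => by rw [h0 w hw he] at hup; exact lt_irrefl _ hup, ?_⟩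
      have J := (S.harm w (hsub hw) hup).JL.add ((JL.normSq c w).cmul a)
      exact ⟨_, _, _, J, fun _ _ => by linarith⟩
  have h1 := key z hz
  have h2 : 0 ≤ a * Complex.normSq (z - c) := mul_nonneg ha0.le (Complex.normSq_nonneg _)
  have h3 : a * r ^ 2 < u z := by
    rw [ha, div_mul_eq_mul_div, div_lt_iff₀ (by positivity)]; nlinarith
  linarith
end P3

noncomputable def Gt (t s : ℝ) : ℝ := Real.smoothTransition (s / t - 1)
noncomputable def Gt' (t s : ℝ) : ℝ := deriv Real.smoothTransition (s / t - 1) * (1 / t)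
noncomputable def Pt (t s : ℝ) : ℝ := ∫ r in (0:ℝ)..s, Gt t r

theorem Gt_der (t s : ℝ) : HasDerivAt (Gt t) (Gt' t s) s := by
  have h : DifferentiableAt ℝ Real.smoothTransition (s / t - 1) :=
    (Real.smoothTransition.contDiff (n := 1)).differentiable (by simp) _
  exact h.hasDerivAt.comp s (((hasDerivAt_id s).div_const t).sub_const 1)

theorem Gt_cont (t : ℝ) : Continuous (Gt t) :=
  continuous_iff_continuousAt.2 fun s => (Gt_der t s).continuousAt

theorem Gt'_cont (t : ℝ) : Continuous (Gt' t) := by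
  have := (Real.smoothTransition.contDiff (n := 1)).continuous_deriv (by simp)
  unfold Gt'; fun_prop

theorem Pt_der (t s : ℝ) : HasDerivAt (Pt t) (Gt t s) s :=
  intervalIntegral.integral_hasDerivAt_right ((Gt_cont t).intervalIntegrable _ _)
    ((Gt_cont t).stronglyMeasurableAtFilter _ _) (Gt_cont t).continuousAt

theorem Gt'_nonneg {t : ℝ} (ht : 0 < t) (s : ℝ) : 0 ≤ Gt' t s :=
  mul_nonneg Real.smoothTransition.monotone.deriv_nonneg (by positivity)

theorem Gt_zero {t s : ℝ} (ht : 0 < t) (hs : s ≤ t) : Gt t s = 0 :=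
  Real.smoothTransition.zero_of_nonpos (by have := (div_le_one ht).2 hs; linarith)

theorem Gt_one {t s : ℝ} (ht : 0 < t) (hs : 2 * t ≤ s) : Gt t s = 1 :=
  Real.smoothTransition.one_of_one_le (by have := (le_div_iff₀ ht).2 hs; linarith)

theorem Gt_mem (t s : ℝ) : 0 ≤ Gt t s ∧ Gt t s ≤ 1 :=
  ⟨Real.smoothTransition.nonneg _, Real.smoothTransition.le_one _⟩

theorem Gt'_zero {t s : ℝ} (ht : 0 < t) (hs : s < t) : Gt' t s = 0 := by
  have h : Gt t =ᶠ[𝓝 s] fun _ => 0 := by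
    filter_upwards [gt_mem_nhds hs] with r hr using Gt_zero ht hr.le
  exact (Gt_der t s).unique ((hasDerivAt_const s 0).congr_of_eventuallyEq h)

theorem Gt'_zero' {t s : ℝ} (ht : 0 < t) (hs : 2 * t < s) : Gt' t s = 0 := by
  have h : Gt t =ᶠ[𝓝 s] fun _ => 1 := by
    filter_upwards [lt_mem_nhds hs] with r hr using Gt_one ht (le_of_lt hr)
  exact (Gt_der t s).unique ((hasDerivAt_const s 1).congr_of_eventuallyEq h)

theorem Pt_zero {t s : ℝ} (ht : 0 < t) (hs : s ≤ t) : Pt t s = 0 := by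
  unfold Pt
  rw [intervalIntegral.integral_congr (g := fun _ => 0)]
  · simp
  · intro r hr
    refine Gt_zero ht ?_
    rcases le_total 0 s with h | h
    · rw [uIcc_of_le h] at hr; linarith [hr.2]
    · rw [uIcc_of_ge h] at hr; linarith [hr.2]

theorem Pt_lip (t a b : ℝ) : |Pt t a - Pt t b| ≤ |a - b| := by
  have := (convex_univ (𝕜 := ℝ) (E := ℝ)).norm_image_sub_le_of_norm_hasDerivWithin_le (f := Pt t) (f' := Gt t) (C := 1)
    (fun x _ => (Pt_der t x).hasDerivWithinAt)
    (fun x _ => by rw [Real.norm_eq_abs, abs_of_nonneg (Gt_mem t x).1]; exact (Gt_mem t x).2)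
    (mem_univ b) (mem_univ a)
  simpa using this

section mi
variable {Ω : Set ℂ} {u φ : ℂ → ℝ} {f : ℂ → ℂ}

theorem mi_loc (op : IsOpen Ω) (hc : ContinuousOn u Ω) (hsub : tsupport φ ⊆ Ω) {t : ℝ} (ht : 0 < t) (z : ℂ) :
    (z ∈ Ω ∧ 0 < u z) ∨ (∀ᶠ w in 𝓝 z, φ =ᶠ[𝓝 w] 0) ∨
      (∀ᶠ w in 𝓝 z, Gt t (u w) = 0 ∧ Gt' t (u w) = 0 ∧ Pt t (u w) = 0) := by
  by_cases hz : z ∈ tsupport φ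
  · by_cases h : 0 < u z
    · exact Or.inl ⟨hsub hz, h⟩
    · right; right
      have h1 : ∀ᶠ w in 𝓝 z, u w < t :=
        (hc.continuousAt (op.mem_nhds (hsub hz))).eventually (gt_mem_nhds (by linarith))
      filter_upwards [h1] with w hw using ⟨Gt_zero ht hw.le, Gt'_zero ht hw, Pt_zero ht hw.le⟩
  · right; left
    filter_upwards [(isClosed_tsupport φ).isOpen_compl.mem_nhds hz] with w hw
    exact notMem_tsupport_iff_eventuallyEq.1 hw

theorem hess_cont (hφ : ContDiff ℝ 2 φ) (ω : ℂ) :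
    (∀ z, HasFDerivAt (fun w => fderiv ℝ φ w ω) (fderiv ℝ (fun x => fderiv ℝ φ x ω) z) z) ∧
    Continuous (fun z => hess φ z ω ω) := by
  have h1 : ContDiff ℝ 1 (fun w => fderiv ℝ φ w ω) :=
    (hφ.fderiv_right (m := 1) (by norm_num)).clm_apply contDiff_const
  refine ⟨fun z => (h1.differentiable (by simp) z).hasFDerivAt, ?_⟩
  exact (h1.continuous_fderiv (by simp)).clm_apply continuous_const

theorem hess_zero {z ω : ℂ} (h : φ =ᶠ[𝓝 z] 0) : φ z = 0 ∧ fderiv ℝ φ z ω = 0 ∧ hess φ z ω ω = 0 := by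
  have h2 : (fun x => fderiv ℝ φ x ω) =ᶠ[𝓝 z] 0 := by
    filter_upwards [h.eventuallyEq_nhds] with w hw
    rw [hw.fderiv_eq]; simp
  refine ⟨h.eq_of_nhds, h2.eq_of_nhds, ?_⟩
  unfold hess; rw [h2.fderiv_eq]; simp

theorem mi_line (op : IsOpen Ω) (hc : ContinuousOn u Ω)
    (hh : ∀ z ∈ Ω, 0 < u z → HarmAt u f z) (hφ : ContDiff ℝ 2 φ) (hs : HasCompactSupport φ)
    (hsub : tsupport φ ⊆ Ω) {t : ℝ} (ht : 0 < t) (ω : ℂ) :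
    Integrable (fun z => φ z * (Gt' t (u z) * (f z * ω).re ^ 2) + φ z * (Gt t (u z) * (deriv f z * ω ^ 2).re)
      - Pt t (u z) * hess φ z ω ω) ∧
    ∫ z, (φ z * (Gt' t (u z) * (f z * ω).re ^ 2) + φ z * (Gt t (u z) * (deriv f z * ω ^ 2).re)
      - Pt t (u z) * hess φ z ω ω) = 0 := by
  set X : ℂ → ℝ := fun z => φ z * (Gt t (u z) * (f z * ω).re) - Pt t (u z) * fderiv ℝ φ z ω with hX
  set Y : ℂ → ℝ := fun z => φ z * (Gt' t (u z) * (f z * ω).re ^ 2) + φ z * (Gt t (u z) * (deriv f z * ω ^ 2).re)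
      - Pt t (u z) * hess φ z ω ω with hY
  have hz0 : ∀ z, ((∀ᶠ w in 𝓝 z, φ =ᶠ[𝓝 w] 0) ∨
      (∀ᶠ w in 𝓝 z, Gt t (u w) = 0 ∧ Gt' t (u w) = 0 ∧ Pt t (u w) = 0)) → X =ᶠ[𝓝 z] 0 ∧ Y =ᶠ[𝓝 z] 0 := by
    intro z h
    rcases h with h | h
    · constructor <;> filter_upwards [h] with w hw <;> simp [hX, hY, hess_zero (ω := ω) hw]
    · constructor <;> filter_upwards [h] with w hw <;> simp [hX, hY, hw]
  have hcX : Continuous X := by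
    rw [continuous_iff_continuousAt]; intro z
    rcases mi_loc op hc hsub ht z with ⟨h1, h2⟩ | h
    · have hu := (hh z h1 h2).continuousAt
      have hf := (hh z h1 h2).analyticAt.continuousAt
      have e1 : ContinuousAt (fun w => Gt t (u w)) z := (Gt_cont t).continuousAt.comp hu
      have e2 : ContinuousAt (fun w => Pt t (u w)) z := (Pt_der t _).continuousAt.comp hu
      have e3 : ContinuousAt φ z := hφ.continuous.continuousAt
      have e4 : ContinuousAt (fun w => fderiv ℝ φ w ω) z := ((hess_cont hφ ω).1 z).continuousAt
      have e5 : ContinuousAt (fun w => (f w * ω).re) z := continuous_re.continuousAt.comp (hf.mul continuousAt_const)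
      exact (e3.mul (e1.mul e5)).sub (e2.mul e4)
    · exact continuousAt_const.congr (hz0 z h).1.symm
  have hcY : Continuous Y := by
    rw [continuous_iff_continuousAt]; intro z
    rcases mi_loc op hc hsub ht z with ⟨h1, h2⟩ | h
    · have hu := (hh z h1 h2).continuousAt
      have hf := (hh z h1 h2).analyticAt.continuousAt
      have hf' := (hh z h1 h2).analyticAt.deriv.continuousAt
      have e1 : ContinuousAt (fun w => Gt t (u w)) z := (Gt_cont t).continuousAt.comp hu
      have e1' : ContinuousAt (fun w => Gt' t (u w)) z := (Gt'_cont t).continuousAt.comp hu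
      have e2 : ContinuousAt (fun w => Pt t (u w)) z := (Pt_der t _).continuousAt.comp hu
      have e3 : ContinuousAt φ z := hφ.continuous.continuousAt
      have e4 : ContinuousAt (fun w => hess φ w ω ω) z := (hess_cont hφ ω).2.continuousAt
      have e5 : ContinuousAt (fun w => (f w * ω).re) z := continuous_re.continuousAt.comp (hf.mul continuousAt_const)
      have e6 : ContinuousAt (fun w => (deriv f w * ω ^ 2).re) z :=
        continuous_re.continuousAt.comp (hf'.mul continuousAt_const)
      exact ((e3.mul (e1'.mul (e5.pow 2))).add (e3.mul (e1.mul e6))).sub (e2.mul e4)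
    · exact continuousAt_const.congr (hz0 z h).2.symm
  have hsX : HasCompactSupport X := HasCompactSupport.intro hs.isCompact fun z hz => by
    simp [hX, hess_zero (ω := ω) (notMem_tsupport_iff_eventuallyEq.1 hz)]
  have hsY : HasCompactSupport Y := HasCompactSupport.intro hs.isCompact fun z hz => by
    simp [hY, hess_zero (ω := ω) (notMem_tsupport_iff_eventuallyEq.1 hz)]
  have hd : ∀ z, HasLineDerivAt ℝ X (Y z) z ω := by
    intro z
    rcases mi_loc op hc hsub ht z with ⟨h1, h2⟩ | h
    · have H := hh z h1 h2
      have H0 : HasDerivAt (fun s : ℝ => u (z + s • ω)) ((f z * ω).re) 0 := by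
        have := HarmAt.hasDerivAt_line (h := u) (F := f) (z := z) (ω := ω) (t := 0) (by simpa using H)
        simpa using this
      have z0 : z + (0:ℝ) • ω = z := by simp
      have Hf : HasDerivAt (fun s : ℝ => (f (z + s • ω) * ω).re) ((deriv f z * ω ^ 2).re) 0 := by
        have h3 : HasDerivAt (fun w => f w * ω) (deriv f z * ω) (z + ((0:ℝ):ℂ) * ω) := by
          have := H.analyticAt.differentiableAt.hasDerivAt.mul_const ω
          simpa using this
        have := hasDerivAt_re_line h3
        simp only [real_smul]
        exact this.congr_deriv (by ring_nf)
      have e1 : HasDerivAt (fun s : ℝ => Gt t (u (z + s • ω))) (Gt' t (u z) * (f z * ω).re) 0 := by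
        have := (Gt_der t (u (z + (0:ℝ) • ω))).comp (0:ℝ) H0
        rw [z0] at this; exact this
      have e2 : HasDerivAt (fun s : ℝ => Pt t (u (z + s • ω))) (Gt t (u z) * (f z * ω).re) 0 := by
        have := (Pt_der t (u (z + (0:ℝ) • ω))).comp (0:ℝ) H0
        rw [z0] at this; exact this
      have hl : HasDerivAt (fun s : ℝ => z + s • ω) ω 0 := by
        simpa using ((hasDerivAt_id (0:ℝ)).smul_const ω).const_add z
      have e3 : HasDerivAt (fun s : ℝ => φ (z + s • ω)) (fderiv ℝ φ z ω) 0 := by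
        have h4 : HasFDerivAt φ (fderiv ℝ φ z) (z + (0:ℝ) • ω) := by
          rw [z0]; exact (hφ.differentiable (by simp) z).hasFDerivAt
        exact h4.comp_hasDerivAt 0 hl
      have e4 : HasDerivAt (fun s : ℝ => fderiv ℝ φ (z + s • ω) ω) (hess φ z ω ω) 0 := by
        have h4 := (hess_cont hφ ω).1 (z + (0:ℝ) • ω)
        have := h4.comp_hasDerivAt 0 hl
        rw [z0] at this; exact this
      have := (e3.mul (e1.mul Hf)).sub (e2.mul e4)
      refine this.congr_deriv ?_
      simp only [z0, hY, Pi.mul_apply]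
      ring
    · have h0 := hz0 z h
      have h1 : HasDerivAt (fun s : ℝ => X (z + s • ω)) 0 0 := by
        refine (hasDerivAt_const (0:ℝ) (0:ℝ)).congr_of_eventuallyEq ?_
        have := (tendsto_line z ω).eventually h0.1
        simpa [EventuallyEq] using this
      have : Y z = 0 := h0.2.eq_of_nhds
      rw [this]; exact h1
  have iX := hcX.integrable_of_hasCompactSupport (μ := volume) hsX
  have iY := hcY.integrable_of_hasCompactSupport (μ := volume) hsY
  refine ⟨iY, ?_⟩
  have := integral_bilinear_hasLineDerivAt_right_eq_neg_left_of_integrable (μ := (volume : Measure ℂ))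
    (f := fun _ => (1:ℝ)) (f' := fun _ => (0:ℝ)) (g := X) (g' := Y) (v := ω)
    (B := ContinuousLinearMap.mul ℝ ℝ) (by simp) (by simpa using iY) (by simpa using iX)
    (fun x _ => by simpa [HasLineDerivAt] using hasDerivAt_const (0:ℝ) (1:ℝ)) (fun x _ => hd x)
  simpa using this

theorem mi_identity (op : IsOpen Ω) (hc : ContinuousOn u Ω)
    (hh : ∀ z ∈ Ω, 0 < u z → HarmAt u f z) (hφ : ContDiff ℝ 2 φ) (hs : HasCompactSupport φ)
    (hsub : tsupport φ ⊆ Ω) {t : ℝ} (ht : 0 < t) :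
    Integrable (fun z => Pt t (u z) * (hess φ z 1 1 + hess φ z I I)) ∧
    Integrable (fun z => φ z * (Gt' t (u z) * ‖f z‖ ^ 2)) ∧
    ∫ z, φ z * (Gt' t (u z) * ‖f z‖ ^ 2) = ∫ z, Pt t (u z) * (hess φ z 1 1 + hess φ z I I) := by
  obtain ⟨i1, j1⟩ := mi_line op hc hh hφ hs hsub ht 1
  obtain ⟨i2, j2⟩ := mi_line op hc hh hφ hs hsub ht I
  have i3 : Integrable (fun z => Pt t (u z) * (hess φ z 1 1 + hess φ z I I)) := by
    refine Continuous.integrable_of_hasCompactSupport ?_ (HasCompactSupport.intro hs.isCompact fun z hz => by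
      have h0 := notMem_tsupport_iff_eventuallyEq.1 hz
      simp [hess_zero (ω := 1) h0, hess_zero (ω := I) h0])
    rw [continuous_iff_continuousAt]; intro z
    rcases mi_loc op hc hsub ht z with ⟨h1, h2⟩ | h | h
    · have hu := (hh z h1 h2).continuousAt
      have e2 : ContinuousAt (fun w => Pt t (u w)) z := (Pt_der t _).continuousAt.comp hu
      exact e2.mul ((hess_cont hφ 1).2.continuousAt.add (hess_cont hφ I).2.continuousAt)
    · refine continuousAt_const.congr (f := fun _ => 0) ?_
      filter_upwards [h] with w hw
      simp [hess_zero (ω := 1) hw, hess_zero (ω := I) hw]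
    · refine continuousAt_const.congr (f := fun _ => 0) ?_
      filter_upwards [h] with w hw
      simp [hw]
  have key : (fun z => φ z * (Gt' t (u z) * ‖f z‖ ^ 2)) = fun z => ((φ z * (Gt' t (u z) * (f z * 1).re ^ 2) + φ z * (Gt t (u z) * (deriv f z * 1 ^ 2).re)
      - Pt t (u z) * hess φ z 1 1) + (φ z * (Gt' t (u z) * (f z * I).re ^ 2) + φ z * (Gt t (u z) * (deriv f z * I ^ 2).re)
      - Pt t (u z) * hess φ z I I)) + Pt t (u z) * (hess φ z 1 1 + hess φ z I I) := by
    funext z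
    rw [← sq_re_im]
    simp
    ring
  refine ⟨i3, ?_, ?_⟩
  · rw [key]; exact (i1.add i2).add i3
  · rw [key]
    refine (integral_add (i1.add i2) i3).trans ?_
    have := integral_add i1 i2
    rw [j1, j2] at this
    simp only [Pi.add_apply]
    rw [this]; simp

end mi

noncomputable def chi1 : ContDiffBump (3/8:ℝ) := ⟨1/16, 1/8, by norm_num, by norm_num⟩
noncomputable def chi2 : ContDiffBump (0:ℝ) := ⟨1/2, 3/4, by norm_num, by norm_num⟩
noncomputable def phi (z : ℂ) : ℝ := chi1 z.im * chi2 z.re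
def KK : Set ℂ := {z | |z.re| ≤ 3/4 ∧ 1/4 ≤ z.im ∧ z.im ≤ 1/2}

theorem KK_closed : IsClosed KK :=
  (isClosed_le (continuous_abs.comp continuous_re) continuous_const).inter
    ((isClosed_le continuous_const continuous_im).inter (isClosed_le continuous_im continuous_const))

theorem KK_compact : IsCompact KK := by
  refine Metric.isCompact_of_isClosed_isBounded KK_closed ?_
  refine isBounded_closedBall (x := (0:ℂ)) (r := 2) |>.subset fun z hz => ?_
  rw [mem_closedBall, dist_zero_right]
  have := Complex.norm_le_abs_re_add_abs_im z
  have h2 : |z.im| ≤ 1/2 := abs_le.2 ⟨by linarith [hz.2.1], hz.2.2⟩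
  linarith [hz.1]

theorem phi_zero {z : ℂ} (h : z ∉ KK) : phi z = 0 := by
  unfold phi
  by_contra hne
  have h1 := left_ne_zero_of_mul hne
  have h2 := right_ne_zero_of_mul hne
  apply h
  have a1 : z.im ∈ ball (3/8:ℝ) (1/8) := by
    have : z.im ∈ Function.support chi1 := h1
    rw [chi1.support_eq] at this; exact this
  have a2 : z.re ∈ ball (0:ℝ) (3/4) := by
    have : z.re ∈ Function.support chi2 := h2
    rw [chi2.support_eq] at this; exact this
  rw [mem_ball, Real.dist_eq, abs_lt] at a1 a2
  exact ⟨abs_le.2 ⟨by linarith, by linarith⟩, by linarith, by linarith⟩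

theorem phi_tsupport : tsupport phi ⊆ KK :=
  closure_minimal (fun z hz => by_contra fun h => hz (phi_zero h)) KK_closed

theorem phi_compact : HasCompactSupport phi := HasCompactSupport.intro KK_compact fun _ h => phi_zero h

theorem phi_nonneg (z : ℂ) : 0 ≤ phi z := mul_nonneg chi1.nonneg chi2.nonneg

theorem phi_smooth : ContDiff ℝ 2 phi :=
  (chi1.contDiff.comp imCLM.contDiff).mul (chi2.contDiff.comp reCLM.contDiff)

noncomputable def mm : ℝ := ∫ y, chi1 y
theorem mm_pos : 0 < mm := chi1.integral_pos

theorem Sol.near_one {Ω u f N} (S : Sol Ω u f N) {K : Set ℂ} (hK : IsCompact K) (hKΩ : K ⊆ Ω) :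
    ∃ t₀ > 0, ∀ z ∈ K, 0 < u z → u z < t₀ → 0.99 ≤ ‖f z‖ := by
  by_contra hcon
  push Not at hcon
  choose z hz1 hz2 hz3 hz4 using fun k : ℕ => hcon (1 / ((k:ℝ) + 1)) (by positivity)
  obtain ⟨a, ha, ϕ, hϕ, hlim⟩ := hK.tendsto_subseq hz1
  have hu0 : Tendsto (fun k => u (z (ϕ k))) atTop (𝓝 0) := by
    refine squeeze_zero (fun k => (hz2 _).le) (fun k => (hz3 _).le) ?_
    exact tendsto_one_div_add_atTop_nhds_zero_nat.comp hϕ.tendsto_atTop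
  have hua : u a = 0 := tendsto_nhds_unique ((S.cAt (hKΩ ha)).tendsto.comp hlim) hu0
  have hFB : a ∈ FB Ω u := by
    rw [S.memFB]
    refine ⟨hKΩ ha, hua, mem_closure_of_tendsto hlim (Eventually.of_forall fun k => ⟨hKΩ (hz1 _), hz2 _⟩)⟩
  have := hlim.eventually (S.fb1 a hFB 0.01 (by norm_num))
  obtain ⟨k, hk⟩ := this.exists
  have := (abs_lt.1 (hk (hz2 _))).1
  have := hz4 (ϕ k)
  simp only [Function.comp] at *
  linarith

theorem mi_hcont {Ω u f N} (S : Sol Ω u f N) (hK : KK ⊆ Ω) {t : ℝ} (ht : 0 < t) :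
    Continuous (fun z => phi z * (Gt' t (u z) * |(f z).re|)) := by
  rw [continuous_iff_continuousAt]; intro z
  rcases mi_loc S.op S.cont (phi_tsupport.trans hK) ht z with ⟨h1, h2⟩ | h | h
  · have e1' : ContinuousAt (fun w => Gt' t (u w)) z := (Gt'_cont t).continuousAt.comp (S.cAt h1)
    exact phi_smooth.continuous.continuousAt.mul (e1'.mul
      (continuous_abs.continuousAt.comp (continuous_re.continuousAt.comp (S.fcont h1 h2))))
  · refine continuousAt_const.congr (f := fun _ => 0) ?_
    filter_upwards [h] with w hw
    simp [hw.eq_of_nhds]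
  · refine continuousAt_const.congr (f := fun _ => 0) ?_
    filter_upwards [h] with w hw
    simp [hw]

theorem mi_core {Ω u f N} (S : Sol Ω u f N) (hK : KK ⊆ Ω) {n B : ℝ} (hn : 0 ≤ n)
    (hlow : ∀ y ∈ Ioo (1/4:ℝ) (1/2), ∀ᶠ t in 𝓝[>] (0:ℝ), ENNReal.ofReal n ≤
      ∫⁻ x in Icc (-1/2:ℝ) (1/2), ENNReal.ofReal (Gt' t (u ⟨x, y⟩) * |(f ⟨x, y⟩).re|))
    (hB : ∀ t > 0, ∫ z, Pt t (u z) * (hess phi z 1 1 + hess phi z I I) ≤ B) : 0.99 * n * mm ≤ B := by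
  obtain ⟨t₀, ht₀, hf⟩ := S.near_one KK_compact hK
  set tk : ℕ → ℝ := fun k => t₀ / 4 * (1 / ((k:ℝ) + 1)) with htk
  have htk0 : ∀ k, 0 < tk k := fun k => by rw [htk]; positivity
  have htk1 : ∀ k, 2 * tk k < t₀ := fun k => by
    have : 1 / ((k:ℝ) + 1) ≤ 1 := by rw [div_le_one (by positivity)]; linarith [k.cast_nonneg (α := ℝ)]
    simp only [htk]; nlinarith
  have htl : Tendsto tk atTop (𝓝[>] 0) := by
    refine tendsto_nhdsWithin_iff.2 ⟨?_, Eventually.of_forall htk0⟩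
    simpa [htk] using (tendsto_one_div_add_atTop_nhds_zero_nat (𝕜 := ℝ)).const_mul (t₀ / 4)
  set h : ℕ → ℂ → ℝ := fun k z => phi z * (Gt' (tk k) (u z) * |(f z).re|) with hh
  have hc : ∀ k, Continuous (h k) := fun k => mi_hcont S hK (htk0 k)
  have hcp : ∀ k, Continuous (fun p : ℝ × ℝ => h k ⟨p.1, p.2⟩) := fun k =>
    (hc k).comp (Complex.equivRealProdCLM.symm.continuous)
  have hup : ∀ k, ∫⁻ y, ∫⁻ x, ENNReal.ofReal (h k ⟨x, y⟩) ≤ ENNReal.ofReal (B / 0.99) := by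
    intro k
    obtain ⟨i1, i2, i3⟩ := mi_identity S.op S.cont S.harm phi_smooth phi_compact (phi_tsupport.trans hK) (htk0 k)
    have e1 : ∫⁻ y, ∫⁻ x, ENNReal.ofReal (h k ⟨x, y⟩) = ∫⁻ z, ENNReal.ofReal (h k z) := by
      have := (Complex.volume_preserving_equiv_real_prod.symm).lintegral_comp_emb
        (MeasurableEquiv.measurableEmbedding _) (fun z => ENNReal.ofReal (h k z))
      rw [← this, Measure.volume_eq_prod, lintegral_prod_symm]
      · rfl
      · exact ((hcp k).measurable.ennreal_ofReal).aemeasurable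
    rw [e1]
    calc ∫⁻ z, ENNReal.ofReal (h k z)
        ≤ ∫⁻ z, ENNReal.ofReal (phi z * (Gt' (tk k) (u z) * ‖f z‖ ^ 2) / 0.99) := by
          refine lintegral_mono fun z => ENNReal.ofReal_le_ofReal ?_
          simp only [hh]
          by_cases hz : z ∈ KK
          · by_cases hg : Gt' (tk k) (u z) = 0
            · simp [hg]
            · have h1 : tk k ≤ u z := by
                by_contra hlt; exact hg (Gt'_zero (htk0 k) (not_le.1 hlt))
              have h2 : u z ≤ 2 * tk k := by
                by_contra hlt; exact hg (Gt'_zero' (htk0 k) (not_le.1 hlt))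
              have h3 := hf z hz (by linarith [htk0 k]) (by linarith [htk1 k])
              have h4 := Complex.abs_re_le_norm (f z)
              rw [mul_div_assoc, mul_div_assoc]
              refine mul_le_mul_of_nonneg_left (mul_le_mul_of_nonneg_left ?_ (Gt'_nonneg (htk0 k) _)) (phi_nonneg z)
              rw [le_div_iff₀ (by norm_num)]
              nlinarith [norm_nonneg (f z)]
          · simp [phi_zero hz]
      _ = ENNReal.ofReal (∫ z, phi z * (Gt' (tk k) (u z) * ‖f z‖ ^ 2) / 0.99) := by
          rw [ofReal_integral_eq_lintegral_ofReal (i2.div_const _)]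
          refine Eventually.of_forall fun z => ?_
          have := Gt'_nonneg (htk0 k) (u z)
          have := phi_nonneg z
          simp only [Pi.zero_apply]; positivity
      _ ≤ ENNReal.ofReal (B / 0.99) := by
          refine ENNReal.ofReal_le_ofReal ?_
          rw [integral_div, i3]
          have := hB (tk k) (htk0 k)
          gcongr
  have hlo : ∀ y, ENNReal.ofReal (chi1 y) * ENNReal.ofReal n ≤
      liminf (fun k => ∫⁻ x, ENNReal.ofReal (h k ⟨x, y⟩)) atTop := by
    intro y
    by_cases hy : y ∈ Ioo (1/4:ℝ) (1/2)
    · refine le_liminf_of_le (by isBoundedDefault) ?_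
      filter_upwards [htl.eventually (hlow y hy)] with k hk
      calc ENNReal.ofReal (chi1 y) * ENNReal.ofReal n ≤ ENNReal.ofReal (chi1 y) * ∫⁻ x in Icc (-1/2:ℝ) (1/2), ENNReal.ofReal (Gt' (tk k) (u ⟨x, y⟩) * |(f ⟨x, y⟩).re|) := by gcongr
        _ = ∫⁻ x in Icc (-1/2:ℝ) (1/2), ENNReal.ofReal (chi1 y) * ENNReal.ofReal (Gt' (tk k) (u ⟨x, y⟩) * |(f ⟨x, y⟩).re|) := by
            rw [lintegral_const_mul' _ _ ENNReal.ofReal_ne_top]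
        _ ≤ ∫⁻ x in Icc (-1/2:ℝ) (1/2), ENNReal.ofReal (h k ⟨x, y⟩) := by
            refine setLIntegral_mono' measurableSet_Icc fun x hx => ?_
            rw [← ENNReal.ofReal_mul chi1.nonneg]
            refine ENNReal.ofReal_le_ofReal (le_of_eq ?_)
            have : chi2 x = 1 := chi2.one_of_mem_closedBall (by
              rw [mem_closedBall, Real.dist_eq, sub_zero]
              exact abs_le.2 ⟨by linarith [hx.1, show chi2.rIn = 1/2 from rfl], by linarith [hx.2, show chi2.rIn = 1/2 from rfl]⟩)
            simp [hh, phi, this]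
        _ ≤ _ := setLIntegral_le_lintegral _ _
    · have : chi1 y = 0 := by
        by_contra hne
        have : y ∈ Function.support chi1 := hne
        rw [chi1.support_eq, Real.ball_eq_Ioo] at this
        apply hy
        have e1 : chi1.rOut = 1/8 := rfl
        rw [e1] at this
        exact ⟨by linarith [this.1], by linarith [this.2]⟩
      simp [this]
  have e2 : ENNReal.ofReal (mm * n) ≤ ENNReal.ofReal (B / 0.99) := by
    calc ENNReal.ofReal (mm * n) = ∫⁻ y, ENNReal.ofReal (chi1 y) * ENNReal.ofReal n := by
          rw [lintegral_mul_const' _ _ ENNReal.ofReal_ne_top, ENNReal.ofReal_mul mm_pos.le]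
          unfold mm
          rw [ofReal_integral_eq_lintegral_ofReal chi1.integrable (Eventually.of_forall fun y => chi1.nonneg)]
      _ ≤ ∫⁻ y, liminf (fun k => ∫⁻ x, ENNReal.ofReal (h k ⟨x, y⟩)) atTop := lintegral_mono hlo
      _ ≤ liminf (fun k => ∫⁻ y, ∫⁻ x, ENNReal.ofReal (h k ⟨x, y⟩)) atTop := by
          refine lintegral_liminf_le fun k => ?_
          exact Measurable.lintegral_prod_left ((hcp k).measurable.ennreal_ofReal)
      _ ≤ ENNReal.ofReal (B / 0.99) := by
          refine (liminf_le_liminf (Eventually.of_forall hup)).trans ?_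
          simp
  by_cases hB0 : 0 ≤ B / 0.99
  · have := (ENNReal.ofReal_le_ofReal_iff hB0).1 e2
    rw [le_div_iff₀ (by norm_num)] at this
    linarith
  · rw [ENNReal.ofReal_of_nonpos (not_le.1 hB0).le] at e2
    have h3 := ENNReal.ofReal_eq_zero.1 (le_antisymm e2 bot_le)
    have h4 := mul_nonneg mm_pos.le hn
    have h5 := hB 1 one_pos
    have h0 : mm * n = 0 := le_antisymm h3 h4
    have := hup 0
    exfalso
    obtain ⟨i1, i2, i3⟩ := mi_identity S.op S.cont S.harm phi_smooth phi_compact (phi_tsupport.trans hK) one_pos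
    have h6 : 0 ≤ ∫ z, phi z * (Gt' 1 (u z) * ‖f z‖ ^ 2) := integral_nonneg fun z =>
      mul_nonneg (phi_nonneg z) (mul_nonneg (Gt'_nonneg one_pos _) (by positivity))
    apply hB0
    rw [i3] at h6
    exact div_nonneg (by linarith) (by norm_num)

noncomputable def DD : ℝ := ∫ z, |hess phi z 1 1 + hess phi z I I|

theorem lap_int : Integrable (fun z => |hess phi z 1 1 + hess phi z I I|) := by
  refine Continuous.integrable_of_hasCompactSupport ?_ (HasCompactSupport.intro phi_compact.isCompact fun z hz => by
      have h0 := notMem_tsupport_iff_eventuallyEq.1 hz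
      simp [hess_zero (ω := 1) h0, hess_zero (ω := I) h0])
  exact continuous_abs.comp ((hess_cont phi_smooth 1).2.add (hess_cont phi_smooth I).2)

theorem lap_zero {z : ℂ} (h : z ∉ KK) : hess phi z 1 1 + hess phi z I I = 0 := by
  have h0 := notMem_tsupport_iff_eventuallyEq.1 (fun h' => h (phi_tsupport h'))
  simp [hess_zero (ω := 1) h0, hess_zero (ω := I) h0]

theorem P_harm : ∀ z ∈ (univ : Set ℂ), 0 < Pfun z → HarmAt Pfun (fun _ => 1) z := by
  intro z _ hz
  refine (HarmAt.re_mul 1 0 z).congr ?_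
  have hz : 0 < z.re := by
    by_contra h; simp [Pfun, max_eq_right (not_lt.1 h)] at hz
  filter_upwards [continuous_re.continuousAt.eventually (lt_mem_nhds hz)] with w hw
  simp [Pfun, max_eq_left hw.le]

theorem P_cont : Continuous Pfun := continuous_re.max continuous_const

theorem P_mass {t : ℝ} (ht : 0 < t) : ∫ z, Pt t (Pfun z) * (hess phi z 1 1 + hess phi z I I) ≤ mm := by
  obtain ⟨i1, i2, i3⟩ := mi_identity isOpen_univ P_cont.continuousOn P_harm phi_smooth phi_compact (subset_univ _) ht
  rw [← i3]
  have e1 : ∀ x : ℝ, Gt' t (max x 0) = Gt' t x := by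
    intro x
    rcases le_total x 0 with h | h
    · rw [max_eq_right h, Gt'_zero ht ht, Gt'_zero ht (by linarith)]
    · rw [max_eq_left h]
  have e2 : ∫ z, phi z * (Gt' t (Pfun z) * ‖(1:ℂ)‖ ^ 2) = ∫ p : ℝ × ℝ, (chi2 p.1 * Gt' t p.1) * chi1 p.2 := by
    have := (Complex.volume_preserving_equiv_real_prod.symm).integral_comp
        (MeasurableEquiv.measurableEmbedding _) (fun z => phi z * (Gt' t (Pfun z) * ‖(1:ℂ)‖ ^ 2))
    rw [← this]
    refine integral_congr_ae (Eventually.of_forall fun p => ?_)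
    simp only [Complex.measurableEquivRealProd_symm_apply, phi, Pfun, e1]
    simp; ring
  rw [e2, Measure.volume_eq_prod, integral_prod_mul (fun x => chi2 x * Gt' t x) (fun y => chi1 y)]
  have hc := Gt'_cont t
  have i0 : ∫ x, Gt' t x = 1 := by
    have h1 : ∫ x in t..2*t, Gt' t x = Gt t (2*t) - Gt t t :=
      intervalIntegral.integral_eq_sub_of_hasDerivAt (fun x _ => Gt_der t x) (hc.intervalIntegrable _ _)
    rw [Gt_one ht le_rfl, Gt_zero ht le_rfl, sub_zero, intervalIntegral.integral_of_le (by linarith)] at h1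
    rw [← h1, ← integral_Icc_eq_integral_Ioc, setIntegral_eq_integral_of_forall_compl_eq_zero]
    intro x hx
    by_cases h : x < t
    · exact Gt'_zero ht h
    · exact Gt'_zero' ht (by by_contra h'; exact hx ⟨not_lt.1 h, not_lt.1 h'⟩)
  have hs : HasCompactSupport (Gt' t) := HasCompactSupport.intro (isCompact_Icc (a := t) (b := 2*t)) fun x hx => by
    by_cases h : x < t
    · exact Gt'_zero ht h
    · exact Gt'_zero' ht (by by_contra h'; exact hx ⟨not_lt.1 h, not_lt.1 h'⟩)
  have h5 : ∫ x, chi2 x * Gt' t x ≤ 1 := by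
    rw [← i0]
    refine integral_mono_of_nonneg (Eventually.of_forall fun x => mul_nonneg chi2.nonneg (Gt'_nonneg ht x))
      (hc.integrable_of_hasCompactSupport hs) (Eventually.of_forall fun x => ?_)
    exact mul_le_of_le_one_left (Gt'_nonneg ht x) chi2.le_one
  have := mm_pos
  change (∫ x, chi2 x * Gt' t x) * mm ≤ mm
  nlinarith

theorem mi_diff {u v : ℂ → ℝ} {η t : ℝ} (iu : Integrable (fun z => Pt t (u z) * (hess phi z 1 1 + hess phi z I I)))
    (iv : Integrable (fun z => Pt t (v z) * (hess phi z 1 1 + hess phi z I I)))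
    (h : ∀ z ∈ KK, |u z - v z| ≤ η) :
    ∫ z, Pt t (u z) * (hess phi z 1 1 + hess phi z I I) ≤
      (∫ z, Pt t (v z) * (hess phi z 1 1 + hess phi z I I)) + η * DD := by
  unfold DD
  rw [← integral_const_mul, ← integral_add iv (lap_int.const_mul η)]
  refine integral_mono iu (iv.add (lap_int.const_mul η)) fun z => ?_
  by_cases hz : z ∈ KK
  · have h1 := (Pt_lip t (u z) (v z)).trans (h z hz)
    set D := hess phi z 1 1 + hess phi z I I with hD
    have h2 : (Pt t (u z) - Pt t (v z)) * D ≤ η * |D| := by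
      refine (le_abs_self _).trans ?_
      rw [abs_mul]; gcongr
    simp only [Pi.add_apply]
    linarith
  · simp [lap_zero hz]

theorem var1 {Ω u f N} (S : Sol Ω u f N) {a b y t : ℝ} (ht : 0 < t) (hab : a ≤ b)
    (hsub : ∀ x ∈ Icc a b, (⟨x, y⟩ : ℂ) ∈ Ω) :
    ENNReal.ofReal |Gt t (u ⟨b, y⟩) - Gt t (u ⟨a, y⟩)| ≤
      ∫⁻ x in Ioc a b, ENNReal.ofReal (Gt' t (u ⟨x, y⟩) * |(f ⟨x, y⟩).re|) := by
  have key : ∀ x ∈ Icc a b, HasDerivAt (fun x : ℝ => Gt t (u ⟨x, y⟩)) (Gt' t (u ⟨x, y⟩) * (f ⟨x, y⟩).re) x ∧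
      ContinuousAt (fun x : ℝ => Gt' t (u ⟨x, y⟩) * (f ⟨x, y⟩).re) x := by
    intro x hx
    have hl : ContinuousAt (fun x : ℝ => (⟨x, y⟩ : ℂ)) x :=
      (Complex.equivRealProdCLM.symm.continuous.comp (continuous_id.prodMk continuous_const)).continuousAt
    by_cases hu : 0 < u ⟨x, y⟩
    · have H := S.harm _ (hsub x hx) hu
      have H0 : HasDerivAt (fun s : ℝ => u ⟨s, y⟩) ((f ⟨x, y⟩).re) x := by
        have e : ∀ s : ℝ, (⟨s, y⟩ : ℂ) = ⟨0, y⟩ + (s:ℂ) * 1 := fun s => by apply Complex.ext <;> simp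
        have := HarmAt.hasDerivAt_line (h := u) (F := f) (z := ⟨0, y⟩) (ω := 1) (t := x) (by rw [← e]; exact H)
        simp only [← e] at this
        simpa using this
      refine ⟨(Gt_der t _).comp x H0, ?_⟩
      exact ((Gt'_cont t).continuousAt.comp H0.continuousAt).mul
        (continuous_re.continuousAt.comp ((S.fcont (hsub x hx) hu).comp_of_eq hl rfl))
    · have h1 : ∀ᶠ s : ℝ in 𝓝 x, u ⟨s, y⟩ < t :=
        ((S.cAt (hsub x hx)).comp_of_eq hl rfl).eventually (gt_mem_nhds (by simp only [Function.comp]; linarith))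
      constructor
      · rw [Gt'_zero ht (by linarith), zero_mul]
        refine (hasDerivAt_const x 0).congr_of_eventuallyEq ?_
        filter_upwards [h1] with s hs using Gt_zero ht hs.le
      · refine continuousAt_const.congr (f := fun _ => 0) ?_
        filter_upwards [h1] with s hs
        simp [Gt'_zero ht hs]
  have hint := intervalIntegral.integral_eq_sub_of_hasDerivAt (a := a) (b := b) (f := fun x : ℝ => Gt t (u ⟨x, y⟩))
    (fun x hx => (key x (by rwa [uIcc_of_le hab] at hx)).1)
    (ContinuousOn.intervalIntegrable fun x hx => (key x (by rwa [uIcc_of_le hab] at hx)).2.continuousWithinAt)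
  rw [← hint, intervalIntegral.integral_of_le hab, ← Real.enorm_eq_ofReal_abs]
  refine (enorm_integral_le_lintegral_enorm _).trans (lintegral_mono fun x => ?_)
  rw [Real.enorm_eq_ofReal_abs, abs_mul, abs_of_nonneg (Gt'_nonneg ht _)]

theorem ev_one {s : ℝ} (hs : 0 < s) : ∀ᶠ t in 𝓝[>] (0:ℝ), Gt t s = 1 ∧ 0 < t := by
  filter_upwards [self_mem_nhdsWithin, mem_nhdsWithin_of_mem_nhds (gt_mem_nhds (show (0:ℝ) < s / 2 by linarith))]
    with t h1 h2
  exact ⟨Gt_one h1 (by linarith), h1⟩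

theorem exists_MI : ∃ c₀ > 0, ∀ {Ω : Set ℂ} {u : ℂ → ℝ} {f N : ℂ → ℂ}, Sol Ω u f N → KK ⊆ Ω →
    ((∀ z ∈ KK, u z ≤ c₀) → ∃ y ∈ Ioo (1/4:ℝ) (1/2),
      ∀ x ∈ Icc (-1/2:ℝ) (1/2), ∀ x' ∈ Icc (-1/2:ℝ) (1/2), u ⟨x, y⟩ = 0 → 0 < u ⟨x', y⟩ → False) ∧
    ((∀ z ∈ KK, |u z - Pfun z| ≤ c₀) → ∃ y ∈ Ioo (1/4:ℝ) (1/2),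
      ∀ x ∈ Icc (-1/2:ℝ) (1/2), ∀ x' ∈ Icc (-1/2:ℝ) (1/2), x' < x → u ⟨x, y⟩ = 0 → 0 < u ⟨x', y⟩ → False) := by
  have hD : 0 ≤ DD := integral_nonneg fun z => abs_nonneg _
  have hm := mm_pos
  set c₀ := min (1/4) (mm / (4 * (DD + 1))) with hc
  have hc0 : 0 < c₀ := by rw [hc]; positivity
  have hcD : c₀ * DD ≤ mm / 4 := by
    calc c₀ * DD ≤ mm / (4 * (DD + 1)) * (DD + 1) := by gcongr; exact min_le_right _ _; linarith
      _ = mm / 4 := by field_simp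
  refine ⟨c₀, hc0, fun {Ω u f N} S hK => ⟨fun hu => ?_, fun hu => ?_⟩⟩
  all_goals
    have hseg : ∀ y ∈ Ioo (1/4:ℝ) (1/2), ∀ x ∈ Icc (-1/2:ℝ) (1/2), (⟨x, y⟩ : ℂ) ∈ KK := fun y hy x hx =>
      ⟨abs_le.2 ⟨by simp only; linarith [hx.1], by simp only; linarith [hx.2]⟩, hy.1.le, hy.2.le⟩
    by_contra hcon
    push Not at hcon
  · have := mi_core S hK (n := 1) (B := mm / 4) zero_le_one ?_ ?_
    · nlinarith
    · intro y hy
      obtain ⟨x, hx, x', hx', h1, h2, -⟩ := hcon y hy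
      filter_upwards [ev_one h2] with t ht
      rcases le_total x x' with h | h
      · have := var1 S (y := y) ht.2 h (fun s hs => hK (hseg y hy s ⟨hx.1.trans hs.1, hs.2.trans hx'.2⟩))
        rw [ht.1, h1, Gt_zero ht.2 ht.2.le, sub_zero, abs_one] at this
        refine this.trans (lintegral_mono_set ?_)
        exact fun s hs => ⟨hx.1.trans hs.1.le, hs.2.trans hx'.2⟩
      · have := var1 S (y := y) ht.2 h (fun s hs => hK (hseg y hy s ⟨hx'.1.trans hs.1, hs.2.trans hx.2⟩))
        rw [ht.1, h1, Gt_zero ht.2 ht.2.le, zero_sub, abs_neg, abs_one] at this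
        refine this.trans (lintegral_mono_set ?_)
        exact fun s hs => ⟨hx'.1.trans hs.1.le, hs.2.trans hx.2⟩
    · intro t ht
      have := mi_diff (u := u) (v := fun _ => 0) (t := t) (η := c₀)
        (mi_identity S.op S.cont S.harm phi_smooth phi_compact (phi_tsupport.trans hK) ht).1
        (by simp [Pt_zero ht ht.le]) (fun z hz => by
          rw [sub_zero, abs_of_nonneg (S.nonneg z (hK hz))]; exact hu z hz)
      simp only [Pt_zero ht ht.le, zero_mul, integral_zero, zero_add] at this
      linarith
  · have := mi_core S hK (n := 2) (B := mm + mm / 4) zero_le_two ?_ ?_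
    · nlinarith
    · intro y hy
      obtain ⟨x, hx, x', hx', hlt, h1, h2, -⟩ := hcon y hy
      have h12 : (1/2:ℝ) ∈ Icc (-1/2:ℝ) (1/2) := ⟨by norm_num, le_rfl⟩
      have h3 : 0 < u ⟨1/2, y⟩ := by
        have := hu _ (hseg y hy _ h12)
        have e : Pfun ⟨1/2, y⟩ = 1/2 := by simp [Pfun]
        have e2 := min_le_left (1/4) (mm / (4 * (DD + 1)))
        rw [e] at this
        have := (abs_le.1 this).1
        linarith
      filter_upwards [ev_one h2, ev_one h3] with t ht ht3
      have v1 := var1 S (y := y) ht.2 hlt.le (fun s hs => hK (hseg y hy s ⟨hx'.1.trans hs.1, hs.2.trans hx.2⟩))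
      have v2 := var1 S (y := y) ht.2 hx.2 (fun s hs => hK (hseg y hy s ⟨hx.1.trans hs.1, hs.2⟩))
      rw [ht.1, h1, Gt_zero ht.2 ht.2.le, zero_sub, abs_neg, abs_one] at v1
      rw [ht3.1, h1, Gt_zero ht.2 ht.2.le, sub_zero, abs_one] at v2
      have : ENNReal.ofReal 2 = ENNReal.ofReal 1 + ENNReal.ofReal 1 := by
        rw [← ENNReal.ofReal_add] <;> norm_num
      rw [this]
      refine (add_le_add v1 v2).trans ?_
      rw [← lintegral_union measurableSet_Ioc (by
        rw [Set.disjoint_left]; intro s h1 h2; linarith [h1.2, h2.1])]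
      refine lintegral_mono_set ?_
      rintro s (hs | hs)
      · exact ⟨hx'.1.trans hs.1.le, hs.2.trans hx.2⟩
      · exact ⟨hx.1.trans hs.1.le, hs.2⟩
    · intro t ht
      have := mi_diff (u := u) (v := Pfun) (t := t) (η := c₀)
        (mi_identity S.op S.cont S.harm phi_smooth phi_compact (phi_tsupport.trans hK) ht).1
        (mi_identity isOpen_univ P_cont.continuousOn P_harm phi_smooth phi_compact (subset_univ _) ht).1 hu
      have := P_mass ht
      linarith

noncomputable def c0 : ℝ := exists_MI.choose
theorem c0_pos : 0 < c0 := exists_MI.choose_spec.1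

theorem sep {F A B : Set ℂ} (hF : IsPreconnected F) (hA : IsOpen A) (hB : IsOpen B) (hd : ∀ z ∈ A, z ∉ B)
    (hc : ∀ z ∈ F, z ∈ A ∨ z ∈ B) {a b : ℂ} (ha : a ∈ F) (haA : a ∈ A) (hb : b ∈ F) (hbB : b ∈ B) : False := by
  obtain ⟨z, _, h1, h2⟩ := hF A B hA hB hc ⟨a, ha, haA⟩ ⟨b, hb, hbB⟩
  exact hd z h1 h2

section P6
variable {Ω : Set ℂ} {u : ℂ → ℝ} {f N : ℂ → ℂ}

theorem Sol.good_line (S : Sol Ω u f N) (hsub : closedBall 0 1 ⊆ Ω) (hu : ∀ z ∈ closedBall (0:ℂ) 1, u z ≤ c0)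
    {κ : ℂ} (hκ : ‖κ‖ = 1) : ∃ y ∈ Ioo (1/4:ℝ) (1/2),
      (∀ x ∈ Icc (-1/2:ℝ) (1/2), u (κ * ⟨x, y⟩) = 0) ∨ (∀ x ∈ Icc (-1/2:ℝ) (1/2), 0 < u (κ * ⟨x, y⟩)) := by
  have hκ0 : κ ≠ 0 := by rw [← norm_pos_iff, hκ]; norm_num
  have hb : ∀ z ∈ KK, κ * z + 0 ∈ closedBall (0:ℂ) 1 := by
    intro z hz
    rw [mem_closedBall, dist_zero_right, add_zero, norm_mul, hκ, one_mul]
    have h1 := sq_re_im z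
    have h2 := (abs_le.1 hz.1)
    nlinarith [hz.2.1, hz.2.2, norm_nonneg z]
  obtain ⟨y, hy, h⟩ := (exists_MI.choose_spec.2 (S.affine κ 0 hκ0) (fun z hz => hsub (hb z hz))).1
    (fun z hz => by rw [hκ, div_one]; exact hu _ (hb z hz))
  refine ⟨y, hy, ?_⟩
  simp only [hκ, div_one, add_zero] at h
  by_contra hcon
  push Not at hcon
  obtain ⟨⟨x1, hx1, h1⟩, x2, hx2, h2⟩ := hcon
  have hK : ∀ x ∈ Icc (-1/2:ℝ) (1/2), 0 ≤ u (κ * ⟨x, y⟩) := fun x hx => by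
    have := hb ⟨x, y⟩ ⟨abs_le.2 ⟨by simp only; linarith [hx.1], by simp only; linarith [hx.2]⟩, hy.1.le, hy.2.le⟩
    rw [add_zero] at this
    exact S.nonneg _ (hsub this)
  exact h x2 hx2 x1 hx1 (le_antisymm h2 (hK _ hx2)) (lt_of_le_of_ne (hK _ hx1) (Ne.symm h1))

theorem Sol.rect0 (S : Sol Ω u f N) (hsub : closedBall 0 1 ⊆ Ω) (hu : ∀ z ∈ closedBall (0:ℂ) 1, u z ≤ c0)
    (h0 : (0:ℂ) ∈ FB Ω u) {F : Set ℂ} (hF : IsPreconnected F) (hFB : F ⊆ FB Ω u) (h0F : (0:ℂ) ∈ F)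
    {w : ℂ} (hw : w ∈ F) (hw1 : 1 ≤ ‖w‖) : False := by
  obtain ⟨a, ha, la⟩ := S.good_line hsub hu (κ := 1) (by simp)
  obtain ⟨b, hb, lb⟩ := S.good_line hsub hu (κ := I) (by simp)
  obtain ⟨c, hc, lc⟩ := S.good_line hsub hu (κ := -1) (by simp)
  obtain ⟨e, he, le⟩ := S.good_line hsub hu (κ := -I) (by simp)
  have r1 : ∀ x y : ℝ, (1:ℂ) * ⟨x, y⟩ = ⟨x, y⟩ := fun x y => by simp
  have r2 : ∀ x y : ℝ, I * ⟨x, y⟩ = ⟨-y, x⟩ := fun x y => by apply Complex.ext <;> simp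
  have r3 : ∀ x y : ℝ, (-1:ℂ) * ⟨x, y⟩ = ⟨-x, -y⟩ := fun x y => by apply Complex.ext <;> simp
  have r4 : ∀ x y : ℝ, (-I) * ⟨x, y⟩ = ⟨y, -x⟩ := fun x y => by apply Complex.ext <;> simp
  simp only [r1, r2, r3, r4] at la lb lc le
  have m : ∀ {t : ℝ}, t ∈ Ioo (1/4:ℝ) (1/2) → t ∈ Icc (-1/2:ℝ) (1/2) ∧ -t ∈ Icc (-1/2:ℝ) (1/2) := fun {t} h =>
    ⟨⟨by linarith [h.1], h.2.le⟩, ⟨by linarith [h.2], by linarith [h.1]⟩⟩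
  set Q : Set ℂ := {z | -b ≤ z.re ∧ z.re ≤ e ∧ -c ≤ z.im ∧ z.im ≤ a} with hQ
  set Qi : Set ℂ := {z | -b < z.re ∧ z.re < e ∧ -c < z.im ∧ z.im < a} with hQi
  have hQc : IsClosed Q := (isClosed_le continuous_const continuous_re).inter
    ((isClosed_le continuous_re continuous_const).inter ((isClosed_le continuous_const continuous_im).inter
      (isClosed_le continuous_im continuous_const)))
  have hQo : IsOpen Qi := (isOpen_lt continuous_const continuous_re).inter
    ((isOpen_lt continuous_re continuous_const).inter ((isOpen_lt continuous_const continuous_im).inter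
      (isOpen_lt continuous_im continuous_const)))
  have hQb : Q ⊆ ball 0 1 := by
    intro z hz
    rw [mem_ball, dist_zero_right]
    have h1 := sq_re_im z
    obtain ⟨q1, q2, q3, q4⟩ := hz
    have k1 : z.re ^ 2 ≤ 1/4 := by nlinarith [ha.2, hb.2, hc.2, he.2]
    have k2 : z.im ^ 2 ≤ 1/4 := by nlinarith [ha.2, hb.2, hc.2, he.2]
    nlinarith [norm_nonneg z]
  have hbd : ∀ z ∈ Q, z ∉ Qi →
      (∃ x ∈ Icc (-1/2:ℝ) (1/2), z = ⟨x, a⟩) ∨ (∃ x ∈ Icc (-1/2:ℝ) (1/2), z = ⟨-b, x⟩) ∨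
      (∃ x ∈ Icc (-1/2:ℝ) (1/2), z = ⟨-x, -c⟩) ∨ (∃ x ∈ Icc (-1/2:ℝ) (1/2), z = ⟨e, -x⟩) := by
    intro z hz hzi
    obtain ⟨q1, q2, q3, q4⟩ := hz
    simp only [hQi, mem_setOf_eq, not_and_or, not_lt] at hzi
    rcases hzi with h | h | h | h
    · right; left
      exact ⟨z.im, ⟨by linarith [hc.2], by linarith [ha.2]⟩, Complex.ext (by simp; linarith) rfl⟩
    · right; right; right
      exact ⟨-z.im, ⟨by linarith [ha.2], by linarith [hc.2]⟩, Complex.ext (by simp; linarith) (by simp)⟩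
    · right; right; left
      exact ⟨-z.re, ⟨by linarith [he.2], by linarith [hb.2]⟩, Complex.ext (by simp) (by simp; linarith)⟩
    · left
      exact ⟨z.re, ⟨by linarith [hb.2], by linarith [he.2]⟩, Complex.ext rfl (by simp; linarith)⟩
  have h00 : (0:ℂ) ∈ Qi := ⟨by simp; linarith [hb.1], by simp; linarith [he.1], by simp; linarith [hc.1],
    by simp; linarith [ha.1]⟩
  have hiQ : Qi ⊆ Q := fun z hz => ⟨hz.1.le, hz.2.1.le, hz.2.2.1.le, hz.2.2.2.le⟩
  by_cases hs : u ⟨-b, a⟩ = 0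
  ·
    have la' : ∀ x ∈ Icc (-1/2:ℝ) (1/2), u ⟨x, a⟩ = 0 := la.resolve_right fun h => by
      have := h _ (m hb).2; rw [hs] at this; exact lt_irrefl _ this
    have lb' : ∀ x ∈ Icc (-1/2:ℝ) (1/2), u ⟨-b, x⟩ = 0 := lb.resolve_right fun h => by
      have := h _ (m ha).1; rw [hs] at this; exact lt_irrefl _ this
    have lc' : ∀ x ∈ Icc (-1/2:ℝ) (1/2), u ⟨-x, -c⟩ = 0 := lc.resolve_right fun h => by
      have := h _ (m hb).1; rw [lb' _ (m hc).2] at this; exact lt_irrefl _ this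
    have le' : ∀ x ∈ Icc (-1/2:ℝ) (1/2), u ⟨e, -x⟩ = 0 := le.resolve_right fun h => by
      have := h _ (m ha).2; rw [neg_neg, la' _ (m he).1] at this; exact lt_irrefl _ this
    have hz := S.zero_cpt (K := Q) (c := 0) (r := 1) ((isCompact_closedBall (0:ℂ) 1).of_isClosed_subset hQc
      (hQb.trans ball_subset_closedBall))
      ((hQb.trans ball_subset_closedBall).trans hsub) (hQb.trans ball_subset_closedBall) (by
        intro z hz hn
        have : z ∉ Qi := fun h => hn (mem_of_superset (hQo.mem_nhds h) hiQ)
        rcases hbd z hz this with ⟨x, hx, rfl⟩ | ⟨x, hx, rfl⟩ | ⟨x, hx, rfl⟩ | ⟨x, hx, rfl⟩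
        exacts [la' x hx, lb' x hx, lc' x hx, le' x hx])
    obtain ⟨w, hw1, hw2⟩ := mem_closure_iff.1 (S.memFB.1 h0).2.2 Qi hQo h00
    have := hz w (hiQ hw1)
    have := hw2.2
    linarith
  · have la' : ∀ x ∈ Icc (-1/2:ℝ) (1/2), 0 < u ⟨x, a⟩ := la.resolve_left fun h => hs (h _ (m hb).2)
    have lb' : ∀ x ∈ Icc (-1/2:ℝ) (1/2), 0 < u ⟨-b, x⟩ := lb.resolve_left fun h => hs (h _ (m ha).1)
    have lc' : ∀ x ∈ Icc (-1/2:ℝ) (1/2), 0 < u ⟨-x, -c⟩ := lc.resolve_left fun h => by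
      have h2 := lb' _ (m hc).2; rw [h _ (m hb).1] at h2; exact lt_irrefl _ h2
    have le' : ∀ x ∈ Icc (-1/2:ℝ) (1/2), 0 < u ⟨e, -x⟩ := le.resolve_left fun h => by
      have h2 := la' _ (m he).1
      have h3 := h _ (m ha).2
      rw [neg_neg] at h3
      rw [h3] at h2; exact lt_irrefl _ h2
    refine sep hF hQo hQc.isOpen_compl (fun z hz h => h (hiQ hz)) ?_ h0F h00 hw (b := w) ?_
    · intro z hz
      by_contra hcon
      simp only [not_or, mem_compl_iff, not_not] at hcon
      have hu0 := (S.memFB.1 (hFB hz)).2.1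
      rcases hbd z hcon.2 hcon.1 with ⟨x, hx, rfl⟩ | ⟨x, hx, rfl⟩ | ⟨x, hx, rfl⟩ | ⟨x, hx, rfl⟩
      exacts [(la' x hx).ne' hu0, (lb' x hx).ne' hu0, (lc' x hx).ne' hu0, (le' x hx).ne' hu0]
    · intro h
      have := hQb h
      rw [mem_ball, dist_zero_right] at this
      linarith

theorem Sol.rect (S : Sol Ω u f N) {z₀ : ℂ} {ρ : ℝ} (hρ : 0 < ρ) (hsub : closedBall z₀ ρ ⊆ Ω)
    (hu : ∀ z ∈ closedBall z₀ ρ, u z ≤ c0 * ρ)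
    (h0 : z₀ ∈ FB Ω u) {F : Set ℂ} (hF : IsPreconnected F) (hFB : F ⊆ FB Ω u) (h0F : z₀ ∈ F)
    {w : ℂ} (hw : w ∈ F) (hw1 : ρ ≤ ‖w - z₀‖) : False := by
  have hρ0 : (ρ:ℂ) ≠ 0 := by exact_mod_cast hρ.ne'
  have hn : ‖(ρ:ℂ)‖ = ρ := by simp [abs_of_pos hρ]
  have e1 : FB ((fun z => (ρ:ℂ) * z + z₀) ⁻¹' Ω) (fun z => u ((ρ:ℂ) * z + z₀) / ‖(ρ:ℂ)‖) =
    (fun z => (ρ:ℂ) * z + z₀) ⁻¹' FB Ω u := FB_preimage (affH ρ z₀ hρ0) ‖(ρ:ℂ)‖ (by rw [hn]; exact hρ)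
  have hm : ∀ z ∈ closedBall (0:ℂ) 1, (ρ:ℂ) * z + z₀ ∈ closedBall z₀ ρ := by
    intro z hz
    rw [mem_closedBall, dist_zero_right] at hz
    rw [mem_closedBall, dist_eq_norm, add_sub_cancel_right, norm_mul, hn]
    nlinarith
  refine (S.affine ρ z₀ hρ0).rect0 (fun z hz => hsub (hm z hz)) (fun z hz => ?_) ?_
    (F := (fun z => (ρ:ℂ) * z + z₀) ⁻¹' F) ?_ ?_ ?_ (w := (w - z₀) / ρ) ?_ ?_
  · rw [hn, div_le_iff₀ hρ]; exact hu _ (hm z hz)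
  · rw [e1]; simpa using h0
  · exact (affH ρ z₀ hρ0).isPreconnected_preimage.2 hF
  · rw [e1]; exact preimage_mono hFB
  · simpa using h0F
  · change (ρ:ℂ) * ((w - z₀) / ρ) + z₀ ∈ F
    rwa [mul_div_cancel₀ _ hρ0, sub_add_cancel]
  · rw [norm_div, hn, le_div_iff₀ hρ, one_mul]; exact hw1

end P6

noncomputable def bK : ℝ := 1 / c0 + 2
theorem bK_ge : 2 ≤ bK := by have := c0_pos; unfold bK; have : 0 < 1 / c0 := by positivity
                             linarith

structure NF (δ ε : ℝ) (Ω : Set ℂ) (u : ℂ → ℝ) (f N : ℂ → ℂ) : Prop where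
  S : Sol Ω u f N
  hδ : 0 < δ
  hδ' : δ ≤ 1 / 256
  hε : 0 < ε
  hb : bK * ε ≤ 1 / 1000
  dom : ∀ z, δ < ‖z‖ → ‖z‖ < 1 → z ∈ Ω
  flat : ∀ z, δ < ‖z‖ → ‖z‖ < 1 → |u z - Pfun z| ≤ ε
  ne : (FB Ω u).Nonempty
  nc : ∀ z ∈ FB Ω u, ∃ F ⊆ FB Ω u, IsPreconnected F ∧ z ∈ F ∧ ∀ s, δ < s → s < 1 → ∃ w ∈ F, ‖w‖ = s

theorem Pfun_conj (z : ℂ) : Pfun ((starRingEnd ℂ) z) = Pfun z := by simp [Pfun]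

theorem NF.conj {δ ε Ω u f N} (H : NF δ ε Ω u f N) :
    NF δ ε ((starRingEnd ℂ) ⁻¹' Ω) (fun z => u ((starRingEnd ℂ) z))
      (fun z => (starRingEnd ℂ) (f ((starRingEnd ℂ) z)))
      (fun z => (starRingEnd ℂ) (N ((starRingEnd ℂ) z))) := by
  have hFB : FB ((starRingEnd ℂ) ⁻¹' Ω) (fun z => u ((starRingEnd ℂ) z)) =
      (starRingEnd ℂ) ⁻¹' FB Ω u := by
    have := FB_preimage (Ω := Ω) (u := u) conjCLE.toHomeomorph 1 one_pos
    simp only [div_one] at this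
    exact this
  refine ⟨H.S.conj, H.hδ, H.hδ', H.hε, H.hb, fun z h1 h2 => H.dom _ (by simpa using h1) (by simpa using h2),
    fun z h1 h2 => ?_, ?_, ?_⟩
  · rw [← Pfun_conj z]; exact H.flat _ (by simpa using h1) (by simpa using h2)
  · obtain ⟨z, hz⟩ := H.ne
    exact ⟨(starRingEnd ℂ) z, by rw [hFB]; simpa using hz⟩
  · intro z hz
    rw [hFB] at hz
    obtain ⟨F, h1, h2, h3, h4⟩ := H.nc _ hz
    refine ⟨(starRingEnd ℂ) ⁻¹' F, by rw [hFB]; exact preimage_mono h1,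
      conjCLE.toHomeomorph.isPreconnected_preimage.2 h2, h3, fun s hs1 hs2 => ?_⟩
    obtain ⟨w, hw, e⟩ := h4 s hs1 hs2
    exact ⟨(starRingEnd ℂ) w, by simpa using hw, by simpa using e⟩

section P7
variable {Ω : Set ℂ} {u : ℂ → ℝ} {f N : ℂ → ℂ} {δ ε : ℝ}

theorem NF.small (H : NF δ ε Ω u f N) : ε ≤ 1 / 2000 ∧ ε / c0 ≤ 1 / 1000 ∧ ε / c0 + 2 * ε = bK * ε ∧ ε ≤ c0 := by
  have hc := c0_pos
  have e : ε / c0 + 2 * ε = bK * ε := by unfold bK; ring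
  have h1 := H.hb
  have h2 := H.hε
  have h3 : 0 < ε / c0 := by positivity
  refine ⟨by linarith, by linarith, e, ?_⟩
  have : ε / c0 ≤ 1 := by linarith
  rwa [div_le_one hc] at this

theorem Pfun_le_of {z : ℂ} {a : ℝ} (h : z.re ≤ a) (ha : 0 ≤ a) : Pfun z ≤ a := max_le h ha

theorem NF.pos_of (H : NF δ ε Ω u f N) {z : ℂ} (h1 : δ < ‖z‖) (h2 : ‖z‖ < 1) (h : ε < z.re) : 0 < u z := by
  have h3 := (abs_le.1 (H.flat z h1 h2)).1
  have : z.re ≤ Pfun z := le_max_left _ _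
  linarith

theorem NF.strip (H : NF δ ε Ω u f N) {z : ℂ} (hz : z ∈ FB Ω u) (h1 : 1 / 64 ≤ ‖z‖) (h2 : ‖z‖ ≤ 3 / 4) :
    |z.re| ≤ bK * ε := by
  obtain ⟨s1, s2, s3, s4⟩ := H.small
  have hc := c0_pos
  have hε := H.hε
  have hρ : 0 < ε / c0 := by positivity
  rw [abs_le]
  constructor
  · by_contra hlt
    push Not at hlt
    have hball : ∀ w ∈ closedBall z (ε / c0), δ < ‖w‖ ∧ ‖w‖ < 1 ∧ w.re ≤ 0 := by
      intro w hw
      rw [mem_closedBall, dist_eq_norm] at hw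
      have k1 := norm_sub_norm_le w z
      have k2 := norm_sub_norm_le z w
      rw [norm_sub_rev] at k2
      have k3 := (abs_le.1 ((Complex.abs_re_le_norm (w - z)).trans hw)).2
      rw [sub_re] at k3
      exact ⟨by linarith [H.hδ'], by linarith, by linarith⟩
    obtain ⟨F, f1, f2, f3, f4⟩ := H.nc z hz
    obtain ⟨w, hw, hwn⟩ := f4 (1/128) (by linarith [H.hδ']) (by norm_num)
    refine H.S.rect hρ (fun w hw => H.dom w (hball w hw).1 (hball w hw).2.1) (fun w hw => ?_) hz f2 f1 f3 hw ?_
    · have h3 := (abs_le.1 (H.flat w (hball w hw).1 (hball w hw).2.1)).2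
      have h4 := Pfun_le_of (hball w hw).2.2 le_rfl
      rw [mul_div_cancel₀ _ hc.ne']
      linarith
    · have k2 := norm_sub_norm_le z w
      rw [norm_sub_rev] at k2
      linarith
  · by_contra hlt
    push Not at hlt
    have := H.pos_of (z := z) (by linarith [H.hδ']) (by linarith) (by linarith)
    linarith [(H.S.memFB.1 hz).2.1]

theorem leftset_conn {β : ℝ} (hβ : 0 < β) :
    IsPreconnected {z : ℂ | z.re < -β ∧ 1 / 64 < ‖z‖ ∧ ‖z‖ < 3 / 4} := by
  have hC : Convex ℝ {p : ℝ × ℝ | (1 / 64 < p.1 ∧ p.1 < 3 / 4) ∧ ‖(⟨p.2, β⟩ : ℂ)‖ < p.1} := by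
    rintro p ⟨⟨p1, p2⟩, p3⟩ q ⟨⟨q1, q2⟩, q3⟩ a b ha hb hab
    simp only [mem_setOf_eq, Prod.fst_add, Prod.smul_fst, smul_eq_mul, Prod.snd_add, Prod.smul_snd]
    have e : (⟨a * p.2 + b * q.2, β⟩ : ℂ) = (a:ℂ) * ⟨p.2, β⟩ + (b:ℂ) * ⟨q.2, β⟩ := by
      apply Complex.ext
      · simp
      · simp; rw [← add_mul, hab, one_mul]
    have h5 : ‖(⟨a * p.2 + b * q.2, β⟩ : ℂ)‖ ≤ a * ‖(⟨p.2, β⟩ : ℂ)‖ + b * ‖(⟨q.2, β⟩ : ℂ)‖ := by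
      rw [e]
      refine (norm_add_le _ _).trans ?_
      simp [abs_of_nonneg ha, abs_of_nonneg hb]
    rcases eq_or_lt_of_le ha with h0 | h0
    · have : b = 1 := by linarith
      subst h0; subst this; simp at h5 ⊢; exact ⟨⟨by linarith, q2⟩, q3⟩
    · refine ⟨⟨?_, ?_⟩, ?_⟩
      · have : b = 1 - a := by linarith
        subst this; nlinarith
      · have : b = 1 - a := by linarith
        subst this; nlinarith
      · nlinarith
  have := hC.isPreconnected.image (fun p : ℝ × ℝ => (⟨-Real.sqrt (p.1 ^ 2 - p.2 ^ 2), p.2⟩ : ℂ)) (by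
    have : Continuous (fun p : ℝ × ℝ => (-Real.sqrt (p.1 ^ 2 - p.2 ^ 2), p.2)) := by fun_prop
    exact (Complex.equivRealProdCLM.symm.continuous.comp this).continuousOn)
  convert this using 1
  ext z
  simp only [mem_setOf_eq, mem_image, Prod.exists]
  constructor
  · rintro ⟨h1, h2, h3⟩
    have hn := sq_re_im z
    refine ⟨‖z‖, z.im, ⟨⟨h2, h3⟩, ?_⟩, ?_⟩
    · refine lt_of_pow_lt_pow_left₀ 2 (norm_nonneg _) ?_
      rw [← sq_re_im (⟨z.im, β⟩ : ℂ), ← hn]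
      simp only
      nlinarith
    · have : ‖z‖ ^ 2 - z.im ^ 2 = (-z.re) ^ 2 := by rw [← hn]; ring
      rw [this, Real.sqrt_sq (by linarith), neg_neg]
  · rintro ⟨r, y, ⟨⟨h1, h2⟩, h3⟩, rfl⟩
    have h4 : β ^ 2 < r ^ 2 - y ^ 2 := by
      have := sq_re_im (⟨y, β⟩ : ℂ)
      simp only at this
      have h5 := pow_lt_pow_left₀ h3 (norm_nonneg _) two_ne_zero
      nlinarith
    have h6 : 0 ≤ r ^ 2 - y ^ 2 := by nlinarith
    have hn : ‖(⟨-Real.sqrt (r ^ 2 - y ^ 2), y⟩ : ℂ)‖ = r := by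
      rw [← sq_eq_sq₀ (norm_nonneg _) (by linarith), ← sq_re_im]
      simp only [neg_sq, Real.sq_sqrt h6]; ring
    rw [hn]
    refine ⟨?_, h1, h2⟩
    have := Real.lt_sqrt_of_sq_lt h4
    simp only; linarith

theorem NF.up_line (H : NF δ ε Ω u f N) (hp : ∀ z : ℂ, z.re < -(bK * ε) → 1 / 64 < ‖z‖ → ‖z‖ < 3 / 4 → 0 < u z) :
    ∃ y ∈ Ioo (1/4:ℝ) (1/2), ∀ x, |x| ≤ 1 / 8 → u ⟨x, y⟩ ≠ 0 := by
  obtain ⟨s1, s2, s3, s4⟩ := H.small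
  have hK : ∀ z ∈ KK, δ < ‖z‖ ∧ ‖z‖ < 1 := by
    intro z hz
    have h1 := sq_re_im z
    have h2 := (abs_le.1 hz.1)
    have h3 := H.hδ'
    have h4 := H.hδ
    have h5 := hz.2.1
    have h6 := hz.2.2
    exact ⟨by have := Complex.abs_im_le_norm z; rw [abs_of_nonneg (by linarith)] at this; linarith,
      by nlinarith [norm_nonneg z]⟩
  obtain ⟨y, hy, h⟩ := (exists_MI.choose_spec.2 H.S (fun z hz => H.dom z (hK z hz).1 (hK z hz).2)).2
    (fun z hz => (H.flat z (hK z hz).1 (hK z hz).2).trans s4)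
  refine ⟨y, hy, fun x hx h0 => ?_⟩
  have hx := abs_le.1 hx
  refine h x ⟨by linarith, by linarith⟩ (-1/4) ⟨by norm_num, by norm_num⟩ (by linarith) h0 (hp _ ?_ ?_ ?_)
  · have := H.hb; simp only; linarith
  · have := Complex.abs_im_le_norm (⟨-1/4, y⟩ : ℂ)
    simp only at this
    rw [abs_of_nonneg (by linarith [hy.1])] at this; linarith [hy.1]
  · have h1 := sq_re_im (⟨-1/4, y⟩ : ℂ)
    simp only at h1
    nlinarith [hy.1, hy.2, norm_nonneg (⟨-1/4, y⟩ : ℂ)]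

theorem NF.left (H : NF δ ε Ω u f N) {z : ℂ} (h0 : z.re < -(bK * ε)) (h1 : 1 / 64 < ‖z‖) (h2 : ‖z‖ < 3 / 4) :
    u z = 0 := by
  obtain ⟨s1, s2, s3, s4⟩ := H.small
  have hβ : 0 < bK * ε := mul_pos (by linarith [bK_ge]) H.hε
  have hΩ : ∀ w : ℂ, 1 / 64 < ‖w‖ → ‖w‖ < 3 / 4 → w ∈ Ω := fun w a b =>
    H.dom w (by linarith [H.hδ']) (by linarith)
  by_contra hne
  have hpz : 0 < u z := lt_of_le_of_ne (H.S.nonneg z (hΩ z h1 h2)) (Ne.symm hne)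
  have hp : ∀ w : ℂ, w.re < -(bK * ε) → 1 / 64 < ‖w‖ → ‖w‖ < 3 / 4 → 0 < u w := by
    intro w a1 a2 a3
    by_contra hw
    refine sep (leftset_conn hβ) (A := posSet Ω u) (B := interior {w | u w = 0}) (posSet_open H.S.op H.S.cont)
      isOpen_interior ?_ ?_ (a := z) (b := w) ⟨h0, h1, h2⟩ ⟨hΩ z h1 h2, hpz⟩ ⟨a1, a2, a3⟩ ?_
    · intro v hv hv'
      have := interior_subset hv'
      have h5 := hv.2
      simp only [mem_setOf_eq] at this
      linarith
    · rintro v ⟨v1, v2, v3⟩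
      by_cases hv : 0 < u v
      · exact Or.inl ⟨hΩ v v2 v3, hv⟩
      · right
        have hv0 := le_antisymm (not_lt.1 hv) (H.S.nonneg v (hΩ v v2 v3))
        rw [mem_interior_iff_mem_nhds]
        filter_upwards [H.S.not_fb (hΩ v v2 v3) hv0 (fun hf => by
          have := (abs_le.1 (H.strip hf v2.le v3.le)).1
          linarith)] with x hx using hx.2
    · have hv0 := le_antisymm (not_lt.1 hw) (H.S.nonneg w (hΩ w a2 a3))
      rw [mem_interior_iff_mem_nhds]
      filter_upwards [H.S.not_fb (hΩ w a2 a3) hv0 (fun hf => by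
          have := (abs_le.1 (H.strip hf a2.le a3.le)).1
          linarith)] with x hx using hx.2
  obtain ⟨a, ha, la⟩ := H.up_line hp
  obtain ⟨b, hb, lb⟩ := H.conj.up_line (fun w a1 a2 a3 => hp _ (by simpa using a1) (by simpa using a2) (by simpa using a3))
  obtain ⟨p, hp'⟩ := H.ne
  obtain ⟨F, f1, f2, f3, f4⟩ := H.nc p hp'
  obtain ⟨w1, hw1, n1⟩ := f4 (1/16) (by linarith [H.hδ']) (by norm_num)
  obtain ⟨w2, hw2, n2⟩ := f4 (0.72) (by linarith [H.hδ']) (by norm_num)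
  refine sep f2 (A := {z | (-b < z.im ∧ z.im < a) ∧ ‖z‖ < 0.7}) (B := {z | (z.im < -b ∨ a < z.im) ∨ 0.7 < ‖z‖})
    (((isOpen_lt continuous_const continuous_im).inter (isOpen_lt continuous_im continuous_const)).inter
      (isOpen_lt continuous_norm continuous_const))
    (((isOpen_lt continuous_im continuous_const).union (isOpen_lt continuous_const continuous_im)).union
      (isOpen_lt continuous_const continuous_norm)) ?_ ?_ hw1 ?_ hw2 ?_
  · rintro v ⟨⟨v1, v2⟩, v3⟩ ((v4 | v4) | v4) <;> linarith
  · intro v hv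
    by_contra hcon
    simp only [mem_setOf_eq, not_or, not_and_or, not_lt] at hcon
    obtain ⟨k1, ⟨k2, k3⟩, k4⟩ := hcon
    have hu := (H.S.memFB.1 (f1 hv)).2.1
    have him := abs_le.1 (Complex.abs_im_le_norm v)
    have hlow : 1 / 64 ≤ ‖v‖ := by
      rcases k1 with (k1 | k1) | k1
      · linarith [hb.1]
      · linarith [ha.1]
      · linarith
    have hst := H.strip (f1 hv) hlow (by linarith)
    have hst8 : |v.re| ≤ 1 / 8 := by linarith [H.hb]
    rcases k1 with (k1 | k1) | k1
    · apply lb v.re hst8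
      have : (starRingEnd ℂ) (⟨v.re, b⟩ : ℂ) = v := by
        apply Complex.ext <;> simp; linarith
      rw [this]; exact hu
    · apply la v.re hst8
      have : (⟨v.re, a⟩ : ℂ) = v := by apply Complex.ext <;> simp; linarith
      rw [this]; exact hu
    · have h5 := sq_re_im v
      have h6 := abs_le.1 hst8
      nlinarith [ha.2, hb.2]
  · have him := abs_le.1 (Complex.abs_im_le_norm w1)
    exact ⟨⟨by linarith [hb.1], by linarith [ha.1]⟩, by linarith⟩
  · right; simp only [n2]; norm_num

noncomputable def C1 : ℝ := 640 * (1 + 2 * bK)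

theorem NF.qb (H : NF δ ε Ω u f N) {z : ℂ} (h1 : 1 / 32 ≤ ‖z‖) (h2 : ‖z‖ ≤ 1 / 2) : qf u f z ≤ C1 * ε := by
  obtain ⟨s1, s2, s3, s4⟩ := H.small
  have hε := H.hε
  have hβ : 0 < bK * ε := mul_pos (by linarith [bK_ge]) H.hε
  have hin : ∀ w ∈ closedBall z (1/128), 1 / 64 < ‖w‖ ∧ ‖w‖ < 3 / 4 := by
    intro w hw
    rw [mem_closedBall, dist_eq_norm] at hw
    have k1 := norm_sub_norm_le w z
    have k2 := norm_sub_norm_le z w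
    rw [norm_sub_rev] at k2
    exact ⟨by linarith, by linarith⟩
  have hΩ : ∀ w ∈ closedBall z (1/128), w ∈ Ω := fun w hw =>
    H.dom w (by linarith [H.hδ', (hin w hw).1]) (by linarith [(hin w hw).2])
  have := bernst (h := qf u f) (e := fun w => u w - max w.re (-(2 * (bK * ε)))) (Fh := fun w => deriv f w / f w)
    (Fe := fun w => f w - 1) (z₀ := z) (ρ := 1/128) (η := ε + 2 * (bK * ε)) (by norm_num) (by positivity)
    (H.S.q_cont.mono hΩ) ((H.S.cont.mono hΩ).sub (continuous_re.max continuous_const).continuousOn)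
    (fun w hw hq => H.S.q_harm (hΩ w (ball_subset_closedBall hw)) hq) ?_ ?_ ?_
  · refine this.trans (le_of_eq ?_)
    unfold C1; ring
  · intro w hw hq
    have hw' := ball_subset_closedBall hw
    have hu := (qf_pos hq).1
    have hre : -(bK * ε) ≤ w.re := by
      by_contra h; rw [H.left (not_le.1 h) (hin w hw').1 (hin w hw').2] at hu; exact lt_irrefl _ hu
    refine ((H.S.harm w (hΩ w hw') hu).sub (HarmAt.re_mul 1 0 w)).congr ?_
    have : ∀ᶠ v : ℂ in 𝓝 w, -(2 * (bK * ε)) < v.re :=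
      continuous_re.continuousAt.eventually (lt_mem_nhds (by linarith))
    filter_upwards [this] with v hv
    rw [max_eq_left hv.le]; simp
  · intro w hw hq
    obtain ⟨q1, q2, q3⟩ := qf_pos hq
    rw [q3]
    have h5 := Real.log_le_sub_one_of_pos (show 0 < ‖f w‖ by linarith)
    have h6 := norm_sub_norm_le (f w) 1
    rw [norm_one] at h6
    linarith
  · intro w hw
    have hf := abs_le.1 (H.flat w (by linarith [H.hδ', (hin w hw).1]) (by linarith [(hin w hw).2]))
    by_cases hre : w.re < -(bK * ε)
    · rw [H.left hre (hin w hw).1 (hin w hw).2]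
      rw [abs_le]
      constructor
      · have : max w.re (-(2 * (bK * ε))) ≤ 0 := max_le (by linarith) (by linarith)
        linarith
      · linarith [le_max_right w.re (-(2 * (bK * ε)))]
    · rw [max_eq_left (by linarith), abs_le]
      unfold Pfun at hf
      rcases le_total w.re 0 with h | h
      · rw [max_eq_right h] at hf; constructor <;> linarith
      · rw [max_eq_left h] at hf; constructor <;> linarith

theorem NF.intgrad (H : NF δ ε Ω u f N) {z : ℂ} (h1 : 1 / 32 ≤ ‖z‖) (h2 : ‖z‖ ≤ 1 / 2) (h3 : 1 / 160 ≤ u z) :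
    ‖f z - 1‖ ≤ 2000 * ε := by
  obtain ⟨s1, s2, s3, s4⟩ := H.small
  have hε := H.hε
  by_contra hcon
  push Not at hcon
  have hne : 0 < ‖f z - 1‖ := by linarith
  have hzre : 1 / 200 < z.re := by
    have hf := abs_le.1 (H.flat z (by linarith [H.hδ']) (by linarith))
    by_contra h
    have := Pfun_le_of (not_lt.1 h) (by norm_num)
    linarith
  have hin : ∀ w ∈ closedBall z (1/400), (1 / 64 < ‖w‖ ∧ ‖w‖ < 3 / 4) ∧ 1 / 400 < w.re := by
    intro w hw
    rw [mem_closedBall, dist_eq_norm] at hw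
    have k1 := norm_sub_norm_le w z
    have k2 := norm_sub_norm_le z w
    rw [norm_sub_rev] at k2
    have k3 := abs_le.1 ((Complex.abs_re_le_norm (w - z)).trans hw)
    rw [sub_re] at k3
    exact ⟨⟨by linarith, by linarith⟩, by linarith⟩
  have hn : ∀ w ∈ closedBall z (1/400), δ < ‖w‖ ∧ ‖w‖ < 1 := fun w hw =>
    ⟨by linarith [H.hδ', (hin w hw).1.1], by linarith [(hin w hw).1.2]⟩
  have hΩ : ∀ w ∈ closedBall z (1/400), w ∈ Ω := fun w hw => H.dom w (hn w hw).1 (hn w hw).2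
  have hup : ∀ w ∈ closedBall z (1/400), 0 < u w := fun w hw =>
    H.pos_of (hn w hw).1 (hn w hw).2 (by linarith [(hin w hw).2])
  set κ : ℂ := (starRingEnd ℂ) (f z - 1) / ‖f z - 1‖ with hκ
  have hκ1 : ‖κ‖ = 1 := by
    rw [hκ, norm_div, RCLike.norm_conj, norm_real, norm_norm, div_self hne.ne']
  have hfc : ContinuousOn f (closedBall z (1/400)) := fun w hw => (H.S.fcont (hΩ w hw) (hup w hw)).continuousWithinAt
  have := bernst (h := fun w => max ((κ * (f w - 1)).re) 0) (e := fun w => u w - w.re) (Fh := fun w => κ * deriv f w)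
    (Fe := fun w => f w - 1) (z₀ := z) (ρ := 1/400) (η := ε) (by norm_num) (by positivity)
    ((continuous_re.comp_continuousOn (continuousOn_const.mul (hfc.sub continuousOn_const))).sup continuousOn_const)
    ((H.S.cont.mono hΩ).sub continuous_re.continuousOn) ?_ ?_ ?_ ?_
  · have e : (κ * (f z - 1)).re = ‖f z - 1‖ := by
      rw [hκ, div_mul_eq_mul_div, mul_comm, Complex.mul_conj, Complex.normSq_eq_norm_sq]
      norm_cast
      rw [sq, mul_div_assoc, div_self hne.ne', mul_one]
    have h5 := le_max_left ((κ * (f z - 1)).re) 0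
    rw [e] at h5 this
    linarith
  · intro w hw hq
    have hw' := ball_subset_closedBall hw
    have ha := (H.S.harm w (hΩ w hw') (hup w hw')).analyticAt
    refine HarmAt.congr (h := fun w => (κ * (f w - 1)).re) ⟨fun w => κ * (f w - 1), ?_⟩ ?_
    · filter_upwards [ha.eventually_analyticAt] with v hv
      exact ⟨(hv.differentiableAt.hasDerivAt.sub_const 1).const_mul κ, rfl⟩
    · have hq' : 0 < (κ * (f w - 1)).re := by
        by_contra h; simp only [max_eq_right (not_lt.1 h)] at hq; exact lt_irrefl _ hq
      have hc : ContinuousAt (fun w => (κ * (f w - 1)).re) w :=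
        continuous_re.continuousAt.comp (continuousAt_const.mul (ha.continuousAt.sub continuousAt_const))
      filter_upwards [hc.eventually (lt_mem_nhds hq')] with v hv
      exact max_eq_left (le_of_lt hv)
  · intro w hw hq
    have hw' := ball_subset_closedBall hw
    refine ((H.S.harm w (hΩ w hw') (hup w hw')).sub (HarmAt.re_mul 1 0 w)).congr ?_
    exact Eventually.of_forall fun v => by simp
  · intro w hw hq
    refine max_le ?_ (norm_nonneg _)
    have := Complex.re_le_norm (κ * (f w - 1))
    rwa [norm_mul, hκ1, one_mul] at this
  · intro w hw
    have hf := H.flat w (hn w hw).1 (hn w hw).2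
    unfold Pfun at hf
    rwa [max_eq_left (by linarith [(hin w hw).2])] at hf

end P7

def Flat (d ε : ℝ) (u : ℂ → ℝ) (a : ℂ) : Prop :=
  ∀ z : ℂ, d < ‖a‖ * ‖z‖ → ‖z‖ < 1 → |u (a * z) / ‖a‖ - Pfun z| ≤ ε

structure Og (d : ℝ) (u : ℂ → ℝ) (f N : ℂ → ℂ) : Prop where
  S : Sol (ann d 1) u f N
  hd : 0 < d
  ne : (FB (ann d 1) u).Nonempty
  nc : ∀ z ∈ FB (ann d 1) u, ∃ F ⊆ FB (ann d 1) u, IsPreconnected F ∧ z ∈ F ∧ ∀ s, d < s → s < 1 → ∃ w ∈ F, ‖w‖ = s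

theorem Sol.scale {Ω : Set ℂ} {u : ℂ → ℝ} {f N : ℂ → ℂ} (S : Sol Ω u f N) (a : ℂ) (ha : a ≠ 0) :
    Sol ((fun z => a * z) ⁻¹' Ω) (fun z => u (a * z) / ‖a‖)
      (fun z => f (a * z) * a / ‖a‖) (fun z => N (a * z) * (starRingEnd ℂ) a / ‖a‖) := by
  simpa using S.affine a 0 ha

theorem FB_scale (Ω : Set ℂ) (u : ℂ → ℝ) {a : ℂ} (ha : a ≠ 0) :
    FB ((fun z => a * z) ⁻¹' Ω) (fun z => u (a * z) / ‖a‖) = (fun z => a * z) ⁻¹' FB Ω u := by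
  have := FB_preimage (Ω := Ω) (u := u) (affH a 0 ha) ‖a‖ (norm_pos_iff.2 ha)
  have e : (affH a 0 ha : ℂ → ℂ) = fun z => a * z := by
    funext z; change a * z + 0 = _; simp
  rw [e] at this
  exact this

theorem qf_scale {u : ℂ → ℝ} {f : ℂ → ℂ} {a : ℂ} (ha : a ≠ 0) (z : ℂ) :
    qf (fun z => u (a * z) / ‖a‖) (fun z => f (a * z) * a / ‖a‖) z = qf u f (a * z) := by
  have hk := norm_pos_iff.2 ha
  unfold qf
  have e : ‖f (a * z) * a / ‖a‖‖ = ‖f (a * z)‖ := by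
    rw [norm_div, norm_mul]; simp [hk.ne']
  simp only [e]
  have : 0 < u (a * z) / ‖a‖ ↔ 0 < u (a * z) := by simp [div_pos_iff, hk, hk.le.not_gt]
  simp only [this]

section P8
variable {u : ℂ → ℝ} {f N : ℂ → ℂ} {d ε : ℝ}

theorem Og.nf (O : Og d u f N) {a : ℂ} (ha1 : ‖a‖ ≤ 1) (ha : 256 * d ≤ ‖a‖) (hf : Flat d ε u a)
    (hε : 0 < ε) (hb : bK * ε ≤ 1 / 1000) :
    NF (d / ‖a‖) ε ((fun z => a * z) ⁻¹' ann d 1) (fun z => u (a * z) / ‖a‖)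
      (fun z => f (a * z) * a / ‖a‖) (fun z => N (a * z) * (starRingEnd ℂ) a / ‖a‖) := by
  have hd := O.hd
  have hk : 0 < ‖a‖ := by linarith
  have ha0 : a ≠ 0 := norm_pos_iff.1 hk
  refine ⟨O.S.scale a ha0, by positivity, ?_, hε, hb, ?_, ?_, ?_, ?_⟩
  · rw [div_le_iff₀ hk]; linarith
  · intro z h1 h2
    rw [div_lt_iff₀ hk] at h1
    rw [mem_preimage, ann, mem_setOf_eq, norm_mul]
    constructor
    · linarith
    · nlinarith
  · intro z h1 h2
    rw [div_lt_iff₀ hk] at h1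
    exact hf z (by linarith) h2
  · obtain ⟨z, hz⟩ := O.ne
    refine ⟨z / a, ?_⟩
    rw [FB_scale _ _ ha0, mem_preimage, mul_div_cancel₀ _ ha0]; exact hz
  · intro z hz
    rw [FB_scale _ _ ha0] at hz ⊢
    obtain ⟨F, h1, h2, h3, h4⟩ := O.nc _ hz
    refine ⟨(fun z => z / a) '' F, ?_, h2.image _ (by fun_prop), ⟨a * z, h3, by field_simp⟩, ?_⟩
    · rintro _ ⟨w, hw, rfl⟩
      rw [mem_preimage, mul_div_cancel₀ _ ha0]; exact h1 hw
    · intro s hs1 hs2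
      rw [div_lt_iff₀ hk] at hs1
      obtain ⟨w, hw, e⟩ := h4 (s * ‖a‖) hs1 (by nlinarith [mul_lt_mul_of_pos_right hs2 hk])
      refine ⟨w / a, ⟨w, hw, rfl⟩, ?_⟩
      rw [norm_div, e]; field_simp

def Fl (d ε : ℝ) (u : ℂ → ℝ) : Prop := ∀ r, d < r → r < 1 → ∃ a : ℂ, ‖a‖ = r ∧ Flat d ε u a

theorem Og.pt (O : Og d u f N) (hF : Fl d ε u) (hε : 0 < ε) (hb : bK * ε ≤ 1 / 1000)
    {z : ℂ} (h1 : 64 * d ≤ ‖z‖) (h2 : ‖z‖ < 1 / 4) :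
    qf u f z ≤ C1 * ε ∧ u z ≤ 2 * ‖z‖ ∧
    (‖z‖ / 5 ≤ u z → u z - 9000 * ε * ‖z‖ ≤ (f z * z).re) := by
  have hd := O.hd
  have hz : 0 < ‖z‖ := by linarith
  obtain ⟨a, ha, hfl⟩ := hF (4 * ‖z‖) (by linarith) (by linarith)
  have hk : 0 < ‖a‖ := by linarith
  have ha0 : a ≠ 0 := norm_pos_iff.1 hk
  have H := O.nf (by linarith) (by linarith) hfl hε hb
  have e0 : a * (z / a) = z := mul_div_cancel₀ _ ha0
  have hn : ‖z / a‖ = 1 / 4 := by rw [norm_div, ha]; field_simp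
  have q1 := H.qb (z := z / a) (by rw [hn]; norm_num) (by rw [hn]; norm_num)
  rw [qf_scale ha0, e0] at q1
  have fl := hfl (z / a) (by rw [ha, hn]; linarith) (by rw [hn]; norm_num)
  rw [e0, ha] at fl
  obtain ⟨s1, -⟩ := H.small
  have hP : Pfun (z / a) ≤ 1 / 4 := by
    rw [← hn]; exact max_le (re_le_norm _) (norm_nonneg _)
  have fl' := abs_le.1 fl
  have hu : u z = u z / (4 * ‖z‖) * (4 * ‖z‖) := by field_simp
  have hu1 : u z / (4 * ‖z‖) ≤ 1 / 4 + ε := by linarith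
  refine ⟨q1, ?_, ?_⟩
  · rw [hu]; nlinarith
  · intro h5
    have h6 : 1 / 20 ≤ u z / (4 * ‖z‖) := by rw [le_div_iff₀ (by linarith)]; linarith
    have g := H.intgrad (z := z / a) (by rw [hn]; norm_num) (by rw [hn]; norm_num)
      (by simp only [e0, ha]; linarith)
    simp only [e0] at g
    set F := f z * a / ‖a‖ with hFd
    have e1 : f z * z = ((4 * ‖z‖ : ℝ) : ℂ) * (F * (z / a)) := by
      rw [hFd, ha]
      have : ((4 * ‖z‖ : ℝ) : ℂ) ≠ 0 := by exact_mod_cast (by positivity : (4 * ‖z‖) ≠ 0)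
      field_simp
    have e2 : (F * (z / a)).re = (z / a).re + ((F - 1) * (z / a)).re := by
      rw [← add_re]; congr 1; ring
    have e3 : -(2000 * ε * (1/4)) ≤ ((F - 1) * (z / a)).re := by
      have := abs_re_le_norm ((F - 1) * (z / a))
      rw [norm_mul, hn] at this
      have := (abs_le.1 this).1
      nlinarith
    have hPe : Pfun (z / a) = (z / a).re := by
      unfold Pfun; apply max_eq_left
      by_contra hneg
      have : Pfun (z / a) = 0 := max_eq_right (le_of_lt (not_le.1 hneg))
      linarith
    rw [e1, re_ofReal_mul, e2, hu]
    have : u z / (4 * ‖z‖) - 504 * ε ≤ (z / a).re + ((F - 1) * (z / a)).re := by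
      rw [← hPe]; linarith
    nlinarith

noncomputable def C2 : ℝ := 160 * C1
theorem C1_ge : 1 ≤ C1 := by unfold C1; linarith [bK_ge]

theorem Og.q1 (O : Og d u f N) (hF : Fl d ε u) (hε : 0 < ε) (hb : bK * ε ≤ 1 / 1000)
    {z : ℂ} (h1 : 128 * d ≤ ‖z‖) (h2 : ‖z‖ ≤ 1 / 8) : qf u f z ≤ C2 * ε * u z / ‖z‖ := by
  have hd := O.hd
  have hz : 0 < ‖z‖ := by linarith
  have hin : ∀ w ∈ closedBall z (‖z‖/4), 3/4 * ‖z‖ ≤ ‖w‖ ∧ ‖w‖ ≤ 5/4 * ‖z‖ := by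
    intro w hw
    rw [mem_closedBall, dist_eq_norm] at hw
    have k1 := norm_sub_norm_le w z
    have k2 := norm_sub_norm_le z w
    rw [norm_sub_rev] at k2
    constructor <;> linarith
  have := O.S.q_growth (z₀ := z) (ρ := ‖z‖/4) (K := 10) (ε := C1 * ε) (by positivity) ?_ ?_ ?_
  · refine this.trans (le_of_eq ?_)
    unfold C2; field_simp; ring
  · intro w hw
    obtain ⟨k1, k2⟩ := hin w hw
    exact ⟨by linarith, by linarith⟩
  · intro w hw
    obtain ⟨k1, k2⟩ := hin w hw
    have := (O.pt hF hε hb (z := w) (by linarith) (by linarith)).2.1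
    linarith
  · intro w hw
    obtain ⟨k1, k2⟩ := hin w hw
    exact (O.pt hF hε hb (z := w) (by linarith) (by linarith)).1

theorem JL_eqL {u : ℂ → ℝ} {z : ℂ} {p q L L' : ℝ} (h : JL u z p q L) (e : L = L') : JL u z p q L' := e ▸ h

theorem JL_sqrt {u : ℂ → ℝ} {z : ℂ} {p q : ℝ} (h : JL u z p q 0) (hu : 0 < u z) (hc : ContinuousAt u z) (hz : z ≠ 0) :
    ∃ p' q', JL (fun w => Real.sqrt (u w) / ‖w‖) z p' q'
      (Real.sqrt (u z) / ‖z‖ / normSq z *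
        (-(1/4) * (p ^ 2 + q ^ 2) * normSq z / u z ^ 2 - (z.re * p + z.im * q) / u z + 1)) := by
  have hn : 0 < normSq z := normSq_pos.2 hz
  have hlog : ∀ s : ℝ, 0 < s → (∀ᶠ t in 𝓝 s, HasDerivAt Real.log (t⁻¹) t) ∧
      HasDerivAt (fun t : ℝ => t⁻¹) (-(s ^ 2)⁻¹) s := fun s hs =>
    ⟨by filter_upwards [lt_mem_nhds hs] with t ht using Real.hasDerivAt_log ht.ne', hasDerivAt_inv hs.ne'⟩
  have j1 := h.comp (hlog _ hu).1 (hlog _ hu).2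
  have j0 := JL.normSq 0 z
  simp only [sub_zero] at j0
  have j2 := j0.comp (hlog _ hn).1 (hlog _ hn).2
  have j3 := ((j1.cmul (1/2)).sub (j2.cmul (1/2))).comp (F := Real.exp) (F' := Real.exp)
    (F'' := Real.exp (1 / 2 * Real.log (u z) - 1 / 2 * Real.log (normSq z)))
    (Eventually.of_forall fun s => Real.hasDerivAt_exp s) (Real.hasDerivAt_exp _)
  have ev : ∀ w, 0 < u w → w ≠ 0 → Real.sqrt (u w) / ‖w‖ =
      Real.exp (1 / 2 * Real.log (u w) - 1 / 2 * Real.log (normSq w)) := by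
    intro w hw hw0
    have : 0 < ‖w‖ := norm_pos_iff.2 hw0
    rw [Real.exp_sub, normSq_eq_norm_sq, Real.log_pow, Real.sqrt_eq_rpow, Real.rpow_def_of_pos hw]
    have e : (1 / 2 * (((2:ℕ):ℝ) * Real.log ‖w‖)) = Real.log ‖w‖ := by push_cast; ring
    rw [e, Real.exp_log this]; ring_nf
  have j4 := j3.congr (Ψ := fun w => Real.sqrt (u w) / ‖w‖) (by
    filter_upwards [hc.eventually (lt_mem_nhds hu), isOpen_ne.mem_nhds hz] with w h1 h2
    exact ev w h1 h2)
  refine ⟨_, _, JL_eqL j4 ?_⟩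
  rw [ev z hu hz]
  have e := normSq_apply z
  field_simp
  rw [e]; ring

noncomputable def C3 : ℝ := 16 * C2

theorem Og.decay (O : Og d u f N) (hF : Fl d ε u) (hε : 0 < ε) (hb : bK * ε ≤ 1 / 1000) (hε' : ε ≤ 1 / 1000000)
    {z : ℂ} (h1 : 128 * d ≤ ‖z‖) (h2 : ‖z‖ ≤ 1 / 8) :
    qf u f z ≤ C3 * ε * (u z + Real.sqrt d * (Real.sqrt (u z) / ‖z‖)) := by
  have hd := O.hd
  have hC2 : 0 < C2 := by unfold C2; linarith [C1_ge]
  have hC3 : 0 < C3 := by unfold C3; linarith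
  set A := C3 * ε with hA
  have hA0 : 0 < A := by positivity
  set K : Set ℂ := {z | 128 * d ≤ ‖z‖ ∧ ‖z‖ ≤ 1 / 8} with hK
  have hKc : IsCompact K := by
    refine Metric.isCompact_of_isClosed_isBounded ?_ ((isBounded_closedBall (x := 0) (r := 1/8)).subset ?_)
    · exact (isClosed_le continuous_const continuous_norm).inter (isClosed_le continuous_norm continuous_const)
    · intro w hw; rw [mem_closedBall, dist_zero_right]; exact hw.2
  have hKΩ : K ⊆ ann d 1 := fun w hw => ⟨by linarith [hw.1], by linarith [hw.2]⟩
  have hK0 : ∀ w ∈ K, 0 < ‖w‖ := fun w hw => by linarith [hw.1]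
  have huc := O.S.cont.mono hKΩ
  have key := max_principle (K := K) (B := 0)
    (Φ := fun z => qf u f z - A * (u z + Real.sqrt d * (Real.sqrt (u z) / ‖z‖))) hKc ?_ ?_ z ⟨h1, h2⟩
  · linarith
  · exact (O.S.q_cont.mono hKΩ).sub (continuousOn_const.mul (huc.add (continuousOn_const.mul
      (huc.sqrt.div continuous_norm.continuousOn (fun w hw => (hK0 w hw).ne')))))
  · intro w hw hΦ
    have hr := hK0 w hw
    have hw0 : w ≠ 0 := norm_pos_iff.1 hr
    have hΩ := hKΩ hw
    have hun := O.S.nonneg w hΩ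
    have hnn : 0 ≤ A * (u w + Real.sqrt d * (Real.sqrt (u w) / ‖w‖)) := by positivity
    have hq : 0 < qf u f w := by linarith
    obtain ⟨hu, hf1, -⟩ := qf_pos hq
    obtain ⟨p1, p2, p3⟩ := O.pt hF hε hb (z := w) (by linarith [hw.1]) (by linarith [hw.2])
    have hq1 := O.q1 hF hε hb hw.1 hw.2
    have hne1 : 128 * d ≠ ‖w‖ := by
      intro e
      have : C2 * ε * u w / ‖w‖ ≤ A * (u w + Real.sqrt d * (Real.sqrt (u w) / ‖w‖)) := by
        have t1 : Real.sqrt (u w) ≤ 16 * Real.sqrt d := by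
          rw [Real.sqrt_le_left (by positivity), mul_pow, Real.sq_sqrt hd.le]; linarith
        have t2 : u w = Real.sqrt (u w) * Real.sqrt (u w) := (Real.mul_self_sqrt hun).symm
        have t3 : C2 * ε * u w / ‖w‖ ≤ A * (Real.sqrt d * (Real.sqrt (u w) / ‖w‖)) := by
          have : A * (Real.sqrt d * (Real.sqrt (u w) / ‖w‖)) = C2 * ε * (Real.sqrt (u w) * (16 * Real.sqrt d)) / ‖w‖ := by
            rw [hA]; unfold C3; ring
          rw [this]
          gcongr
          nth_rewrite 1 [t2]
          gcongr
        nlinarith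
      linarith
    have hne2 : ‖w‖ ≠ 1 / 8 := by
      intro e
      have : C2 * ε * u w / ‖w‖ ≤ A * (u w + Real.sqrt d * (Real.sqrt (u w) / ‖w‖)) := by
        have t1 : C2 * ε * u w / ‖w‖ ≤ A * u w := by
          rw [e, hA]; unfold C3
          have : 0 ≤ C2 * ε * u w := by positivity
          linarith
        have t2 : 0 ≤ A * (Real.sqrt d * (Real.sqrt (u w) / ‖w‖)) := by positivity
        linarith
      linarith
    refine ⟨?_, ?_⟩
    · filter_upwards [continuous_norm.continuousAt.eventually (lt_mem_nhds (lt_of_le_of_ne hw.1 hne1)),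
        continuous_norm.continuousAt.eventually (gt_mem_nhds (lt_of_le_of_ne hw.2 hne2))] with v a b
      exact ⟨a.le, b.le⟩
    have hJ := (O.S.harm w hΩ hu).JL
    obtain ⟨p', q', j⟩ := JL_sqrt hJ hu (O.S.cAt hΩ) hw0
    refine ⟨_, _, _, (O.S.q_harm hΩ hq).JL.sub ((hJ.add (j.cmul (Real.sqrt d))).cmul A), fun _ _ => ?_⟩
    have hns : normSq w = ‖w‖ ^ 2 := normSq_eq_norm_sq w
    have hneg : (-(1/4) * ((f w).re ^ 2 + (-(f w).im) ^ 2) * normSq w / u w ^ 2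
        - (w.re * (f w).re + w.im * (-(f w).im)) / u w + 1) < 0 := by
      rw [sq_re_im, hns]
      have e1 : w.re * (f w).re + w.im * (-(f w).im) = (f w * w).re := by rw [mul_re]; ring
      rw [e1]
      set Q := ‖f w‖ * ‖w‖ / u w with hQ
      have e2 : -(1/4) * ‖f w‖ ^ 2 * ‖w‖ ^ 2 / u w ^ 2 = -(1/4) * Q ^ 2 := by rw [hQ]; field_simp
      rw [e2]
      have hQ0 : ‖w‖ / u w < Q := by
        rw [hQ]; apply div_lt_div_of_pos_right _ hu; nlinarith
      by_cases h5 : ‖w‖ / 5 ≤ u w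
      · have h6 := p3 h5
        have h7 : 1 - 45000 * ε ≤ (f w * w).re / u w := by
          rw [le_div_iff₀ hu]
          nlinarith
        have h8 : 1 / 2 ≤ ‖w‖ / u w := by rw [div_le_div_iff₀ two_pos hu]; linarith
        nlinarith
      · push Not at h5
        have h6 : -Q ≤ (f w * w).re / u w := by
          have := (abs_le.1 (abs_re_le_norm (f w * w))).1
          rw [norm_mul] at this
          rw [hQ, ← neg_div]
          exact div_le_div_of_nonneg_right this hu.le
        have h7 : 5 < ‖w‖ / u w := by rw [lt_div_iff₀ hu]; linarith
        nlinarith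
    have hsq : 0 < Real.sqrt (u w) / ‖w‖ / normSq w := by
      rw [hns]; have := Real.sqrt_pos.2 hu; positivity
    have := mul_neg_of_pos_of_neg hsq hneg
    have hsd := Real.sqrt_pos.2 hd
    have := mul_neg_of_pos_of_neg (mul_pos hA0 hsd) this
    linarith

noncomputable def C5 : ℝ := 400 * C3
theorem Og.q2 (O : Og d u f N) (hF : Fl d ε u) (hε : 0 < ε) (hb : bK * ε ≤ 1 / 1000) (hε' : ε ≤ 1 / 1000000)
    {z : ℂ} (h1 : 256 * d ≤ ‖z‖) (h2 : ‖z‖ ≤ 1 / 16) :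
    qf u f z ≤ C5 * ε * (1 + Real.sqrt (d / ‖z‖) / ‖z‖) * u z := by
  have hd := O.hd
  have hC3 : 0 < C3 := by unfold C3 C2; linarith [C1_ge]
  have hz : 0 < ‖z‖ := by linarith
  have hin : ∀ w ∈ closedBall z (‖z‖/4), 3/4 * ‖z‖ ≤ ‖w‖ ∧ ‖w‖ ≤ 5/4 * ‖z‖ := by
    intro w hw
    rw [mem_closedBall, dist_eq_norm] at hw
    have k1 := norm_sub_norm_le w z
    have k2 := norm_sub_norm_le z w
    rw [norm_sub_rev] at k2
    constructor <;> linarith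
  have hsub : closedBall z (‖z‖/4) ⊆ ann d 1 := by
    intro w hw
    obtain ⟨k1, k2⟩ := hin w hw
    exact ⟨by linarith, by linarith⟩
  have hu2 : ∀ w ∈ closedBall z (‖z‖/4), u w ≤ 5/2 * ‖z‖ := by
    intro w hw
    obtain ⟨k1, k2⟩ := hin w hw
    have := (O.pt hF hε hb (z := w) (by linarith) (by linarith)).2.1
    linarith
  have := O.S.q_growth (z₀ := z) (ρ := ‖z‖/4) (K := 10)
    (ε := C3 * ε * (5/2 * ‖z‖ + 5/2 * Real.sqrt (d / ‖z‖))) (by positivity) hsub ?_ ?_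
  · refine this.trans (le_of_eq ?_)
    unfold C5; field_simp; ring
  · intro w hw
    linarith [hu2 w hw]
  · intro w hw
    obtain ⟨k1, k2⟩ := hin w hw
    refine (O.decay hF hε hb hε' (z := w) (by linarith) (by linarith)).trans ?_
    have hw0 : 0 < ‖w‖ := by linarith
    have hu := hu2 w hw
    have t : Real.sqrt d * (Real.sqrt (u w) / ‖w‖) ≤ 5/2 * Real.sqrt (d / ‖z‖) := by
      rw [← mul_div_assoc, div_le_iff₀ hw0, ← Real.sqrt_mul hd.le]
      apply Real.sqrt_le_iff.2
      constructor
      · positivity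
      rw [mul_pow, mul_pow, Real.sq_sqrt (by positivity)]
      have : d * u w ≤ d * (5/2 * ‖z‖) := by gcongr
      refine this.trans ?_
      have e : (3/4 * ‖z‖)^2 ≤ ‖w‖^2 := by gcongr
      calc d * (5/2 * ‖z‖) ≤ (5/2)^2 * (d / ‖z‖) * (3/4 * ‖z‖)^2 := by
            field_simp; nlinarith [mul_pos hd hz]
        _ ≤ _ := by gcongr
    gcongr

noncomputable def C6 : ℝ := 200 * C5
theorem C6_ge : 1 ≤ C6 := by unfold C6 C5 C3 C2; linarith [C1_ge]

noncomputable def MM (d ε R : ℝ) : ℝ := C6 * ε * (R + Real.sqrt (d / R))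

theorem Og.qM (O : Og d u f N) (hF : Fl d ε u) (hε : 0 < ε) (hb : bK * ε ≤ 1 / 1000) (hε' : ε ≤ 1 / 1000000)
    {a : ℂ} (ha1 : ‖a‖ ≤ 1 / 8) (ha : 8192 * d ≤ ‖a‖) {z : ℂ} (h1 : 1 / 32 ≤ ‖z‖) (h2 : ‖z‖ ≤ 1 / 2) :
    qf (fun z => u (a * z) / ‖a‖) (fun z => f (a * z) * a / ‖a‖) z ≤ MM d ε ‖a‖ * (u (a * z) / ‖a‖) := by
  have hd := O.hd
  have hk : 0 < ‖a‖ := by linarith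
  have hC5 : 0 < C5 := by unfold C5 C3 C2; linarith [C1_ge]
  have ha0 : a ≠ 0 := norm_pos_iff.1 hk
  have hz0 : 0 < ‖z‖ := by linarith
  have e : ‖a * z‖ = ‖a‖ * ‖z‖ := norm_mul _ _
  rw [qf_scale ha0]
  have r1 : 256 * d ≤ ‖a * z‖ := by rw [e]; nlinarith
  have r2 : ‖a * z‖ ≤ 1 / 16 := by rw [e]; nlinarith
  refine (O.q2 hF hε hb hε' r1 r2).trans ?_
  have hu : 0 ≤ u (a * z) := O.S.nonneg _ ⟨by linarith, by linarith⟩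
  have t : Real.sqrt (d / ‖a * z‖) ≤ 6 * Real.sqrt (d / ‖a‖) := by
    apply Real.sqrt_le_iff.2 ⟨by positivity, ?_⟩
    rw [mul_pow, Real.sq_sqrt (by positivity), e, div_le_iff₀ (by positivity)]
    field_simp
    linarith
  have t2 : Real.sqrt (d / ‖a * z‖) / ‖a * z‖ ≤ 200 * Real.sqrt (d / ‖a‖) / ‖a‖ := by
    rw [e]; rw [e] at t
    rw [div_le_div_iff₀ (by positivity) hk]
    have hs := Real.sqrt_nonneg (d / ‖a‖)
    have : Real.sqrt (d / (‖a‖ * ‖z‖)) ≤ 200 * Real.sqrt (d / ‖a‖) * ‖z‖ := by nlinarith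
    nlinarith
  have : MM d ε ‖a‖ * (u (a * z) / ‖a‖) = C5 * ε * (200 + 200 * Real.sqrt (d / ‖a‖) / ‖a‖) * u (a * z) := by
    unfold MM C6; field_simp
  rw [this]
  gcongr
  norm_num
end P8

theorem oneD {g : ℝ → ℝ} {κ a b A S : ℝ} (hab : a < b) (hκ : 0 ≤ κ) (hl : LowerSemicontinuousOn g (Icc a b))
    (hS : |S| + κ * (b - a) ≤ 1) (h1 : A ≤ g a) (h2 : A + S * (b - a) ≤ g b)
    (nt : ∀ y0 ∈ Ioo a b, ∀ m, |m| ≤ 1 → (∀ᶠ y in 𝓝 y0, g y0 + m * (y - y0) + κ * (y - y0) ^ 2 ≤ g y) → False) :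
    ∀ y ∈ Icc a b, A + S * (y - a) - κ * (y - a) * (b - y) ≤ g y := by
  have hc : LowerSemicontinuousOn (fun y => -(A + S * (y - a) - κ * (y - a) * (b - y))) (Icc a b) :=
    (Continuous.continuousOn (by fun_prop)).lowerSemicontinuousOn
  obtain ⟨y0, hy0, hmin⟩ := (hl.add hc).exists_isMinOn (nonempty_Icc.2 hab.le) isCompact_Icc
  have hmin' : ∀ y ∈ Icc a b, g y0 - (A + S * (y0 - a) - κ * (y0 - a) * (b - y0)) ≤
      g y - (A + S * (y - a) - κ * (y - a) * (b - y)) := by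
    intro y hy
    have := hmin hy
    simp only [mem_setOf_eq] at this
    linarith
  by_cases hn : 0 ≤ g y0 - (A + S * (y0 - a) - κ * (y0 - a) * (b - y0))
  · intro y hy; linarith [hmin' y hy]
  exfalso
  push Not at hn
  have ha : a < y0 := by
    refine lt_of_le_of_ne hy0.1 ?_
    rintro rfl
    rw [sub_self, mul_zero, mul_zero, zero_mul] at hn; linarith
  have hb : y0 < b := by
    refine lt_of_le_of_ne hy0.2 ?_
    rintro rfl
    rw [sub_self, mul_zero] at hn; linarith
  refine nt y0 ⟨ha, hb⟩ (S - κ * (b - y0) + κ * (y0 - a)) ?_ ?_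
  · have := abs_le.1 (le_refl |S|)
    rw [abs_le]
    constructor <;> nlinarith
  · filter_upwards [Icc_mem_nhds ha hb] with y hy
    have := hmin' y hy
    nlinarith

structure NM (δ ε M : ℝ) (Ω : Set ℂ) (u : ℂ → ℝ) (f N : ℂ → ℂ) : Prop where
  H : NF δ ε Ω u f N
  hM : 0 < M
  hM' : 300 * M ≤ 1 / 10
  qM : ∀ z : ℂ, 1 / 32 ≤ ‖z‖ → ‖z‖ ≤ 1 / 2 → qf u f z ≤ M * u z

noncomputable def gf (Ω : Set ℂ) (u : ℂ → ℝ) (y : ℝ) : ℝ :=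
  sInf {x : ℝ | |x| ≤ 1 / 16 ∧ (⟨x, y⟩ : ℂ) ∈ closure (posSet Ω u)}

theorem box_norm {x y : ℝ} (hx : |x| ≤ 1 / 16) (hy : y ∈ Icc (1/32:ℝ) (15/32)) :
    y ≤ ‖(⟨x, y⟩ : ℂ)‖ ∧ ‖(⟨x, y⟩ : ℂ)‖ < 1 / 2 := by
  have h := sq_re_im (⟨x, y⟩ : ℂ)
  simp only at h
  have hx2 := abs_le.1 hx
  have hn := norm_nonneg (⟨x, y⟩ : ℂ)
  constructor
  · nlinarith [hy.1]
  · have : x ^ 2 ≤ (1/16)^2 := sq_le_sq' hx2.1 hx2.2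
    nlinarith [hy.1, hy.2]

section P9
variable {Ω : Set ℂ} {u : ℂ → ℝ} {f N : ℂ → ℂ} {δ ε M : ℝ}

theorem NF.cl_left (H : NF δ ε Ω u f N) {z : ℂ} (h1 : 1 / 64 < ‖z‖) (h2 : ‖z‖ < 3 / 4)
    (h : z ∈ closure (posSet Ω u)) : -(bK * ε) ≤ z.re := by
  by_contra hlt
  push Not at hlt
  have hop : IsOpen {w : ℂ | w.re < -(bK * ε) ∧ 1 / 64 < ‖w‖ ∧ ‖w‖ < 3 / 4} :=
    (isOpen_lt continuous_re continuous_const).inter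
      ((isOpen_lt continuous_const continuous_norm).inter (isOpen_lt continuous_norm continuous_const))
  obtain ⟨w, ⟨a, b, c⟩, hw⟩ := mem_closure_iff.1 h _ hop ⟨hlt, h1, h2⟩
  have := H.left a b c
  linarith [hw.2]

theorem NF.g_spec (H : NF δ ε Ω u f N) {y : ℝ} (hy : y ∈ Icc (1/32:ℝ) (15/32)) :
    |gf Ω u y| ≤ bK * ε ∧ (⟨gf Ω u y, y⟩ : ℂ) ∈ FB Ω u ∧
    ∀ x, |x| ≤ 1 / 16 → x < gf Ω u y → (⟨x, y⟩ : ℂ) ∉ closure (posSet Ω u) := by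
  obtain ⟨s1, s2, s3, s4⟩ := H.small
  have hb := H.hb
  have hε := H.hε
  have hB : 2 * ε ≤ bK * ε := by nlinarith [bK_ge]
  set T : Set ℝ := {x : ℝ | |x| ≤ 1 / 16 ∧ (⟨x, y⟩ : ℂ) ∈ closure (posSet Ω u)} with hT
  have hcx : Continuous (fun x : ℝ => (⟨x, y⟩ : ℂ)) :=
    Complex.equivRealProdCLM.symm.continuous.comp (continuous_id.prodMk continuous_const)
  have hTc : IsClosed T := (isClosed_le continuous_abs continuous_const).inter (isClosed_closure.preimage hcx)
  have hbd : BddBelow T := ⟨-(1/16), fun x hx => (abs_le.1 hx.1).1⟩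
  have hn : ∀ x, |x| ≤ 1 / 16 → 1 / 32 ≤ ‖(⟨x, y⟩ : ℂ)‖ ∧ ‖(⟨x, y⟩ : ℂ)‖ < 1 / 2 := fun x hx =>
    ⟨hy.1.trans (box_norm hx hy).1, (box_norm hx hy).2⟩
  have hδ := H.hδ'
  have hΩ : ∀ x, |x| ≤ 1 / 16 → (⟨x, y⟩ : ℂ) ∈ Ω := fun x hx =>
    H.dom _ (by linarith [(hn x hx).1]) (by linarith [(hn x hx).2])
  have hposT : ∀ x, |x| ≤ 1 / 16 → ε < x → x ∈ T := fun x hx hex =>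
    ⟨hx, subset_closure ⟨hΩ x hx, H.pos_of (by linarith [(hn x hx).1]) (by linarith [(hn x hx).2]) hex⟩⟩
  have hε2 : 2 * ε ∈ T := hposT _ (by rw [abs_of_pos (by linarith)]; linarith) (by linarith)
  have hmem : gf Ω u y ∈ T := hTc.csInf_mem ⟨_, hε2⟩ hbd
  have hle : gf Ω u y ≤ 2 * ε := csInf_le hbd hε2
  have hge : -(bK * ε) ≤ gf Ω u y :=
    H.cl_left (z := ⟨gf Ω u y, y⟩) (by linarith [(hn _ hmem.1).1]) (by linarith [(hn _ hmem.1).2]) hmem.2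
  have hlow : ∀ x, |x| ≤ 1 / 16 → x < gf Ω u y → (⟨x, y⟩ : ℂ) ∉ closure (posSet Ω u) := fun x hx hlt hcl =>
    absurd (csInf_le hbd (show x ∈ T from ⟨hx, hcl⟩)) (not_le.2 hlt)
  refine ⟨abs_le.2 ⟨hge, by linarith⟩, H.S.memFB.2 ⟨hΩ _ hmem.1, ?_, hmem.2⟩, hlow⟩
  by_contra hne
  have hpos : 0 < u ⟨gf Ω u y, y⟩ := lt_of_le_of_ne (H.S.nonneg _ (hΩ _ hmem.1)) (Ne.symm hne)
  have hca : ContinuousAt (fun x : ℝ => u ⟨x, y⟩) (gf Ω u y) :=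
    ContinuousAt.comp (f := fun x : ℝ => (⟨x, y⟩ : ℂ)) (H.S.cAt (hΩ _ hmem.1)) hcx.continuousAt
  have hev := (hca.eventually (lt_mem_nhds hpos)).filter_mono (nhdsWithin_le_nhds (s := Iio (gf Ω u y)))
  have hev2 : ∀ᶠ x in 𝓝[<] (gf Ω u y), -(1/16) < x :=
    (lt_mem_nhds (by linarith)).filter_mono nhdsWithin_le_nhds
  obtain ⟨x, ⟨h1, h2⟩, h3⟩ := ((hev.and hev2).and self_mem_nhdsWithin).exists
  have h3' : x < gf Ω u y := h3
  have hx : |x| ≤ 1 / 16 := abs_le.2 ⟨h2.le, by linarith⟩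
  exact hlow x hx h3' (subset_closure ⟨hΩ x hx, h1⟩)

theorem NF.g_lsc (H : NF δ ε Ω u f N) : LowerSemicontinuousOn (gf Ω u) (Icc (1/32:ℝ) (15/32)) := by
  intro y0 hy0 c hc
  set E : Set ℂ := {z | |z.re| ≤ 1 / 16 ∧ z.re ≤ c ∧ z.im ∈ Icc (1/32:ℝ) (15/32) ∧ z ∈ closure (posSet Ω u)} with hE
  have hEc : IsClosed E :=
    (isClosed_le (continuous_abs.comp continuous_re) continuous_const).inter
      ((isClosed_le continuous_re continuous_const).inter
        ((isClosed_Icc.preimage continuous_im).inter isClosed_closure))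
  have hEk : IsCompact E := by
    refine Metric.isCompact_of_isClosed_isBounded hEc ((isBounded_closedBall (x := 0) (r := 1)).subset ?_)
    intro z hz
    rw [mem_closedBall, dist_zero_right]
    linarith [(box_norm hz.1 hz.2.2.1).2]
  have hcl := (hEk.image continuous_im).isClosed
  have hspec := fun y hy => H.g_spec (y := y) hy
  have hb := H.hb
  have hnot : y0 ∉ im '' E := by
    rintro ⟨z, hz, e⟩
    have := (hspec y0 hy0).2.2 z.re hz.1 (by linarith [hz.2.1])
    rw [← e] at this
    exact this hz.2.2.2
  filter_upwards [nhdsWithin_le_nhds (hcl.isOpen_compl.mem_nhds hnot), self_mem_nhdsWithin] with y h1 h2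
  by_contra hle
  push Not at hle
  obtain ⟨g1, g2, -⟩ := hspec y h2
  exact h1 ⟨⟨gf Ω u y, y⟩, ⟨by simp only; linarith, hle, h2, (H.S.memFB.1 g2).2.2⟩, rfl⟩

theorem par_ball {X Y m t ϱ : ℝ} (htp : 0 < t) (ht1 : t ≤ 1.42) (ht2 : t ^ 2 = 1 + m ^ 2) (hm2 : m ^ 2 ≤ 1)
    (hϱ0 : 0 < ϱ) (hs0 : 0 ≤ X - m * Y) (w4 : X - m * Y ≤ 0.2 * ϱ) (hY2 : 3 * Y ^ 2 ≤ ϱ * (X - m * Y)) :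
    (X - ϱ * (1 / t)) ^ 2 + (-(Y - ϱ * (-m / t))) ^ 2 ≤ ϱ ^ 2 := by
  obtain ⟨s, hs⟩ : ∃ s, s = X - m * Y := ⟨_, rfl⟩
  rw [← hs] at hs0 w4 hY2
  have e : (X - ϱ * (1 / t)) ^ 2 + (-(Y - ϱ * (-m / t))) ^ 2 = X ^ 2 + Y ^ 2 - 2 * ϱ * s / t + ϱ ^ 2 := by
    have : (X - ϱ * (1 / t)) ^ 2 + (-(Y - ϱ * (-m / t))) ^ 2 =
      X ^ 2 + Y ^ 2 - 2 * ϱ * s / t + ϱ ^ 2 * ((1 + m ^ 2) / t ^ 2) := by rw [hs]; ring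
    rw [this, ht2, div_self (by positivity), mul_one]
  have hXY : X ^ 2 + Y ^ 2 ≤ 1.4 * ϱ * s := by
    have : X = s + m * Y := by rw [hs]; ring
    have h2 : X ^ 2 ≤ 2 * s ^ 2 + 2 * (m ^ 2 * Y ^ 2) := by rw [this]; nlinarith [sq_nonneg (s - m * Y)]
    have h3 : m ^ 2 * Y ^ 2 ≤ 1 * Y ^ 2 := by gcongr
    have h4 : s * s ≤ 0.2 * ϱ * s := by gcongr
    linarith
  have h4 : 1.4 * ϱ * s ≤ 2 * ϱ * s / t := by
    rw [le_div_iff₀ htp]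
    have : 0 ≤ ϱ * s := by positivity
    nlinarith
  linarith

theorem NM.nt (G : NM δ ε M Ω u f N) {y0 m : ℝ} (hy0 : y0 ∈ Ioo (1/32:ℝ) (15/32)) (hm : |m| ≤ 1)
    (h : ∀ᶠ y in 𝓝 y0, gf Ω u y0 + m * (y - y0) + 300 * M * (y - y0) ^ 2 ≤ gf Ω u y) : False := by
  have H := G.H
  have hM := G.hM
  have hb := H.hb
  obtain ⟨g1, g2, g3⟩ := H.g_spec (Ioo_subset_Icc_self hy0)
  have gx : |gf Ω u y0| < 1 / 16 := by linarith
  set p : ℂ := ⟨gf Ω u y0, y0⟩ with hp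
  have hpn := box_norm gx.le (Ioo_subset_Icc_self hy0)
  set t := Real.sqrt (1 + m ^ 2) with ht
  have ht2 : t ^ 2 = 1 + m ^ 2 := Real.sq_sqrt (by positivity)
  have htp : 0 < t := Real.sqrt_pos.2 (by positivity)
  have hm2 : m ^ 2 ≤ 1 := by rw [← sq_abs]; nlinarith [abs_nonneg m]
  have ht1 : t ≤ 1.42 := by nlinarith
  set ϱ := 1 / (100 * M) with hϱ
  have hϱ0 : 0 < ϱ := by positivity
  set ν : ℂ := ⟨1 / t, -m / t⟩ with hν
  have hν1 : ‖ν‖ = 1 := by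
    have := sq_re_im ν
    simp only [hν] at this
    rw [← hν] at this
    have e : (1 / t) ^ 2 + (-(-m / t)) ^ 2 = 1 := by
      have : (1 / t) ^ 2 + (-(-m / t)) ^ 2 = (1 + m ^ 2) / t ^ 2 := by ring
      rw [this, ht2, div_self (by positivity)]
    nlinarith [norm_nonneg ν]
  have hX : Continuous (fun w : ℂ => (w.re - gf Ω u y0) - m * (w.im - y0)) := by fun_prop
  refine H.S.no_touch (z₁ := p) (c := p + ϱ * ν) (ϱ := ϱ) (M := M) g2 hϱ0 ?_ hM.le ?_ ?_ ?_
  · rw [sub_add_cancel_left, norm_neg, norm_mul, hν1, norm_real, Real.norm_of_nonneg hϱ0.le, mul_one]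
  · rw [hϱ]; field_simp; norm_num
  · have e1 : ∀ᶠ w in 𝓝 p, gf Ω u y0 + m * (w.im - y0) + 300 * M * (w.im - y0) ^ 2 ≤ gf Ω u w.im :=
      (continuous_im.tendsto p).eventually h
    have e2 : ∀ᶠ w : ℂ in 𝓝 p, w.im ∈ Icc (1/32:ℝ) (15/32) :=
      (continuous_im.tendsto p).eventually (Icc_mem_nhds hy0.1 hy0.2)
    have e3 : ∀ᶠ w : ℂ in 𝓝 p, |w.re| < 1/16 :=
      ((continuous_abs.comp continuous_re).tendsto p).eventually (gt_mem_nhds gx)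
    have e4 : ∀ᶠ w : ℂ in 𝓝 p, (w.re - gf Ω u y0) - m * (w.im - y0) < 0.2 * ϱ :=
      (hX.tendsto p).eventually (gt_mem_nhds (by simp [hp]; positivity))
    filter_upwards [e1, e2, e3, e4, H.S.op.mem_nhds g2.1] with w w1 w2 w3 w4 w5 hu
    have w6 : gf Ω u w.im ≤ w.re := by
      by_contra hlt
      exact (H.g_spec w2).2.2 w.re w3.le (not_le.1 hlt) (subset_closure ⟨w5, hu⟩)
    set Y := w.im - y0 with hY
    set X := w.re - gf Ω u y0 with hXd
    set s := X - m * Y with hs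
    have hs1 : 300 * M * Y ^ 2 ≤ s := by linarith
    have hs0 : 0 ≤ s := le_trans (by positivity) hs1
    have hY2 : 3 * Y ^ 2 ≤ ϱ * s := by
      rw [hϱ, div_mul_eq_mul_div, le_div_iff₀ (by positivity)]; linarith
    have hn := sq_re_im (w - (p + ϱ * ν))
    have r1 : (w - (p + ϱ * ν)).re = X - ϱ * (1 / t) := by simp [hν, hp, hXd]; ring
    have r2 : (w - (p + ϱ * ν)).im = Y - ϱ * (-m / t) := by simp [hν, hp, hY]; ring
    rw [r1, r2] at hn
    have e := par_ball htp ht1 ht2 hm2 hϱ0 hs0 w4.le hY2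
    have : ‖w - (p + ϱ * ν)‖ ^ 2 ≤ ϱ ^ 2 := by rw [← hn]; exact e
    exact abs_le_of_sq_le_sq' this hϱ0.le |>.2
  · have e1 : ∀ᶠ w : ℂ in 𝓝 p, 1/32 < ‖w‖ :=
      (continuous_norm.tendsto p).eventually (lt_mem_nhds (lt_of_lt_of_le hy0.1 hpn.1))
    have e2 : ∀ᶠ w : ℂ in 𝓝 p, ‖w‖ < 1/2 :=
      (continuous_norm.tendsto p).eventually (gt_mem_nhds hpn.2)
    filter_upwards [e1, e2] with w a b
    exact G.qM w a.le b.le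

noncomputable def lL (ε M : ℝ) : ℝ := 64 * (bK * ε) + 300 * M

theorem NM.lLb (G : NM δ ε M Ω u f N) : 0 < lL ε M ∧ lL ε M ≤ 1 / 5 := by
  have := G.hM; have := G.hM'; have := G.H.hb
  have : 0 < bK * ε := mul_pos (by linarith [bK_ge]) G.H.hε
  unfold lL
  constructor <;> linarith

theorem NM.lip (G : NM δ ε M Ω u f N) {a b : ℝ} (ha : 1/16 ≤ a) (hab : a ≤ b) (hb : b ≤ 7/16) :
    |gf Ω u b - gf Ω u a| ≤ lL ε M * (b - a) := by
  have H := G.H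
  obtain ⟨hL0, hL1⟩ := G.lLb
  have hM := G.hM
  have hB : 0 < bK * ε := mul_pos (by linarith [bK_ge]) G.H.hε
  have gb : ∀ y ∈ Icc (1/32:ℝ) (15/32), |gf Ω u y| ≤ bK * ε := fun y hy => (H.g_spec hy).1
  have ga := abs_le.1 (gb a ⟨by linarith, by linarith⟩)
  have gb' := abs_le.1 (gb b ⟨by linarith, by linarith⟩)
  have ge := abs_le.1 (gb (15/32) ⟨by norm_num, by norm_num⟩)
  have gs := abs_le.1 (gb (1/32) ⟨by norm_num, by norm_num⟩)
  have hLd : lL ε M = 64 * (bK * ε) + 300 * M := rfl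
  have key : ∀ S ℓ : ℝ, 1/32 ≤ ℓ → ℓ ≤ 1/2 → |S * ℓ| ≤ 2 * (bK * ε) → |S| + 300 * M * ℓ ≤ lL ε M := by
    intro S ℓ h1 h2 h3
    rw [abs_mul, abs_of_pos (by linarith : 0 < ℓ)] at h3
    nlinarith [abs_nonneg S]
  rw [abs_le]
  constructor
  ·
    set S := (-(bK * ε) - gf Ω u a) / (15/32 - a) with hS
    have hl : 0 < 15/32 - a := by linarith
    have hSl : S * (15/32 - a) = -(bK * ε) - gf Ω u a := by rw [hS]; exact div_mul_cancel₀ _ hl.ne'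
    have hk := key S (15/32 - a) (by linarith) (by linarith) (by rw [hSl, abs_le]; constructor <;> linarith)
    have := oneD (g := gf Ω u) (a := a) (b := 15/32) (κ := 300 * M) (A := gf Ω u a) (S := S) (by linarith) (by linarith)
      (H.g_lsc.mono (Icc_subset_Icc (by linarith) le_rfl)) (by linarith) le_rfl (by rw [hSl]; linarith)
      (fun y0 hy m hm h => G.nt ⟨by linarith [hy.1], hy.2⟩ hm h) b ⟨hab, by linarith⟩
    have h5 : 300 * M * (b - a) * (15/32 - b) ≤ 300 * M * (b - a) * (15/32 - a) := by
      have : 0 ≤ 300 * M * (b - a) := mul_nonneg (by linarith) (by linarith)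
      nlinarith
    have h6 := neg_abs_le S
    nlinarith
  · set S := (gf Ω u b + (bK * ε)) / (b - 1/32) with hS
    have hl : 0 < b - 1/32 := by linarith
    have hSl : S * (b - 1/32) = gf Ω u b + (bK * ε) := by rw [hS]; exact div_mul_cancel₀ _ hl.ne'
    have hk := key S (b - 1/32) (by linarith) (by linarith) (by rw [hSl, abs_le]; constructor <;> linarith)
    have := oneD (g := gf Ω u) (a := 1/32) (b := b) (κ := 300 * M) (A := -(bK * ε)) (S := S) (by linarith) (by linarith)
      (H.g_lsc.mono (Icc_subset_Icc le_rfl (by linarith))) (by linarith) (by linarith) (by rw [hSl]; linarith)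
      (fun y0 hy m hm h => G.nt ⟨hy.1, by linarith [hy.2]⟩ hm h) a ⟨by linarith, hab⟩
    have e : -(bK * ε) + S * (a - 1/32) = gf Ω u b - S * (b - a) := by linarith
    rw [e] at this
    have h5 : 300 * M * (a - 1/32) * (b - a) ≤ 300 * M * (b - 1/32) * (b - a) := by
      have : 0 ≤ 300 * M * (b - a) := mul_nonneg (by linarith) (by linarith)
      nlinarith
    have h6 := le_abs_self S
    nlinarith

theorem NM.chord (G : NM δ ε M Ω u f N) {a b : ℝ} (ha : 1/16 ≤ a) (hab : a < b) (hb : b ≤ 7/16) :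
    ∀ y ∈ Icc a b, gf Ω u a + (gf Ω u b - gf Ω u a) / (b - a) * (y - a) - 300 * M * (y - a) * (b - y) ≤ gf Ω u y := by
  have hl : 0 < b - a := by linarith
  have h1 := G.lip ha hab.le hb
  obtain ⟨hL0, hL1⟩ := G.lLb
  have hM := G.hM
  have hM' := G.hM'
  refine oneD hab (by linarith) (G.H.g_lsc.mono (Icc_subset_Icc (by linarith) (by linarith))) ?_ le_rfl ?_
    (fun y0 hy m hm h => G.nt ⟨by linarith [hy.1], by linarith [hy.2]⟩ hm h)
  · rw [abs_div, abs_of_pos hl]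
    have : |gf Ω u b - gf Ω u a| / (b - a) ≤ lL ε M := by rw [div_le_iff₀ hl]; exact h1
    nlinarith
  · rw [div_mul_cancel₀ _ hl.ne']; linarith
end P9

section P10
variable {Ω : Set ℂ} {u : ℂ → ℝ} {f N : ℂ → ℂ} {δ ε M : ℝ}

theorem NM.lip' (G : NM δ ε M Ω u f N) {a b : ℝ} (ha : a ∈ Icc (1/16:ℝ) (7/16)) (hb : b ∈ Icc (1/16:ℝ) (7/16)) :
    |gf Ω u b - gf Ω u a| ≤ lL ε M * |b - a| := by
  rcases le_total a b with h | h
  · rw [abs_of_nonneg (sub_nonneg.2 h)]; exact G.lip ha.1 h hb.2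
  · rw [abs_sub_comm, abs_sub_comm b a, abs_of_nonneg (sub_nonneg.2 h)]; exact G.lip hb.1 h ha.2

theorem NM.gcont (G : NM δ ε M Ω u f N) {y : ℝ} (hy : y ∈ Ioo (1/16:ℝ) (7/16)) : ContinuousAt (gf Ω u) y := by
  have h1 := G.lLb
  refine Metric.continuousAt_iff.2 fun e he => ?_
  obtain ⟨r, hr, hb⟩ := Metric.mem_nhds_iff.1 (Icc_mem_nhds hy.1 hy.2)
  refine ⟨min r e, lt_min hr he, fun {x} hx => ?_⟩
  have hx1 := hb (mem_ball.2 (hx.trans_le (min_le_left _ _)))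
  have := G.lip' ⟨hy.1.le, hy.2.le⟩ hx1
  rw [Real.dist_eq] at hx ⊢
  have h3 := hx.trans_le (min_le_right _ _)
  nlinarith [abs_nonneg (x - y)]

theorem norm_le_abs (a b : ℝ) : ‖(⟨a, b⟩ : ℂ)‖ ≤ |a| + |b| := Complex.norm_le_abs_re_add_abs_im ⟨a, b⟩

theorem NM.graph (G : NM δ ε M Ω u f N) {y : ℝ} (hy : y ∈ Ioo (1/16:ℝ) (7/16)) :
    ∃ m, HasDerivAt (gf Ω u) m y ∧ |m| ≤ lL ε M ∧ ‖N ⟨gf Ω u y, y⟩‖ = 1 ∧ 0 < (N ⟨gf Ω u y, y⟩).re ∧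
      (N ⟨gf Ω u y, y⟩).im = - m * (N ⟨gf Ω u y, y⟩).re ∧
      ∀ᶠ w in 𝓝 (⟨gf Ω u y, y⟩ : ℂ), (0 < u w ↔ gf Ω u w.im < w.re) ∧ (w ∈ FB Ω u ↔ w.re = gf Ω u w.im) := by
  obtain ⟨l1, l2⟩ := G.lLb
  have hb := G.H.hb
  have hy' : y ∈ Icc (1/32:ℝ) (15/32) := ⟨by linarith [hy.1], by linarith [hy.2]⟩
  obtain ⟨g1, g2, g3⟩ := G.H.g_spec hy'
  set p : ℂ := ⟨gf Ω u y, y⟩ with hp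
  obtain ⟨hn, φ, l, L, hl, hφ, hφ0, hL, hev⟩ := G.H.S.nrm p g2
  set n := N p with hnn
  have hL' : ∀ w, L w = l * (n.re * w.re + n.im * w.im) := fun w => by
    rw [hL]; simp [mul_re]
  have hgc := G.gcont hy
  have hcG : ContinuousAt (fun y' : ℝ => (⟨gf Ω u y', y'⟩ : ℂ)) y :=
    Complex.equivRealProdCLM.symm.continuous.continuousAt.comp (hgc.prodMk continuousAt_id)
  have hcG' : Tendsto (fun y' : ℝ => (⟨gf Ω u y', y'⟩ : ℂ)) (𝓝 y) (𝓝 p) := hcG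
  have hlo := hφ.isLittleO
  have hevI : ∀ᶠ y' in 𝓝 y, y' ∈ Icc (1/16:ℝ) (7/16) := Icc_mem_nhds hy.1 hy.2
  have hφg : ∀ᶠ y' in 𝓝 y, φ ⟨gf Ω u y', y'⟩ = 0 := by
    filter_upwards [hevI, hcG'.eventually hev] with y' h1 h2
    exact h2.2.2.1 (G.H.g_spec ⟨by linarith [h1.1], by linarith [h1.2]⟩).2.1
  have key : ∀ c > 0, ∀ᶠ y' in 𝓝 y, |n.re * (gf Ω u y' - gf Ω u y) + n.im * (y' - y)| ≤ c * |y' - y| := by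
    intro c hc
    have ht : Tendsto (fun y' : ℝ => ((⟨gf Ω u y', y'⟩ : ℂ), p)) (𝓝 y) (𝓝 (p, p)) :=
      (hcG'.prodMk_nhds tendsto_const_nhds)
    filter_upwards [ht.eventually (hlo.def (c := c * l / 2) (by positivity)), hφg, hevI] with y' h1 h2 h3
    simp only [h2, hφ0, hL', sub_self, zero_sub, norm_neg, sub_re, sub_im, Real.norm_eq_abs, abs_neg] at h1
    simp only [hp] at h1
    have h4 := norm_le_abs (gf Ω u y' - gf Ω u y) (y' - y)
    have h5 := G.lip' ⟨hy.1.le, hy.2.le⟩ h3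
    have h6 : ‖(⟨gf Ω u y', y'⟩ : ℂ) - ⟨gf Ω u y, y⟩‖ ≤ 2 * |y' - y| := by
      have : (⟨gf Ω u y', y'⟩ : ℂ) - ⟨gf Ω u y, y⟩ = ⟨gf Ω u y' - gf Ω u y, y' - y⟩ := by
        apply Complex.ext <;> simp
      rw [this]; nlinarith [abs_nonneg (y' - y)]
    rw [abs_mul, abs_of_pos hl] at h1
    have h7 : c * l / 2 * ‖(⟨gf Ω u y', y'⟩ : ℂ) - ⟨gf Ω u y, y⟩‖ ≤ c * l / 2 * (2 * |y' - y|) :=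
      mul_le_mul_of_nonneg_left h6 (by positivity)
    refine le_of_mul_le_mul_left ?_ hl
    nlinarith
  have hsq := sq_re_im n
  rw [hn] at hsq
  have hre : n.re ≠ 0 := by
    intro h0
    have him : |n.im| = 1 := by
      rw [h0] at hsq
      have : n.im ^ 2 = 1 := by nlinarith
      rw [← Real.sqrt_sq_eq_abs, this, Real.sqrt_one]
    have hk := (key (1/2) (by norm_num)).filter_mono (nhdsWithin_le_nhds (s := {y}ᶜ))
    obtain ⟨y', h1, h2⟩ := (hk.and self_mem_nhdsWithin).exists
    rw [h0, zero_mul, zero_add, abs_mul, him] at h1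
    have : 0 < |y' - y| := abs_pos.2 (sub_ne_zero.2 h2)
    linarith
  have hder : HasDerivAt (gf Ω u) (-n.im / n.re) y := by
    rw [hasDerivAt_iff_isLittleO, Asymptotics.isLittleO_iff]
    intro c hc
    filter_upwards [key (c * |n.re|) (by positivity)] with y' h1
    rw [Real.norm_eq_abs, Real.norm_eq_abs]
    have h2 : n.re * (gf Ω u y' - gf Ω u y - (y' - y) • (-n.im / n.re)) =
        n.re * (gf Ω u y' - gf Ω u y) + n.im * (y' - y) := by
      rw [smul_eq_mul]; field_simp; ring
    rw [← h2, abs_mul] at h1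
    have := abs_pos.2 hre
    refine le_of_mul_le_mul_left (by linarith) this
  have hm : |-n.im / n.re| ≤ lL ε M := by
    have := hder.le_of_lip' l1.le (by
      filter_upwards [hevI] with y' h1
      exact G.lip' ⟨hy.1.le, hy.2.le⟩ h1)
    rwa [Real.norm_eq_abs] at this
  have hpos : 0 < n.re := by
    by_contra hneg
    have hneg' : n.re < 0 := lt_of_le_of_ne (not_lt.1 hneg) hre
    have hct : Tendsto (fun t : ℝ => p - (t : ℂ)) (𝓝 0) (𝓝 p) := by
      have : Continuous (fun t : ℝ => p - (t : ℂ)) := by fun_prop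
      simpa using this.tendsto 0
    have ht : Tendsto (fun t : ℝ => (p - (t : ℂ), p)) (𝓝 0) (𝓝 (p, p)) := hct.prodMk_nhds tendsto_const_nhds
    have e1 := (ht.eventually (hlo.def (c := l * (-n.re) / 2) (by
      have : 0 < -n.re := by linarith
      positivity))).filter_mono (nhdsWithin_le_nhds (s := Ioi 0))
    have e2 := (hct.eventually hev).filter_mono (nhdsWithin_le_nhds (s := Ioi 0))
    have e3 : ∀ᶠ t in 𝓝[>] (0:ℝ), t < 1/32 := (gt_mem_nhds (by norm_num)).filter_mono nhdsWithin_le_nhds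
    obtain ⟨t, ⟨⟨h1, h2⟩, h3⟩, h4⟩ := (((e1.and e2).and e3).and self_mem_nhdsWithin).exists
    have h4' : 0 < t := h4
    have hw : p - (t : ℂ) = ⟨gf Ω u y - t, y⟩ := by apply Complex.ext <;> simp [hp]
    have hg := abs_le.1 g1
    have hncl := g3 (gf Ω u y - t) (abs_le.2 ⟨by linarith, by linarith⟩) (by linarith)
    have hnp : ¬ 0 < u (p - t) := fun h => hncl (hw ▸ subset_closure ⟨h2.1, h⟩)
    have hφn : ¬ 0 < φ (p - t) := fun h => hnp (h2.2.1.2 h)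
    simp only [hφ0, hL', sub_zero, sub_sub_cancel_left, neg_re, neg_im, ofReal_re, ofReal_im, norm_neg,
      norm_real, Real.norm_eq_abs, neg_zero, mul_zero, add_zero, abs_of_pos h4'] at h1
    have h5 := (abs_le.1 h1).1
    have : 0 < l * (-n.re) * t := mul_pos (mul_pos hl (by linarith)) h4'
    apply hφn; nlinarith
  refine ⟨-n.im / n.re, hder, hm, hn, hpos, by field_simp, ?_⟩
  have hctw : Tendsto (fun w : ℂ => (⟨gf Ω u w.im, w.im⟩ : ℂ)) (𝓝 p) (𝓝 p) :=
    hcG'.comp (continuous_im.tendsto p)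
  have ht : Tendsto (fun w : ℂ => (w, (⟨gf Ω u w.im, w.im⟩ : ℂ))) (𝓝 p) (𝓝 (p, p)) := tendsto_id.prodMk_nhds hctw
  filter_upwards [ht.eventually (hlo.def (c := l * n.re / 2) (by positivity)),
    (continuous_im.tendsto p).eventually hφg, hev] with w h1 h2 h3
  have hd : w - ⟨gf Ω u w.im, w.im⟩ = ((w.re - gf Ω u w.im : ℝ) : ℂ) := by apply Complex.ext <;> simp
  simp only [h2, hd, hL', ofReal_re, ofReal_im, sub_zero, mul_zero, add_zero, norm_real, Real.norm_eq_abs] at h1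
  have hk : 0 < l * n.re := mul_pos hl hpos
  obtain ⟨h4, h5⟩ := abs_le.1 h1
  rw [h3.2.1, h3.2.2]
  rcases lt_trichotomy (w.re - gf Ω u w.im) 0 with hs | hs | hs
  · rw [abs_of_neg hs] at h4 h5
    have : φ w < 0 := by nlinarith [mul_pos hk (neg_pos.2 hs)]
    exact ⟨⟨fun h => by linarith, fun h => by linarith⟩, ⟨fun h => by linarith, fun h => by linarith⟩⟩
  · rw [hs] at h4 h5
    simp only [abs_zero, mul_zero, sub_zero, neg_zero] at h4 h5
    exact ⟨⟨fun h => by linarith, fun h => by linarith⟩, ⟨fun h => by linarith, fun h => by linarith⟩⟩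
  · rw [abs_of_pos hs] at h4 h5
    have : 0 < φ w := by nlinarith [mul_pos hk hs]
    exact ⟨⟨fun h => by linarith, fun h => by linarith⟩, ⟨fun h => by linarith, fun h => by linarith⟩⟩

theorem NM.mono (G : NM δ ε M Ω u f N) {a b ma mb : ℝ} (ha : 1/16 ≤ a) (hab : a < b) (hb : b ≤ 7/16)
    (h1 : HasDerivAt (gf Ω u) ma a) (h2 : HasDerivAt (gf Ω u) mb b) : mb - ma ≤ 600 * M * (b - a) := by
  have hM := G.hM
  set S := (gf Ω u b - gf Ω u a) / (b - a) with hS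
  have hSb : S * (b - a) = gf Ω u b - gf Ω u a := div_mul_cancel₀ _ (sub_pos.2 hab).ne'
  have e : ∀ᶠ t in 𝓝[>] (0:ℝ), t ∈ Icc 0 (b - a) := Icc_mem_nhdsGT (sub_pos.2 hab)
  have k1 : -ma ≤ -S + 300 * M * (b - a) := by
    refine deriv_le_of_right (g := fun t => -gf Ω u (a + t)) ?_ ?_
    · have : HasDerivAt (fun t : ℝ => gf Ω u (a + t)) ma 0 := by
        apply HasDerivAt.comp_const_add; simpa using h1
      exact this.neg
    · filter_upwards [e] with t ht
      have := G.chord ha hab hb (y := a + t) ⟨by linarith [ht.1], by linarith [ht.2]⟩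
      rw [← hS] at this
      simp only [add_zero]
      have h3 : 0 ≤ M * t * t := by have := ht.1; positivity
      nlinarith
  have k2 : mb ≤ S + 300 * M * (b - a) := by
    refine deriv_le_of_right (g := fun t => -gf Ω u (b - t)) ?_ ?_
    · have : HasDerivAt (fun t : ℝ => gf Ω u (b - t)) (-mb) 0 := by
        apply HasDerivAt.comp_const_sub; simpa using h2
      exact this.neg.congr_deriv (neg_neg _)
    · filter_upwards [e] with t ht
      have := G.chord ha hab hb (y := b - t) ⟨by linarith [ht.2], by linarith [ht.1]⟩
      rw [← hS] at this
      simp only [sub_zero]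
      have h3 : 0 ≤ M * t * t := by have := ht.1; positivity
      nlinarith
  linarith

end P10

abbrev NMa (d : ℝ) (u : ℂ → ℝ) (f N : ℂ → ℂ) (ε M : ℝ) (a : ℂ) : Prop :=
  NM (d / ‖a‖) ε M ((fun z => a * z) ⁻¹' ann d 1) (fun z => u (a * z) / ‖a‖)
      (fun z => f (a * z) * a / ‖a‖) (fun z => N (a * z) * (starRingEnd ℂ) a / ‖a‖)

noncomputable abbrev ga (d : ℝ) (u : ℂ → ℝ) (a : ℂ) : ℝ → ℝ :=
  gf ((fun z => a * z) ⁻¹' ann d 1) (fun z => u (a * z) / ‖a‖)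

section P11
variable {u : ℂ → ℝ} {f N : ℂ → ℂ} {d ε : ℝ}

theorem MM_le {R : ℝ} (hd : 0 < d) (hε : 0 < ε) (h1 : R ≤ 1 / 8) (h2 : 8192 * d ≤ R) :
    0 < MM d ε R ∧ MM d ε R ≤ C6 * ε ∧ Real.sqrt (d / R) ≤ 1 / 90 := by
  have hR : 0 < R := by linarith
  have hs : Real.sqrt (d / R) ≤ 1 / 90 := by
    rw [Real.sqrt_le_left (by norm_num), div_le_iff₀ hR]; linarith
  have hC := C6_ge
  unfold MM
  refine ⟨by positivity, ?_, hs⟩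
  have : 0 < C6 * ε := by positivity
  nlinarith

theorem Og.nm (O : Og d u f N) (hF : Fl d ε u) (hε : 0 < ε) (hb : bK * ε ≤ 1 / 1000) (hε' : ε ≤ 1 / 1000000)
    (hC : 3000 * (C6 * ε) ≤ 1) {ε1 : ℝ} (hε1 : 0 < ε1) (hb1 : bK * ε1 ≤ 1 / 1000)
    {a : ℂ} (ha1 : ‖a‖ ≤ 1 / 8) (ha : 8192 * d ≤ ‖a‖) (hf : Flat d ε1 u a) :
    NMa d u f N ε1 (MM d ε ‖a‖) a := by
  obtain ⟨m1, m2, -⟩ := MM_le O.hd hε ha1 ha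
  exact ⟨O.nf (by linarith) (by linarith [O.hd]) hf hε1 hb1, m1, by linarith,
    fun z h1 h2 => O.qM hF hε hb hε' ha1 ha h1 h2⟩

theorem Pfun_smul {t : ℝ} (ht : 0 ≤ t) (z : ℂ) : Pfun (t * z) = t * Pfun z := by
  simp only [Pfun, re_ofReal_mul]
  rw [mul_max_of_nonneg _ _ ht, mul_zero]

theorem rot_close {a β : ℂ} (hd : 0 < d) (ha : 64 * d ≤ ‖a‖) (h1 : Flat d ε u a) (h2 : Flat d ε u (a * β / 2))
    (hβ : ‖β‖ = 1) (hε' : ε ≤ 1 / 1000) : |β.im| ≤ 6 * ε ∧ 1 / 2 < β.re := by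
  have hk : 0 < ‖a‖ := by linarith
  have hnb : ‖a * β / 2‖ = ‖a‖ / 2 := by simp [hβ]
  have key : ∀ z : ℂ, ‖z‖ = 1 / 2 → |Pfun (β * z) - Pfun z| ≤ 3 * ε := by
    intro z hz
    have e1 := h1 (((1/2 : ℝ) : ℂ) * (β * z)) (by rw [norm_mul, norm_mul, hβ, hz]; norm_num; linarith)
      (by rw [norm_mul, norm_mul, hβ, hz]; norm_num)
    have e2 := h2 z (by rw [hnb, hz]; linarith) (by rw [hz]; norm_num)
    rw [Pfun_smul (by norm_num)] at e1
    have e3 : a * (((1/2 : ℝ) : ℂ) * (β * z)) = a * β / 2 * z := by push_cast; ring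
    rw [e3] at e1
    rw [hnb] at e2
    have e4 : u (a * β / 2 * z) / (‖a‖ / 2) = 2 * (u (a * β / 2 * z) / ‖a‖) := by field_simp
    rw [e4] at e2
    rw [abs_le] at e1 e2 ⊢
    constructor <;> linarith [e1.1, e1.2, e2.1, e2.2]
  have k1 := key (I * (1/2)) (by simp)
  have k2 := key (-(I * (1/2))) (by simp)
  have k3 := key (1/2) (by simp)
  simp [Pfun] at k1 k2 k3
  rw [abs_of_nonneg (le_max_right _ _)] at k1 k2
  refine ⟨?_, ?_⟩
  · have := le_max_left (-(β.im * 2⁻¹)) 0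
    have := le_max_left (β.im * 2⁻¹) 0
    rw [abs_le]; constructor <;> linarith
  · have := (abs_le.1 k3).1
    by_contra hlt
    have : max (β.re * 2⁻¹) 0 ≤ 1/4 := max_le (by linarith) (by norm_num)
    linarith

theorem ov_ineq {c t s p : ℝ} (h1 : 9/10 ≤ c) (h2 : c ≤ 1) (h3 : -(1/10) ≤ t) (h4 : t ≤ 1/10) (h5 : 0 < s) (h6 : s ≤ 1/500)
    (h7 : -(1/1000) ≤ p) (h8 : p ≤ 1/1000) :
    7/20 + 2 * t * s ∈ Icc (1/16:ℝ) (7/16) ∧ |p - 2 * c * s| ≤ 1/16 ∧ |2 * t * s| ≤ s / 5 ∧ 9/10 * s ≤ c * s := by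
  have a1 : t * s ≤ 1/10 * s := mul_le_mul_of_nonneg_right h4 h5.le
  have a2 : -(1/10) * s ≤ t * s := mul_le_mul_of_nonneg_right h3 h5.le
  have a3 : 9/10 * s ≤ c * s := mul_le_mul_of_nonneg_right h1 h5.le
  have a4 : c * s ≤ 1 * s := mul_le_mul_of_nonneg_right h2 h5.le
  refine ⟨⟨by linarith, by linarith⟩, abs_le.2 ⟨by linarith, by linarith⟩, abs_le.2 ⟨by linarith, by linarith⟩, a3⟩

theorem overlap {a β : ℂ} {Ma Mb : ℝ} (ha : a ≠ 0) (hβ : ‖β‖ = 1) (h1 : |β.im| ≤ 1 / 10) (h2 : 1 / 2 < β.re)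
    (Ga : NMa d u f N ε Ma a) (Gb : NMa d u f N ε Mb (a * β / 2)) :
    ∃ y ∈ Icc (1/10:ℝ) (1/4), (⟨ga d u a y, y⟩ : ℂ) = β / 2 * ⟨ga d u (a * β / 2) (7/20), 7/20⟩ := by
  have hβ0 : β ≠ 0 := fun h => by simp [h] at hβ
  have hb0 : a * β / 2 ≠ 0 := div_ne_zero (mul_ne_zero ha hβ0) two_ne_zero
  have hB := Ga.H.hb
  obtain ⟨b1, b2, b3⟩ := Gb.H.g_spec (y := 7/20) ⟨by norm_num, by norm_num⟩
  obtain ⟨l1, l2⟩ := Gb.lLb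
  rw [FB_scale _ _ hb0, mem_preimage] at b2
  set p' : ℂ := ⟨ga d u (a * β / 2) (7/20), 7/20⟩ with hp'
  have hsq := sq_re_im β
  rw [hβ] at hsq
  have h1' := abs_le.1 h1
  have hbr : β.re ≤ 1 := by nlinarith [sq_nonneg β.im]
  have hbr2 : 9/10 ≤ β.re := by nlinarith
  set z : ℂ := β / 2 * p' with hz
  have b1' := abs_le.1 b1
  have hzre : z.re = (β.re * p'.re - β.im * (7/20)) / 2 := by
    rw [hz, hp', mul_re]; simp; ring
  have hzim : z.im = (β.re * (7/20) + β.im * p'.re) / 2 := by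
    rw [hz, hp', mul_im]; simp; ring
  have hpre : |p'.re| ≤ 1/1000 := b1.trans hB
  have hpre' := abs_le.1 hpre
  have hy : z.im ∈ Icc (1/10:ℝ) (1/4) := by
    rw [hzim]; constructor <;> nlinarith
  have hy2 : z.im ∈ Icc (1/32:ℝ) (15/32) := ⟨by linarith [hy.1], by linarith [hy.2]⟩
  have hzFB : z ∈ FB ((fun z => a * z) ⁻¹' ann d 1) (fun z => u (a * z) / ‖a‖) := by
    rw [FB_scale _ _ ha, mem_preimage]
    have : a * z = a * β / 2 * p' := by rw [hz]; ring
    rw [this]; exact b2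
  have hzn1 : z.im ≤ ‖z‖ := (le_abs_self _).trans (Complex.abs_im_le_norm z)
  have hzn2 : ‖z‖ ≤ 3/4 := by
    rw [hz, norm_mul, norm_div, hβ]
    have := norm_le_abs p'.re (7/20)
    rw [abs_of_pos (by norm_num : (0:ℝ) < 7/20)] at this
    have e : (⟨p'.re, 7/20⟩ : ℂ) = p' := rfl
    rw [e] at this
    simp only [Complex.norm_ofNat]
    linarith
  have hstrip := Ga.H.strip hzFB (by linarith [hy.1]) hzn2
  have hstrip' := abs_le.1 (hstrip.trans hB)
  obtain ⟨a1, a2, a3⟩ := Ga.H.g_spec hy2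
  have a1' := abs_le.1 (a1.trans hB)
  refine ⟨z.im, hy, ?_⟩
  have hge : ga d u a z.im ≤ z.re := by
    by_contra hlt
    refine a3 z.re (abs_le.2 ⟨by linarith, by linarith⟩) (not_le.1 hlt) ?_
    exact (Ga.H.S.memFB.1 hzFB).2.2
  have heq : ga d u a z.im = z.re := by
    by_contra hne
    have hlt : ga d u a z.im < z.re := lt_of_le_of_ne hge hne
    set s := z.re - ga d u a z.im with hs
    have hs0 : 0 < s := by rw [hs]; linarith
    have hs1 : s ≤ 1/500 := by rw [hs]; linarith
    set w' : ℂ := p' - 2 * (starRingEnd ℂ) β * s with hw'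
    have hbb : β * (starRingEnd ℂ) β = 1 := by rw [mul_conj, normSq_eq_norm_sq, hβ]; simp
    have hw : a * β / 2 * w' = a * ⟨ga d u a z.im, z.im⟩ := by
      have : (⟨ga d u a z.im, z.im⟩ : ℂ) = z - s := by apply Complex.ext <;> simp [hs]
      rw [this, hw', hz]
      linear_combination (-a * s) * hbb
    have hwFB : w' ∈ FB ((fun z => a * β / 2 * z) ⁻¹' ann d 1) (fun z => u (a * β / 2 * z) / ‖a * β / 2‖) := by
      rw [FB_scale _ _ hb0, mem_preimage, hw]
      rwa [FB_scale _ _ ha, mem_preimage] at a2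
    have hwre : w'.re = p'.re - 2 * β.re * s := by rw [hw']; simp
    have hwim : w'.im = 7/20 + 2 * β.im * s := by rw [hw']; simp [hp']
    obtain ⟨o1, o2, o3, o4⟩ := ov_ineq hbr2 hbr h1'.1 h1'.2 hs0 hs1 hpre'.1 hpre'.2
    have hwI : w'.im ∈ Icc (1/16:ℝ) (7/16) := by rw [hwim]; exact o1
    have hge' : ga d u (a * β / 2) w'.im ≤ w'.re := by
      by_contra hlt'
      refine (Gb.H.g_spec (y := w'.im) ⟨by linarith [hwI.1], by linarith [hwI.2]⟩).2.2 w'.re (by rw [hwre]; exact o2)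
        (not_le.1 hlt') (Gb.H.S.memFB.1 hwFB).2.2
    have hl := Gb.lip' (a := 7/20) (b := w'.im) ⟨by norm_num, by norm_num⟩ hwI
    have hl1 := (abs_le.1 hl).1
    have e1 : |w'.im - 7/20| ≤ s / 5 := by
      rw [hwim, add_sub_cancel_left]; exact o3
    have e2 : lL ε Mb * |w'.im - 7/20| ≤ 1/5 * (s/5) := mul_le_mul l2 e1 (abs_nonneg _) (by norm_num)
    have e3 : p'.re = ga d u (a * β / 2) (7/20) := rfl
    rw [hwre] at hge'
    clear_value s
    linarith
  apply Complex.ext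
  · exact heq
  · rfl

theorem nrm_exp {n : ℂ} {m : ℝ} (h1 : ‖n‖ = 1) (h2 : 0 < n.re) (h3 : n.im = -m * n.re) :
    n = exp ((-Real.arctan m : ℝ) * I) := by
  have hs := sq_re_im n
  rw [h1, h3] at hs
  have hq : 0 < Real.sqrt (1 + m ^ 2) := Real.sqrt_pos.2 (by positivity)
  have hre : n.re = 1 / Real.sqrt (1 + m ^ 2) := by
    rw [eq_div_iff hq.ne']
    have h4 : (n.re * Real.sqrt (1 + m ^ 2)) ^ 2 = 1 := by
      rw [mul_pow, Real.sq_sqrt (by positivity)]; linarith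
    have h5 : 0 < n.re * Real.sqrt (1 + m ^ 2) := mul_pos h2 hq
    nlinarith
  apply Complex.ext
  · rw [Complex.exp_ofReal_mul_I_re, Real.cos_neg, Real.cos_arctan, hre]
  · rw [Complex.exp_ofReal_mul_I_im, Real.sin_neg, Real.sin_arctan, h3, hre]; field_simp

theorem arctan_le {x y : ℝ} : |Real.arctan x - Real.arctan y| ≤ |x - y| := by
  have : LipschitzWith 1 Real.arctan := by
    refine lipschitzWith_of_nnnorm_deriv_le Real.differentiable_arctan fun x => ?_
    rw [Real.deriv_arctan, ← NNReal.coe_le_coe, coe_nnnorm, Real.norm_eq_abs, abs_of_pos (by positivity)]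
    rw [NNReal.coe_one, div_le_one (by positivity)]; nlinarith [sq_nonneg x]
  simpa [Real.dist_eq] using this.dist_le_mul x y

noncomputable def Tt (d : ℝ) (u : ℂ → ℝ) (a : ℂ) : ℝ := Real.arctan (deriv (ga d u a) (7/20))

theorem Tt_le {a : ℂ} {M : ℝ} (G : NMa d u f N ε M a) : |Tt d u a| ≤ lL ε M := by
  obtain ⟨m, h1, h2, -⟩ := G.graph (y := 7/20) ⟨by norm_num, by norm_num⟩
  unfold Tt; rw [h1.deriv]
  have := arctan_le (x := m) (y := 0)
  rw [Real.arctan_zero, sub_zero, sub_zero] at this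
  exact this.trans h2

theorem step {a β : ℂ} {Ma Mb α : ℝ} (hd : 0 < d) (hε' : ε ≤ 1/1000) (ha : 64 * d ≤ ‖a‖) (hβ : β = exp (α * I)) (hα : |α| ≤ Real.pi)
    (f1 : Flat d ε u a) (f2 : Flat d ε u (a * β / 2))
    (Ga : NMa d u f N ε Ma a) (Gb : NMa d u f N ε Mb (a * β / 2)) :
    α - Tt d u (a * β / 2) ≤ - Tt d u a + 600 * Ma := by
  have hk : 0 < ‖a‖ := by linarith
  have ha0 : a ≠ 0 := norm_pos_iff.1 hk
  have hβ1 : ‖β‖ = 1 := by rw [hβ, Complex.norm_exp_ofReal_mul_I]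
  obtain ⟨r1, r2⟩ := rot_close hd ha f1 f2 hβ1 hε'
  obtain ⟨y, hy, e⟩ := overlap ha0 hβ1 (by linarith) r2 Ga Gb
  obtain ⟨m1, d1, l1, n1, p1, q1, -⟩ := Ga.graph (y := y) ⟨by linarith [hy.1], by linarith [hy.2]⟩
  obtain ⟨m2, d2, l2, n2, p2, q2, -⟩ := Gb.graph (y := 7/20) ⟨by norm_num, by norm_num⟩
  obtain ⟨m3, d3, l3, -⟩ := Ga.graph (y := 7/20) ⟨by norm_num, by norm_num⟩
  have hm := Ga.mono (by linarith [hy.1]) (by linarith [hy.2]) (by norm_num) d1 d3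
  unfold Tt
  rw [d2.deriv, d3.deriv]
  have E1 := nrm_exp n1 p1 q1
  have E2 := nrm_exp n2 p2 q2
  rw [e] at E1
  have harg : a * (β / 2 * ⟨ga d u (a * β / 2) (7/20), 7/20⟩) = a * β / 2 * ⟨ga d u (a * β / 2) (7/20), 7/20⟩ := by ring
  rw [harg] at E1
  set W := N (a * β / 2 * ⟨ga d u (a * β / 2) (7/20), 7/20⟩)
  have hnb : ‖a * β / 2‖ = ‖a‖ / 2 := by simp [hβ1]
  have E3 : exp ((-Real.arctan m2 : ℝ) * I) = exp ((-Real.arctan m1 : ℝ) * I) * (starRingEnd ℂ) β := by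
    rw [← E1, ← E2, hnb]
    have : (‖a‖ : ℂ) ≠ 0 := by exact_mod_cast hk.ne'
    simp only [map_mul, map_div₀, map_ofNat]; push_cast; field_simp
  have E4 : (starRingEnd ℂ) β = exp ((-α : ℝ) * I) := by
    rw [hβ, ← exp_conj]; simp
  rw [E4, ← Complex.exp_add] at E3
  have E5 : exp ((Real.arctan m2 - Real.arctan m1 - α : ℝ) * I) = 1 := by
    have : exp ((Real.arctan m2 - Real.arctan m1 - α : ℝ) * I) =
      exp ((-Real.arctan m1 : ℝ) * I + (-α : ℝ) * I) * exp (-((-Real.arctan m2 : ℝ) * I)) := by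
        rw [← Complex.exp_add]; congr 1; push_cast; ring
    rw [this, ← E3, ← Complex.exp_add, add_neg_cancel, Complex.exp_zero]
  have E6 := congrArg Complex.re E5
  rw [Complex.exp_ofReal_mul_I_re, one_re] at E6
  have A1 := arctan_le (x := m1) (y := 0)
  have A2 := arctan_le (x := m2) (y := 0)
  have A3 := arctan_le (x := m3) (y := m1)
  rw [Real.arctan_zero, sub_zero, sub_zero] at A1 A2
  have A1' := abs_le.1 (A1.trans (l1.trans Ga.lLb.2))
  have A2' := abs_le.1 (A2.trans (l2.trans Gb.lLb.2))
  have hα' := abs_le.1 hα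
  have hpi := Real.pi_gt_three
  have E7 := (Real.cos_eq_one_iff_of_lt_of_lt (by linarith) (by linarith)).1 E6
  have hM := Ga.hM
  have A4 : Real.arctan m3 - Real.arctan m1 ≤ 600 * Ma := by
    rcases le_total m3 m1 with h | h
    · have := Real.arctan_strictMono.monotone h
      linarith
    · rw [abs_of_nonneg (sub_nonneg.2 h)] at A3
      have := (le_abs_self _).trans A3
      nlinarith [hy.1]
  linarith

end P11

noncomputable def Rr (k : ℕ) : ℝ := (1/2)^k / 8
theorem Rr_pos (k : ℕ) : 0 < Rr k := by unfold Rr; positivity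
theorem Rr_le (k : ℕ) : Rr k ≤ 1/8 := by
  have : (1/2:ℝ)^k ≤ 1 := pow_le_one₀ (by norm_num) (by norm_num)
  unfold Rr; linarith
theorem Rr_succ (k : ℕ) : Rr (k+1) = Rr k / 2 := by unfold Rr; ring

noncomputable def aR (R θ : ℝ) : ℂ := R * exp (θ * I)
theorem aR_norm {R θ : ℝ} (hR : 0 ≤ R) : ‖aR R θ‖ = R := by
  rw [aR, norm_mul, Complex.norm_exp_ofReal_mul_I, mul_one, norm_real, Real.norm_eq_abs, abs_of_nonneg hR]

noncomputable def C7 : ℝ := 128 * bK + 1800 * C6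

section P12
variable {u : ℂ → ℝ} {f N : ℂ → ℂ} {d ε : ℝ}

theorem chain (O : Og d u f N) (hF : Fl d ε u) (hε : 0 < ε) (hb : bK * ε ≤ 1 / 1000) (hε' : ε ≤ 1 / 1000000)
    (hC : 3000 * (C6 * ε) ≤ 1) {θ : ℕ → ℝ} (h1 : ∀ k, 8192 * d ≤ Rr k → Flat d ε u (aR (Rr k) (θ k)))
    (h2 : ∀ k, |θ (k+1) - θ k| ≤ Real.pi) : ∀ k, 8192 * d ≤ Rr k → θ k - θ 0 ≤ C7 * ε := by
  have hd := O.hd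
  have hC6 := C6_ge
  have hn : ∀ k, ‖aR (Rr k) (θ k)‖ = Rr k := fun k => aR_norm (Rr_pos k).le
  have hG : ∀ k, 8192 * d ≤ Rr k → NMa d u f N ε (MM d ε (Rr k)) (aR (Rr k) (θ k)) := by
    intro k hk
    have := O.nm hF hε hb hε' hC hε hb (a := aR (Rr k) (θ k)) (by rw [hn]; exact Rr_le k) (by rw [hn]; exact hk) (h1 k hk)
    rwa [hn k] at this
  have main : ∀ k, 8192 * d ≤ Rr k → θ k - Tt d u (aR (Rr k) (θ k)) ≤ θ 0 - Tt d u (aR (Rr 0) (θ 0)) +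
      600 * (C6 * ε * (1 - 2 * Rr k + 3 * Real.sqrt (d / Rr k))) := by
    intro k
    induction k with
    | zero =>
      intro hk
      have h0 : Rr 0 = 1/8 := by unfold Rr; norm_num
      have : 0 ≤ 600 * (C6 * ε * (1 - 2 * Rr 0 + 3 * Real.sqrt (d / Rr 0))) := by
        have : 0 ≤ 1 - 2 * Rr 0 + 3 * Real.sqrt (d / Rr 0) := by
          rw [h0]; have := Real.sqrt_nonneg (d / (1/8)); linarith
        positivity
      linarith
    | succ k ih =>
      intro hk
      have hk' : 8192 * d ≤ Rr k := by rw [Rr_succ] at hk; linarith [Rr_pos k]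
      have e : aR (Rr k) (θ k) * exp ((θ (k+1) - θ k : ℝ) * I) / 2 = aR (Rr (k+1)) (θ (k+1)) := by
        unfold aR
        rw [mul_assoc, ← Complex.exp_add, Rr_succ]
        have : (θ k : ℂ) * I + (θ (k+1) - θ k : ℝ) * I = θ (k+1) * I := by push_cast; ring
        rw [this]; push_cast; ring
      have st := step (ε := ε) (Mb := MM d ε (Rr (k+1))) hd (by linarith) (by rw [hn]; linarith) (rfl) (h2 k) (h1 k hk')
        (by rw [e]; exact h1 _ hk) (hG k hk') (by rw [e]; exact hG _ hk)
      rw [e] at st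
      have ih' := ih hk'
      have hsq : Real.sqrt (d / Rr (k+1)) = Real.sqrt 2 * Real.sqrt (d / Rr k) := by
        rw [← Real.sqrt_mul (by norm_num), Rr_succ]; congr 1; field_simp
      have hs2 : 1.4 ≤ Real.sqrt 2 := Real.le_sqrt_of_sq_le (by norm_num)
      have hs0 := Real.sqrt_nonneg (d / Rr k)
      have hM : MM d ε (Rr k) ≤ C6 * ε * (1 - 2 * Rr (k+1) + 3 * Real.sqrt (d / Rr (k+1))) -
          C6 * ε * (1 - 2 * Rr k + 3 * Real.sqrt (d / Rr k)) := by
        unfold MM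
        rw [← mul_sub]
        refine mul_le_mul_of_nonneg_left ?_ (by positivity)
        rw [hsq, Rr_succ]
        nlinarith
      linarith
  intro k hk
  have h0 : Rr 0 = 1/8 := by unfold Rr; norm_num
  have hk0 : 8192 * d ≤ Rr 0 := by rw [h0]; linarith [Rr_le k]
  have m := main k hk
  have t1 := abs_le.1 (Tt_le (hG k hk))
  have t2 := abs_le.1 (Tt_le (hG 0 hk0))
  obtain ⟨-, m1, s1⟩ := MM_le hd hε (Rr_le k) hk
  obtain ⟨-, m2, -⟩ := MM_le hd hε (Rr_le 0) hk0
  have hp : 0 < C6 * ε := by positivity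
  have hs : C6 * ε * (1 - 2 * Rr k + 3 * Real.sqrt (d / Rr k)) ≤ C6 * ε * 2 :=
    mul_le_mul_of_nonneg_left (by linarith [Rr_pos k]) hp.le
  unfold lL at t1 t2
  unfold C7
  linarith [t1.1, t1.2, t2.1, t2.2]

theorem ann_conj : (starRingEnd ℂ) ⁻¹' ann d 1 = ann d 1 := by ext z; simp [ann]

theorem FB_conj (Ω : Set ℂ) (u : ℂ → ℝ) : FB ((starRingEnd ℂ) ⁻¹' Ω) (fun z => u ((starRingEnd ℂ) z)) =
      (starRingEnd ℂ) ⁻¹' FB Ω u := by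
  have := FB_preimage (Ω := Ω) (u := u) conjCLE.toHomeomorph 1 one_pos
  simp only [div_one] at this
  exact this

theorem Og.conj (O : Og d u f N) : Og d (fun z => u ((starRingEnd ℂ) z))
      (fun z => (starRingEnd ℂ) (f ((starRingEnd ℂ) z))) (fun z => (starRingEnd ℂ) (N ((starRingEnd ℂ) z))) := by
  have hS := O.S.conj
  have hFB := FB_conj (ann d 1) u
  rw [ann_conj] at hS hFB
  refine ⟨hS, O.hd, ?_, ?_⟩
  · obtain ⟨z, hz⟩ := O.ne
    exact ⟨(starRingEnd ℂ) z, by rw [hFB]; simpa using hz⟩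
  · intro z hz
    rw [hFB] at hz
    obtain ⟨F, h1, h2, h3, h4⟩ := O.nc _ hz
    refine ⟨(starRingEnd ℂ) ⁻¹' F, by rw [hFB]; exact preimage_mono h1,
      conjCLE.toHomeomorph.isPreconnected_preimage.2 h2, h3, fun s hs1 hs2 => ?_⟩
    obtain ⟨w, hw, e⟩ := h4 s hs1 hs2
    exact ⟨(starRingEnd ℂ) w, by simpa using hw, by simpa using e⟩

theorem Flat.conj {a : ℂ} (h : Flat d ε u a) : Flat d ε (fun z => u ((starRingEnd ℂ) z)) ((starRingEnd ℂ) a) := by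
  intro z h1 h2
  have := h ((starRingEnd ℂ) z) (by simpa using h1) (by simpa using h2)
  rw [Pfun_conj] at this
  simpa using this

theorem aR_conj {R θ : ℝ} : (starRingEnd ℂ) (aR R θ) = aR R (-θ) := by
  unfold aR
  rw [map_mul, conj_ofReal, ← exp_conj]; simp

theorem Fl.conj (h : Fl d ε u) : Fl d ε (fun z => u ((starRingEnd ℂ) z)) := by
  intro r h1 h2
  obtain ⟨a, ha, hf⟩ := h r h1 h2
  exact ⟨(starRingEnd ℂ) a, by simpa using ha, hf.conj⟩

theorem Pfun_lip (z w : ℂ) : |Pfun z - Pfun w| ≤ ‖z - w‖ := by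
  unfold Pfun
  refine (abs_max_sub_max_le_abs _ _ _).trans ?_
  rw [← sub_re]; exact abs_re_le_norm _

theorem Flat.rot {R θ θ' η : ℝ} (hR : 0 ≤ R) (h : Flat d ε u (aR R θ)) (hη : |θ' - θ| ≤ η) : Flat d (ε + η) u (aR R θ') := by
  intro z h1 h2
  rw [aR_norm hR] at h1 ⊢
  have := h (exp ((θ' - θ : ℝ) * I) * z) (by rw [aR_norm hR, norm_mul, Complex.norm_exp_ofReal_mul_I, one_mul]; exact h1)
    (by rw [norm_mul, Complex.norm_exp_ofReal_mul_I, one_mul]; exact h2)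
  rw [aR_norm hR] at this
  have e : aR R θ * (exp ((θ' - θ : ℝ) * I) * z) = aR R θ' * z := by
    unfold aR
    rw [← mul_assoc, mul_assoc (R : ℂ), ← Complex.exp_add]
    congr 3; push_cast; ring
  rw [e] at this
  have h3 := Pfun_lip (exp ((θ' - θ : ℝ) * I) * z) z
  have h4 : ‖exp ((θ' - θ : ℝ) * I) * z - z‖ ≤ η := by
    have : exp ((θ' - θ : ℝ) * I) * z - z = (exp (I * (θ' - θ : ℝ)) - 1) * z := by rw [mul_comm I]; ring
    rw [this, norm_mul]
    have h5 := Real.norm_exp_I_mul_ofReal_sub_one_le (x := θ' - θ)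
    rw [Real.norm_eq_abs] at h5
    have := norm_nonneg z
    nlinarith [norm_nonneg (exp (I * (θ' - θ : ℝ)) - 1)]
  calc _ ≤ |u (aR R θ' * z) / R - Pfun (exp ((θ' - θ : ℝ) * I) * z)| + |Pfun (exp ((θ' - θ : ℝ) * I) * z) - Pfun z| := abs_sub_le _ _ _
    _ ≤ _ := add_le_add this (h3.trans h4)

theorem Flat.shrink {R θ t : ℝ} (hR : 0 < R) (h : Flat d ε u (aR R θ)) (ht : 1/2 ≤ t) (ht1 : t ≤ 1) : Flat d (2 * ε) u (aR (t * R) θ) := by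
  intro z h1 h2
  have ht0 : 0 < t := by linarith
  rw [aR_norm (by positivity)] at h1 ⊢
  have hz := norm_nonneg z
  have hn : ‖(t : ℂ) * z‖ = t * ‖z‖ := by rw [norm_mul, norm_real, Real.norm_eq_abs, abs_of_pos ht0]
  have := h (t * z) (by rw [aR_norm hR.le, hn]; linarith) (by rw [hn]; nlinarith)
  rw [aR_norm hR.le, Pfun_smul ht0.le] at this
  have e : aR R θ * (t * z) = aR (t * R) θ * z := by unfold aR; push_cast; ring
  rw [e] at this
  have e2 : u (aR (t * R) θ * z) / R - t * Pfun z = t * (u (aR (t * R) θ * z) / (t * R) - Pfun z) := by field_simp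
  rw [e2, abs_mul, abs_of_pos ht0] at this
  nlinarith [abs_nonneg (u (aR (t * R) θ * z) / (t * R) - Pfun z)]

noncomputable def C8 : ℝ := 2 * (1 + C7)

theorem fixed (O : Og d u f N) (hF : Fl d ε u) (hε : 0 < ε) (hb : bK * ε ≤ 1 / 1000) (hε' : ε ≤ 1 / 1000000)
    (hC : 3000 * (C6 * ε) ≤ 1) : ∃ θ, ∀ R, 16384 * d ≤ R → R ≤ 1/8 → Flat d (C8 * ε) u (aR R θ) := by
  have hd := O.hd
  have hst : ∀ (k : ℕ) (θ : ℝ), ∃ θ', (8192 * d ≤ Rr k → Flat d ε u (aR (Rr k) θ')) ∧ |θ' - θ| ≤ Real.pi := by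
    intro k θ
    by_cases hk : 8192 * d ≤ Rr k
    · obtain ⟨a, ha, hf⟩ := hF (Rr k) (by linarith) (by linarith [Rr_le k])
      refine ⟨θ + arg (a * exp ((-θ : ℝ) * I)), fun _ => ?_, ?_⟩
      · have e : aR (Rr k) (θ + arg (a * exp ((-θ : ℝ) * I))) = a := by
          have h1 := Complex.norm_mul_exp_arg_mul_I (a * exp ((-θ : ℝ) * I))
          rw [norm_mul, Complex.norm_exp_ofReal_mul_I, mul_one, ha] at h1
          unfold aR
          push_cast at h1 ⊢
          rw [add_mul, Complex.exp_add, mul_left_comm, h1, mul_left_comm, ← Complex.exp_add]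
          simp
        rw [e]; exact hf
      · rw [add_sub_cancel_left]; exact abs_arg_le_pi _
    · exact ⟨θ, fun h => absurd h hk, by simp [Real.pi_pos.le]⟩
  choose nx hnx using hst
  set θ : ℕ → ℝ := fun k => Nat.rec (nx 0 0) (fun k t => nx (k+1) t) k with hθ
  have h1 : ∀ k, 8192 * d ≤ Rr k → Flat d ε u (aR (Rr k) (θ k)) := by
    intro k
    cases k with
    | zero => exact (hnx 0 0).1
    | succ k => exact (hnx (k+1) (θ k)).1
  have h2 : ∀ k, |θ (k+1) - θ k| ≤ Real.pi := fun k => (hnx (k+1) (θ k)).2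
  have c1 := chain O hF hε hb hε' hC h1 h2
  have c2 := chain O.conj hF.conj hε hb hε' hC (θ := fun k => - θ k)
    (fun k hk => by have := (h1 k hk).conj; rwa [aR_conj] at this)
    (fun k => by
      have := h2 k
      rwa [abs_sub_comm, ← neg_sub_neg] at this)
  refine ⟨θ 0, fun R hR hR8 => ?_⟩
  have hR0 : 0 < R := by linarith
  obtain ⟨k, hk1, hk2⟩ := exists_nat_pow_near_of_lt_one (x := 8 * R) (y := 1/2) (by linarith) (by linarith) (by norm_num) (by norm_num)
  have hk1' : R ≤ Rr k := by unfold Rr; linarith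
  have hk2' : Rr (k+1) < R := by unfold Rr; linarith
  rw [Rr_succ] at hk2'
  have hk : 8192 * d ≤ Rr k := by linarith
  have hRk := Rr_pos k
  have := (h1 k hk).rot hRk.le (θ' := θ 0) (η := C7 * ε) (by
    rw [abs_le]; constructor
    · linarith [c1 k hk]
    · have := c2 k hk; linarith)
  have := this.shrink hRk (t := R / Rr k) (by rw [le_div_iff₀ hRk]; linarith) (by rw [div_le_one hRk]; exact hk1')
  rw [div_mul_cancel₀ _ hRk.ne'] at this
  unfold C8
  have e : 2 * (ε + C7 * ε) = 2 * (1 + C7) * ε := by ring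
  rwa [e] at this

end P12

section P13
variable {Ω : Set ℂ} {u : ℂ → ℝ} {f N : ℂ → ℂ} {δ ε M : ℝ}

theorem NF.line (H : NF δ ε Ω u f N) {t : ℝ} (ht : 1/4 ≤ t) (ht1 : t ≤ 1) :
    ∃ y ∈ Ioo (t/4) (t/2), ∀ x ∈ Icc (-(t/2)) (t/2), ∀ x' ∈ Icc (-(t/2)) (t/2), x' < x → u ⟨x, y⟩ = 0 →
      0 < u ⟨x', y⟩ → False := by
  obtain ⟨s1, s2, s3, s4⟩ := H.small
  have hc := c0_pos
  have hε := H.hε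
  have t0 : 0 < t := by linarith
  have htc : (t : ℂ) ≠ 0 := by exact_mod_cast t0.ne'
  have hn : ‖(t : ℂ)‖ = t := by rw [norm_real, Real.norm_eq_abs, abs_of_pos t0]
  have hK : ∀ z ∈ KK, δ < ‖(t:ℂ) * z‖ ∧ ‖(t:ℂ) * z‖ < 1 := by
    intro z hz
    have h1 := sq_re_im z
    have h2 : z.re ^ 2 ≤ (3/4)^2 := sq_le_sq' (abs_le.1 hz.1).1 (abs_le.1 hz.1).2
    have h3 := H.hδ'
    have h5 := hz.2.1
    have h6 := hz.2.2
    rw [norm_mul, hn]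
    have h7 : 1/4 ≤ ‖z‖ := by
      have := Complex.abs_im_le_norm z; rw [abs_of_nonneg (by linarith)] at this; linarith
    have h8 : ‖z‖ < 1 := by nlinarith [norm_nonneg z]
    constructor <;> nlinarith
  obtain ⟨y, hy, h⟩ := (exists_MI.choose_spec.2 (H.S.scale t htc) (fun z hz => H.dom _ (hK z hz).1 (hK z hz).2)).2
    (fun z hz => by
      have h1 := H.flat _ (hK z hz).1 (hK z hz).2
      rw [Pfun_smul t0.le] at h1
      have e : u (t * z) / ‖(t:ℂ)‖ - Pfun z = (u (t * z) - t * Pfun z) / t := by rw [hn]; field_simp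
      rw [e, abs_div, abs_of_pos t0, div_le_iff₀ t0]
      have h2 : ε ≤ 1/1000 * c0 := by rwa [div_le_iff₀ hc] at s2
      have h3 : c0 * (1/4) ≤ c0 * t := mul_le_mul_of_nonneg_left ht hc.le
      change _ ≤ c0 * t
      linarith)
  refine ⟨t * y, ⟨by nlinarith [hy.1], by nlinarith [hy.2]⟩, fun x hx x' hx' hlt h0 hp => ?_⟩
  have e : ∀ s : ℝ, (t : ℂ) * ⟨s / t, y⟩ = ⟨s, t * y⟩ := fun s => by
    apply Complex.ext
    · rw [re_ofReal_mul]; exact mul_div_cancel₀ _ t0.ne'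
    · rw [im_ofReal_mul]
  have m : ∀ s ∈ Icc (-(t/2)) (t/2), s / t ∈ Icc (-1/2:ℝ) (1/2) := fun s hs =>
    ⟨by rw [le_div_iff₀ t0]; linarith [hs.1], by rw [div_le_iff₀ t0]; linarith [hs.2]⟩
  refine h (x / t) (m x hx) (x' / t) (m x' hx') (div_lt_div_of_pos_right hlt t0) ?_ ?_
  · rw [e, h0, zero_div]
  · rw [e, hn]; positivity

theorem NM.rpos (G : NM δ ε M Ω u f N) {y x : ℝ} (hy : y ∈ Ioo (1/16:ℝ) (7/16)) (hx : gf Ω u y < x) :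
    ∃ x' ∈ Ioo (gf Ω u y) x, 0 < u ⟨x', y⟩ := by
  obtain ⟨m, -, -, -, -, -, hev⟩ := G.graph hy
  have hc : Tendsto (fun x : ℝ => (⟨x, y⟩ : ℂ)) (𝓝 (gf Ω u y)) (𝓝 ⟨gf Ω u y, y⟩) :=
    (Complex.equivRealProdCLM.symm.continuous.comp (continuous_id.prodMk continuous_const)).tendsto _
  have e1 := (hc.eventually hev).filter_mono (nhdsWithin_le_nhds (s := Ioi (gf Ω u y)))
  obtain ⟨x', h1, h2⟩ := (e1.and (Ioo_mem_nhdsGT hx)).exists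
  exact ⟨x', h2, h1.1.2 h2.1⟩

theorem NM.good (G : NM δ ε M Ω u f N) {t : ℝ} (ht : 1/4 ≤ t) (ht1 : t ≤ 7/8) :
    ∃ y ∈ Ioo (t/4) (t/2), ∀ x, |x| ≤ 1/16 → gf Ω u y < x → 0 < u ⟨x, y⟩ := by
  obtain ⟨y, hy, h⟩ := G.H.line ht (by linarith)
  refine ⟨y, hy, fun x hx hg => ?_⟩
  have hb := G.H.hb
  have hy1 : y ∈ Ioo (1/16:ℝ) (7/16) := ⟨by linarith [hy.1], by linarith [hy.2]⟩
  have hy2 : y ∈ Icc (1/32:ℝ) (15/32) := ⟨by linarith [hy1.1], by linarith [hy1.2]⟩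
  have hx' := abs_le.1 hx
  obtain ⟨x', h1, h2⟩ := G.rpos hy1 hg
  have hgb := abs_le.1 (G.H.g_spec hy2).1
  have hbn := box_norm hx hy2
  have hΩ : (⟨x, y⟩ : ℂ) ∈ Ω := G.H.dom _ (by linarith [G.H.hδ', hbn.1, hy1.1]) (by linarith [hbn.2])
  refine lt_of_le_of_ne (G.H.S.nonneg _ hΩ) fun h0 => ?_
  exact h x ⟨by linarith, by linarith⟩ x' ⟨by linarith [h1.1], by linarith [h1.2]⟩ h1.2 h0.symm h2

theorem NM.noFB (G : NM δ ε M Ω u f N) {z : ℂ} (hz : z ∈ FB Ω u) (hx : |z.re| ≤ 1/16) (hy : z.im ∈ Icc (1/8:ℝ) (7/32)) :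
    z.re ≤ gf Ω u z.im := by
  by_contra hlt
  push Not at hlt
  obtain ⟨so, hso, ho⟩ := G.good (t := 7/8) (by norm_num) (by norm_num)
  obtain ⟨si, hsi, hi⟩ := G.good (t := 1/4) (by norm_num) (by norm_num)
  have hb := G.H.hb
  have hIcc : ∀ {y : ℝ}, si ≤ y → y ≤ so → y ∈ Ioo (1/16:ℝ) (7/16) := fun h1 h2 =>
    ⟨by linarith [hsi.1], by linarith [hso.2]⟩
  set A : Set ℂ := {w | w.im ∈ Ioo si so ∧ gf Ω u w.im < w.re} with hA
  have hAo : IsOpen A := by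
    rw [isOpen_iff_mem_nhds]
    intro w hw
    have hc : ContinuousAt (fun w : ℂ => gf Ω u w.im) w :=
      ContinuousAt.comp (f := fun w : ℂ => w.im) (G.gcont (hIcc hw.1.1.le hw.1.2.le)) continuous_im.continuousAt
    filter_upwards [continuous_im.continuousAt.preimage_mem_nhds (Ioo_mem_nhds hw.1.1 hw.1.2),
      hc.eventually_lt continuous_re.continuousAt hw.2] with w' h1 h2
    exact ⟨h1, h2⟩
  set E := closure (A ∩ FB Ω u) with hE
  have hstr : ∀ w ∈ A ∩ FB Ω u, ‖w‖ < 3/4 → |w.re| ≤ bK * ε := fun w hw h2 => by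
    refine G.H.strip hw.2 ?_ h2.le
    have := Complex.abs_im_le_norm w
    have h3 := hIcc hw.1.1.1.le hw.1.1.2.le
    rw [abs_of_pos (by linarith [h3.1])] at this; linarith [h3.1]
  set A' : Set ℂ := A ∩ {w | ‖w‖ < 1/2} with hA'
  have hA'o : IsOpen A' := hAo.inter (isOpen_lt continuous_norm continuous_const)
  set E' := closure (A' ∩ FB Ω u) with hE'
  have hcl : ∀ w ∈ E', w.im ∈ Icc si so ∧ |w.re| ≤ bK * ε ∧ gf Ω u w.im ≤ w.re ∧ ‖w‖ < 1/2 := by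
    intro w hw
    have c1 : IsClosed {w : ℂ | w.im ∈ Icc si so ∧ |w.re| ≤ bK * ε} :=
      (isClosed_Icc.preimage continuous_im).inter (isClosed_le (continuous_abs.comp continuous_re) continuous_const)
    have h1 := closure_minimal (fun w' (hw' : w' ∈ A' ∩ FB Ω u) =>
      show w' ∈ {w : ℂ | w.im ∈ Icc si so ∧ |w.re| ≤ bK * ε} from
      ⟨⟨hw'.1.1.1.1.le, hw'.1.1.1.2.le⟩, hstr w' ⟨hw'.1.1, hw'.2⟩ (by
        have : ‖w'‖ < 1/2 := hw'.1.2
        linarith)⟩) c1 hw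
    have hI := hIcc h1.1.1 h1.1.2
    refine ⟨h1.1, h1.2, ?_, ?_⟩
    · by_contra hlt2
      have hc : ContinuousAt (fun w : ℂ => gf Ω u w.im) w :=
        ContinuousAt.comp (f := fun w : ℂ => w.im) (G.gcont hI) continuous_im.continuousAt
      have hev := continuous_re.continuousAt.eventually_lt hc (not_le.1 hlt2)
      obtain ⟨w', h2, h3⟩ := mem_closure_iff_nhds.1 hw _ hev
      have h2' : w'.re < gf Ω u w'.im := h2
      exact absurd h3.1.1.2 (not_lt.2 h2'.le)
    · have := box_norm (x := w.re) (y := w.im) (by linarith [h1.2]) ⟨by linarith [hI.1], by linarith [hI.2]⟩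
      exact this.2
  obtain ⟨F, hFs, hFc, hzF, hF⟩ := G.H.nc z hz
  have hzn := (box_norm (x := z.re) (y := z.im) hx ⟨by linarith [hy.1], by linarith [hy.2]⟩).2
  have hzA : z ∈ A' := ⟨⟨⟨by linarith [hsi.2, hy.1], by linarith [hso.1, hy.2]⟩, hlt⟩, hzn⟩
  obtain ⟨w0, hw0, hn0⟩ := hF (3/5) (by linarith [G.H.hδ']) (by norm_num)
  have hcov : F ⊆ A' ∪ E'ᶜ := by
    intro w hw
    by_cases hwE : w ∈ E'
    · left
      obtain ⟨h1, h2, h3, h4⟩ := hcl w hwE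
      have hI := hIcc h1.1 h1.2
      have hwx : |w.re| ≤ 1/16 := by linarith
      have hu0 : u w = 0 := (G.H.S.memFB.1 (hFs hw)).2.1
      rcases h3.lt_or_eq with h5 | h5
      · have q1 : w.im ≠ si := fun h => by
          have := hi w.re hwx (h ▸ h5)
          have e : (⟨w.re, si⟩ : ℂ) = w := by rw [← h]
          rw [e] at this; linarith
        have q2 : w.im ≠ so := fun h => by
          have := ho w.re hwx (h ▸ h5)
          have e : (⟨w.re, so⟩ : ℂ) = w := by rw [← h]
          rw [e] at this; linarith
        exact ⟨⟨⟨lt_of_le_of_ne h1.1 q1.symm, lt_of_le_of_ne h1.2 q2⟩, h5⟩, h4⟩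
      · exfalso
        obtain ⟨m, -, -, -, -, -, hev⟩ := G.graph hI
        have e : (⟨gf Ω u w.im, w.im⟩ : ℂ) = w := by rw [h5]
        rw [e] at hev
        obtain ⟨w', h6, h7⟩ := mem_closure_iff_nhds.1 hwE _ hev
        have h8 := h6.2.1 h7.2
        have h9 := h7.1.1.2
        linarith
    · right; exact hwE
  obtain ⟨w, hw, hwA, hwB⟩ := hFc A' E'ᶜ hA'o isClosed_closure.isOpen_compl hcov ⟨z, hzF, hzA⟩
    ⟨w0, hw0, fun h => by have := (hcl w0 h).2.2.2; rw [hn0] at this; linarith⟩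
  exact hwB (subset_closure ⟨hwA, hFs hw⟩)

theorem NM.full (G : NM δ ε M Ω u f N) {x y : ℝ} (hx : |x| ≤ 1/16) (hy : y ∈ Icc (1/8:ℝ) (7/32)) :
    0 < u ⟨x, y⟩ ↔ gf Ω u y < x := by
  have hb := G.H.hb
  have hε := G.H.hε
  have hδ := G.H.hδ'
  obtain ⟨s1, -, -, -⟩ := G.H.small
  have hy2 : y ∈ Icc (1/32:ℝ) (15/32) := ⟨by linarith [hy.1], by linarith [hy.2]⟩
  have hΩ : ∀ x, |x| ≤ 1/16 → (⟨x, y⟩ : ℂ) ∈ Ω := fun x hx => by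
    have hbn := box_norm hx hy2
    exact G.H.dom _ (by linarith [hbn.1, hy.1]) (by linarith [hbn.2])
  obtain ⟨g1, g2, g3⟩ := G.H.g_spec hy2
  have g1' := abs_le.1 g1
  have hx' := abs_le.1 hx
  constructor
  · intro hu
    by_contra hle
    rcases (not_lt.1 hle).lt_or_eq with h | h
    · exact g3 x hx h (subset_closure ⟨hΩ x hx, hu⟩)
    · rw [← h] at g2
      have := (G.H.S.memFB.1 g2).2.1
      linarith
  · intro hg
    by_contra hu
    have hu0 : u ⟨x, y⟩ = 0 := le_antisymm (not_lt.1 hu) (G.H.S.nonneg _ (hΩ x hx))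
    have hcx : Continuous (fun x : ℝ => (⟨x, y⟩ : ℂ)) :=
      Complex.equivRealProdCLM.symm.continuous.comp (continuous_id.prodMk continuous_const)
    have hpo : IsOpen (posSet Ω u) := G.H.S.cont.isOpen_inter_preimage G.H.S.op isOpen_Ioi
    have habs : ∀ x' ∈ Ioc (gf Ω u y) (1/16), |x'| ≤ 1/16 := fun x' h => abs_le.2 ⟨by linarith [h.1], h.2⟩
    have hnf : ∀ x' ∈ Ioc (gf Ω u y) (1/16), u ⟨x', y⟩ = 0 → (⟨x', y⟩ : ℂ) ∉ closure (posSet Ω u) := fun x' h h0 hcl => by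
      have := G.noFB (z := ⟨x', y⟩) (G.H.S.memFB.2 ⟨hΩ _ (habs x' h), h0, hcl⟩) (habs x' h) hy
      exact absurd h.1 (not_lt.2 this)
    obtain ⟨x', h1, h2, h3⟩ := isPreconnected_Ioc (a := gf Ω u y) (b := 1/16) _ _ (hpo.preimage hcx)
      (isClosed_closure.isOpen_compl.preimage hcx) (fun x' h => by
        by_cases h0 : u ⟨x', y⟩ = 0
        · right; exact hnf x' h h0
        · left; exact ⟨hΩ _ (habs x' h), lt_of_le_of_ne (G.H.S.nonneg _ (hΩ _ (habs x' h))) (Ne.symm h0)⟩)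
      ⟨1/16, ⟨by linarith, le_rfl⟩, hΩ _ (by norm_num), by
        have hbn := box_norm (x := 1/16) (by norm_num) hy2
        exact G.H.pos_of (by linarith [hbn.1, hy.1]) (by linarith [hbn.2]) (by simp only; linarith)⟩
      ⟨x, ⟨hg, hx'.2⟩, hnf x ⟨hg, hx'.2⟩ hu0⟩
    exact h3 (subset_closure h2)

end P13

noncomputable def C9 : ℝ := 64 * bK * C8 + 300 * C6

theorem C8_ge : 2 ≤ C8 := by unfold C8 C7; linarith [bK_ge, C6_ge]

section P14
variable {u : ℂ → ℝ} {f N : ℂ → ℂ} {d ε : ℝ}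

theorem scale_val {R θ y x : ℝ} {ε1 M : ℝ} (hR : 0 < R) (G : NMa d u f N ε1 M (aR R θ)) (hy : y / R ∈ Icc (1/8:ℝ) (7/32)) (hx : |x| ≤ R / 16) :
    0 < u (aR 1 θ * ⟨x, y⟩) ↔ R * ga d u (aR R θ) (y / R) < x := by
  have h := G.full (x := x / R) (y := y / R) (by rw [abs_div, abs_of_pos hR, div_le_iff₀ hR]; linarith) hy
  have e : aR R θ * ⟨x / R, y / R⟩ = aR 1 θ * ⟨x, y⟩ := by
    have : (⟨x, y⟩ : ℂ) = R * ⟨x / R, y / R⟩ := by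
      apply Complex.ext
      · rw [re_ofReal_mul]; exact (mul_div_cancel₀ _ hR.ne').symm
      · rw [im_ofReal_mul]; exact (mul_div_cancel₀ _ hR.ne').symm
    rw [this]; unfold aR; push_cast; ring
  have hk : 0 < ‖aR R θ‖ := by rw [aR_norm hR.le]; exact hR
  rw [e, div_pos_iff_of_pos_right hk] at h
  rw [← lt_div_iff₀' hR]
  exact h

theorem upper (O : Og d u f N) (hF : Fl d ε u) (hε : 0 < ε) (hb : bK * ε ≤ 1 / 1000) (hε' : ε ≤ 1 / 1000000)
    (hC : 3000 * (C6 * ε) ≤ 1) (hb1 : bK * (C8 * ε) ≤ 1 / 1000) {θ : ℝ}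
    (hθ : ∀ R, 16384 * d ≤ R → R ≤ 1/8 → Flat d (C8 * ε) u (aR R θ)) :
    ∃ G : ℝ → ℝ, ∀ y, 3000 * d ≤ y → y ≤ 1/49 → |G y| ≤ C9 * ε * y ∧
      (∀ x, |x| ≤ y / 4 → (0 < u (aR 1 θ * ⟨x, y⟩) ↔ G y < x)) ∧ ∃ m, HasDerivAt G m y ∧ |m| ≤ C9 * ε := by
  have hd := O.hd
  have hC8 := C8_ge
  have hC6 := C6_ge
  have hbK := bK_ge
  have hN : ∀ R, 16384 * d ≤ R → R ≤ 1/8 → NMa d u f N (C8 * ε) (MM d ε R) (aR R θ) := fun R h1 h2 => by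
    have hR : 0 < R := by linarith
    have := O.nm hF hε hb hε' hC (ε1 := C8 * ε) (by positivity) hb1 (a := aR R θ) (by rw [aR_norm hR.le]; exact h2)
      (by rw [aR_norm hR.le]; linarith) (hθ R h1 h2)
    rwa [aR_norm hR.le] at this
  have hgb : ∀ R, 16384 * d ≤ R → R ≤ 1/8 → ∀ y ∈ Icc (1/32:ℝ) (15/32), |R * ga d u (aR R θ) y| ≤ R * (bK * (C8 * ε)) := by
    intro R h1 h2 y hy
    have hR : 0 < R := by linarith
    rw [abs_mul, abs_of_pos hR]
    exact mul_le_mul_of_nonneg_left ((hN R h1 h2).H.g_spec hy).1 hR.le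
  refine ⟨fun y => 6 * y * ga d u (aR (6 * y) θ) (1/6), fun y h1 h2 => ?_⟩
  have hy0 : 0 < y := by linarith
  have hval : ∀ y, 16384 * d ≤ 6 * y → 6 * y ≤ 1/8 → ∀ x, |x| ≤ y / 4 →
      (0 < u (aR 1 θ * ⟨x, y⟩) ↔ 6 * y * ga d u (aR (6 * y) θ) (1/6) < x) := by
    intro y h1 h2 x hx
    have hy0 : 0 < y := by linarith
    have e : y / (6 * y) = 1/6 := by field_simp
    have := scale_val (x := x) (y := y) (by linarith) (hN (6 * y) h1 h2) (by rw [e]; constructor <;> norm_num) (by linarith)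
    rwa [e] at this
  refine ⟨?_, hval y (by linarith) (by linarith), ?_⟩
  · refine (hgb (6 * y) (by linarith) (by linarith) (1/6) ⟨by norm_num, by norm_num⟩).trans ?_
    unfold C9
    have e1 : 0 ≤ bK * C8 * ε * y := by positivity
    have e2 : 0 ≤ C6 * ε * y := by positivity
    nlinarith
  · obtain ⟨m, hm, hmL, -⟩ := (hN (6 * y) (by linarith) (by linarith)).graph (y := 1/6) ⟨by norm_num, by norm_num⟩
    refine ⟨m, ?_, ?_⟩
    · have hm' : HasDerivAt (fun y' => 6 * y * ga d u (aR (6 * y) θ) (y' / (6 * y))) m y := by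
        have h3 : HasDerivAt (fun y' : ℝ => y' / (6 * y)) (1 / (6 * y)) y := (hasDerivAt_id y).div_const _
        have h4 : HasDerivAt (ga d u (aR (6 * y) θ)) m (y / (6 * y)) := by
          have e : y / (6 * y) = 1/6 := by field_simp
          rw [e]; exact hm
        exact ((h4.comp y h3).const_mul (6 * y)).congr_deriv (by field_simp)
      refine hm'.congr_of_eventuallyEq ?_
      have e1 : ∀ᶠ y' in 𝓝 y, y' ∈ Ioo (0.99 * y) (1.01 * y) := Ioo_mem_nhds (by linarith) (by linarith)
      filter_upwards [e1] with y' hy'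
      have p1 : 16384 * d ≤ 6 * y' := by linarith [hy'.1]
      have p2 : 6 * y' ≤ 1/8 := by linarith [hy'.2]
      have p3 : y' / (6 * y) ∈ Icc (1/8:ℝ) (7/32) :=
        ⟨by rw [le_div_iff₀ (by linarith)]; linarith [hy'.1], by rw [div_le_iff₀ (by linarith)]; linarith [hy'.2]⟩
      have v1 := hval y' p1 p2
      have v2 : ∀ x, |x| ≤ y' / 4 → _ := fun x hx =>
        scale_val (x := x) (y := y') (by linarith) (hN (6 * y) (by linarith) (by linarith)) p3 (by linarith [hy'.2])
      have q1 := hgb (6 * y') p1 p2 (1/6) ⟨by norm_num, by norm_num⟩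
      have q2 := hgb (6 * y) (by linarith) (by linarith) (y' / (6 * y)) ⟨by linarith [p3.1], by linarith [p3.2]⟩
      have r1 := q1.trans (mul_le_mul_of_nonneg_left hb1 (by linarith))
      have r2 := q2.trans (mul_le_mul_of_nonneg_left hb1 (by linarith))
      rcases lt_trichotomy (6 * y' * ga d u (aR (6 * y') θ) (1/6)) (6 * y * ga d u (aR (6 * y) θ) (y' / (6 * y))) with h | h | h
      · have hx := r2.trans (show _ ≤ y' / 4 by linarith [hy'.1])
        exact absurd ((v2 _ hx).1 ((v1 _ hx).2 h)) (lt_irrefl _)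
      · exact h
      · have hx := r1.trans (show _ ≤ y' / 4 by linarith [hy'.1])
        exact absurd ((v1 _ hx).1 ((v2 _ hx).2 h)) (lt_irrefl _)
    · refine hmL.trans ?_
      obtain ⟨-, m2, -⟩ := MM_le (ε := ε) (R := 6 * y) hd hε (by linarith) (by linarith)
      unfold lL C9; linarith

theorem side (O : Og d u f N) (hε : 0 < ε) (hb1 : bK * (C8 * ε) ≤ 1 / 1000) {θ : ℝ}
    (hθ : ∀ R, 16384 * d ≤ R → R ≤ 1/8 → Flat d (C8 * ε) u (aR R θ)) {z : ℂ} (h1 : 8192 * d ≤ ‖z‖) (h2 : ‖z‖ ≤ 1/16)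
    (h : |z.im| / 4 < |z.re|) : 0 < u (aR 1 θ * z) ↔ 0 < z.re := by
  have hd := O.hd
  have hC8 := C8_ge
  have hbK := bK_ge
  have hR : 0 < 2 * ‖z‖ := by linarith
  have hn := aR_norm (θ := θ) hR.le
  have H := O.nf (a := aR (2 * ‖z‖) θ) (by rw [hn]; linarith) (by rw [hn]; linarith) (hθ (2 * ‖z‖) (by linarith) (by linarith)) (by positivity) hb1
  have e : aR (2 * ‖z‖) θ * (z / (2 * ‖z‖ : ℝ)) = aR 1 θ * z := by
    have : ((2 * ‖z‖ : ℝ) : ℂ) ≠ 0 := by exact_mod_cast hR.ne'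
    unfold aR; field_simp; push_cast; ring
  have hzn : ‖z / (2 * ‖z‖ : ℝ)‖ = 1/2 := by
    rw [norm_div, norm_real, Real.norm_eq_abs, abs_of_pos hR]
    have hz0 : ‖z‖ ≠ 0 := by intro h0; rw [h0] at hR; linarith
    rw [div_eq_iff hR.ne']; ring
  have hzr : (z / (2 * ‖z‖ : ℝ)).re = z.re / (2 * ‖z‖) := div_ofReal_re _ _
  have hle := Complex.norm_le_abs_re_add_abs_im z
  have hle2 : ‖z‖ < 5 * |z.re| := by linarith
  obtain ⟨s1, -, -, -⟩ := H.small
  have hδ := H.hδ'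
  rcases lt_trichotomy z.re 0 with hz | hz | hz
  · have := H.left (z := z / (2 * ‖z‖ : ℝ)) (by
      rw [hzr, div_lt_iff₀ hR]; rw [abs_of_neg hz] at hle2; nlinarith) (by rw [hzn]; norm_num) (by rw [hzn]; norm_num)
    rw [e, hn, div_eq_zero_iff] at this
    have h0 : u (aR 1 θ * z) = 0 := this.resolve_right hR.ne'
    rw [h0]; constructor <;> intro <;> linarith
  · rw [hz, abs_zero] at h; exact absurd h (not_lt.2 (by positivity))
  · have := H.pos_of (z := z / (2 * ‖z‖ : ℝ)) (by rw [hzn]; linarith) (by rw [hzn]; norm_num) (by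
      rw [hzr, lt_div_iff₀ hR]; rw [abs_of_pos hz] at hle2; nlinarith)
    rw [e, hn, div_pos_iff_of_pos_right hR] at this
    exact ⟨fun _ => hz, fun _ => this⟩

end P14

theorem exists_ST : ∃ K > 0, ∀ t : ℝ, ∃ m, HasDerivAt Real.smoothTransition m t ∧ |m| ≤ K ∧ (t ∉ Icc (0:ℝ) 1 → m = 0) := by
  have hcd : ContDiff ℝ 1 Real.smoothTransition := Real.smoothTransition.contDiff
  have hc : Continuous (deriv Real.smoothTransition) := hcd.continuous_deriv le_rfl
  obtain ⟨K, hK⟩ := isCompact_Icc.exists_bound_of_continuousOn (s := Icc (0:ℝ) 1) hc.continuousOn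
  refine ⟨max K 1, by positivity, fun t => ?_⟩
  have h1 := (hcd.differentiable one_ne_zero t).hasDerivAt
  have h0 : t ∉ Icc (0:ℝ) 1 → deriv Real.smoothTransition t = 0 := by
    intro ht
    rw [mem_Icc, not_and_or, not_le, not_le] at ht
    rcases ht with ht | ht
    · have : Real.smoothTransition =ᶠ[𝓝 t] fun _ => 0 := by
        filter_upwards [gt_mem_nhds ht] with s hs using Real.smoothTransition.zero_of_nonpos hs.le
      rw [this.deriv_eq, deriv_const]
    · have : Real.smoothTransition =ᶠ[𝓝 t] fun _ => 1 := by
        filter_upwards [lt_mem_nhds ht] with s hs using Real.smoothTransition.one_of_one_le hs.le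
      rw [this.deriv_eq, deriv_const]
  refine ⟨_, h1, ?_, h0⟩
  by_cases ht : t ∈ Icc (0:ℝ) 1
  · exact (hK t ht).trans (le_max_left _ _)
  · rw [h0 ht, abs_zero]; positivity

theorem cut {K : ℝ} (hK : 0 < K) (hST : ∀ t : ℝ, ∃ m, HasDerivAt Real.smoothTransition m t ∧ |m| ≤ K ∧ (t ∉ Icc (0:ℝ) 1 → m = 0))
    {α β C : ℝ} {G : ℝ → ℝ} (hα : 0 < α) (hβ : 0 < β) (hC : 0 ≤ C)
    (hG : ∀ y ∈ Icc α (2 * β), |G y| ≤ C * y ∧ ∃ m, HasDerivAt G m y ∧ |m| ≤ C) :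
    ∃ E : ℝ → ℝ, (∀ y, ∃ m, HasDerivAt E m y ∧ |m| ≤ (1 + 4 * K) * C) ∧ (∀ y, y ≤ α → E y = 0) ∧
      (∀ y, 2 * α ≤ y → y ≤ β → E y = G y) ∧ ∀ y, |E y| ≤ C * |y| := by
  set T := Real.smoothTransition
  have T0 : ∀ s, 0 ≤ T s := Real.smoothTransition.nonneg
  have T1 : ∀ s, T s ≤ 1 := Real.smoothTransition.le_one
  have z1 : ∀ y, y ≤ α → T (y / α - 1) = 0 := fun y hy => Real.smoothTransition.zero_of_nonpos (by
    have : y / α ≤ 1 := by rwa [div_le_one hα]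
    linarith)
  have z2 : ∀ y, 2 * β ≤ y → T (2 - y / β) = 0 := fun y hy => Real.smoothTransition.zero_of_nonpos (by
    have : 2 ≤ y / β := by rwa [le_div_iff₀ hβ]
    linarith)
  have hCK : 0 ≤ (1 + 4 * K) * C := by positivity
  refine ⟨fun y => T (y / α - 1) * T (2 - y / β) * G y, fun y => ?_, fun y hy => ?_, fun y h1 h2 => ?_, fun y => ?_⟩
  · by_cases hy : y ∈ Icc α (2 * β)
    · obtain ⟨g0, m, hm, hmC⟩ := hG y hy
      have hy0 : 0 < y := by linarith [hy.1]
      obtain ⟨m1, d1, b1, c1⟩ := hST (y / α - 1)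
      obtain ⟨m2, d2, b2, c2⟩ := hST (2 - y / β)
      have D1 : HasDerivAt (fun y => T (y / α - 1)) (m1 * (1 / α)) y :=
        HasDerivAt.comp (h₂ := T) (h := fun y : ℝ => y / α - 1) y d1 (((hasDerivAt_id' y).div_const α).sub_const 1)
      have D2 : HasDerivAt (fun y => T (2 - y / β)) (m2 * (-(1 / β))) y :=
        HasDerivAt.comp (h₂ := T) (h := fun y : ℝ => 2 - y / β) y d2 (((hasDerivAt_id' y).div_const β).const_sub 2)
      refine ⟨(m1 * (1 / α) * T (2 - y / β) + T (y / α - 1) * (m2 * (-(1 / β)))) * G y + T (y / α - 1) * T (2 - y / β) * m, (D1.mul D2).mul hm, ?_⟩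
      have k1 : |m1 * (1 / α)| * y ≤ 2 * K := by
        by_cases h : y ≤ 2 * α
        · rw [abs_mul, abs_of_pos (by positivity : 0 < 1 / α)]
          have : 1 / α * y ≤ 2 := by rw [one_div_mul_eq_div, div_le_iff₀ hα]; exact h
          rw [mul_assoc]
          calc |m1| * (1 / α * y) ≤ K * 2 := mul_le_mul b1 this (by positivity) hK.le
            _ = _ := by ring
        · rw [c1 (fun hh => h (by
            have := hh.2
            have : y / α ≤ 2 := by linarith
            rwa [div_le_iff₀ hα] at this))]
          simp; positivity
      have k2 : |m2 * (-(1 / β))| * y ≤ 2 * K := by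
        rw [abs_mul, abs_neg, abs_of_pos (by positivity : 0 < 1 / β)]
        have : 1 / β * y ≤ 2 := by rw [one_div_mul_eq_div, div_le_iff₀ hβ]; exact hy.2
        rw [mul_assoc]
        calc |m2| * (1 / β * y) ≤ K * 2 := mul_le_mul b2 this (by positivity) hK.le
          _ = _ := by ring
      have key : ∀ a s : ℝ, |a| * y ≤ 2 * K → 0 ≤ s → s ≤ 1 → |a * s * G y| ≤ 2 * K * C := by
        intro a s ha hs0 hs1
        rw [abs_mul, abs_mul, abs_of_nonneg hs0]
        calc |a| * s * |G y| ≤ |a| * 1 * (C * y) :=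
              mul_le_mul (mul_le_mul_of_nonneg_left hs1 (abs_nonneg _)) g0 (abs_nonneg _) (by positivity)
          _ = (|a| * y) * C := by ring
          _ ≤ _ := mul_le_mul_of_nonneg_right ha hC
      have r1 := key _ _ k1 (T0 (2 - y / β)) (T1 (2 - y / β))
      have r2 := key _ _ k2 (T0 (y / α - 1)) (T1 (y / α - 1))
      have r3 : |T (y / α - 1) * T (2 - y / β) * m| ≤ C := by
        rw [abs_mul, abs_of_nonneg (mul_nonneg (T0 _) (T0 _))]
        calc _ ≤ 1 * C := mul_le_mul (mul_le_one₀ (T1 _) (T0 _) (T1 _)) hmC (abs_nonneg _) zero_le_one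
          _ = C := one_mul _
      rw [add_mul]
      refine (abs_add_le _ _).trans ?_
      have r4 := abs_add_le (m1 * (1 / α) * T (2 - y / β) * G y) (T (y / α - 1) * (m2 * (-(1 / β))) * G y)
      rw [mul_comm (T (y / α - 1)) (m2 * _)] at r4 ⊢
      linarith
    · refine ⟨0, ?_, by rw [abs_zero]; exact hCK⟩
      refine (hasDerivAt_const y (0:ℝ)).congr_of_eventuallyEq ?_
      rw [mem_Icc, not_and_or, not_le, not_le] at hy
      rcases hy with hy | hy
      · filter_upwards [gt_mem_nhds hy] with s hs
        rw [z1 s hs.le]; ring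
      · filter_upwards [lt_mem_nhds hy] with s hs
        rw [z2 s hs.le]; ring
  · simp only [z1 y hy]; ring
  · have e1 : T (y / α - 1) = 1 := Real.smoothTransition.one_of_one_le (by
      have : 2 ≤ y / α := by rwa [le_div_iff₀ hα]
      linarith)
    have e2 : T (2 - y / β) = 1 := Real.smoothTransition.one_of_one_le (by
      have : y / β ≤ 1 := by rwa [div_le_one hβ]
      linarith)
    simp only [e1, e2]; ring
  · by_cases hy : y ∈ Icc α (2 * β)
    · obtain ⟨g0, -⟩ := hG y hy
      have hy0 : 0 < y := by linarith [hy.1]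
      rw [abs_of_pos hy0, abs_mul, abs_of_nonneg (mul_nonneg (T0 _) (T0 _))]
      calc _ ≤ 1 * (C * y) := mul_le_mul (mul_le_one₀ (T1 _) (T0 _) (T1 _)) g0 (abs_nonneg _) zero_le_one
        _ = _ := one_mul _
    · have : T (y / α - 1) * T (2 - y / β) * G y = 0 := by
        rw [mem_Icc, not_and_or, not_le, not_le] at hy
        rcases hy with hy | hy
        · rw [z1 y hy.le]; ring
        · rw [z2 y hy.le]; ring
      simp only [this, abs_zero]; positivity

theorem og_of {d : ℝ} {u : ℂ → ℝ} (hd : 0 < d) (h : IsClassicalSolution (ann d 1) u) (hA : ConditionA d 1 u) :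
    ∃ f N, Og d u f N := by
  have hop : IsOpen (ann d 1) := (isOpen_lt continuous_const continuous_norm).inter (isOpen_lt continuous_norm continuous_const)
  obtain ⟨f, N, S⟩ := sol_of_classical hop h
  obtain ⟨F₁, F₂, n1, n2, -, hU, c1, c2, -, -, a1, a2, a3, a4⟩ := hA
  refine ⟨f, N, S, hd, hU ▸ n1.mono subset_union_left, ?_⟩
  have key : ∀ F ⊆ FB (ann d 1) u, (∀ z ∈ F, connectedComponentIn (FB (ann d 1) u) z = F) →
      (closure F ∩ Metric.sphere 0 d).Nonempty → (closure F ∩ Metric.sphere 0 1).Nonempty → ∀ z ∈ F,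
      ∃ F ⊆ FB (ann d 1) u, IsPreconnected F ∧ z ∈ F ∧ ∀ s, d < s → s < 1 → ∃ w ∈ F, ‖w‖ = s := by
    intro F hF hc ⟨p, p1, p2⟩ ⟨q, q1, q2⟩ z hz
    have hpc : IsPreconnected F := by rw [← hc z hz]; exact isPreconnected_connectedComponentIn
    refine ⟨F, hF, hpc, hz, fun s h1 h2 => ?_⟩
    rw [mem_sphere_zero_iff_norm] at p2 q2
    obtain ⟨w1, b1, b2⟩ := mem_closure_iff.1 p1 {w | ‖w‖ < s} (isOpen_lt continuous_norm continuous_const) (by rw [mem_setOf_eq, p2]; exact h1)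
    obtain ⟨w2, b3, b4⟩ := mem_closure_iff.1 q1 {w | s < ‖w‖} (isOpen_lt continuous_const continuous_norm) (by rw [mem_setOf_eq, q2]; exact h2)
    obtain ⟨w, hw, e⟩ := hpc.intermediate_value b2 b4 continuous_norm.continuousOn ⟨le_of_lt b1, le_of_lt b3⟩
    exact ⟨w, hw, e⟩
  intro z hz
  rw [← hU] at hz
  rcases hz with hz | hz
  · exact key F₁ (hU ▸ subset_union_left) c1 a1 a2 z hz
  · exact key F₂ (hU ▸ subset_union_right) c2 a3 a4 z hz

theorem fl_of {d ε : ℝ} {u : ℂ → ℝ} (hd : 0 < d) (h : ∀ r : ℝ, d < r → r < 1 → ∃ θ : ℝ,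
      ∀ x ∈ Metric.ball (0 : ℂ) r \ Metric.ball 0 d, |u (rot θ x) - Pfun x| ≤ ε * r) : Fl d ε u := by
  intro r h1 h2
  have hr : 0 < r := by linarith
  obtain ⟨θ, hθ⟩ := h r h1 h2
  refine ⟨aR r θ, aR_norm hr.le, fun z h3 h4 => ?_⟩
  rw [aR_norm hr.le] at h3 ⊢
  have hn : ‖(r : ℂ) * z‖ = r * ‖z‖ := by rw [norm_mul, norm_real, Real.norm_eq_abs, abs_of_pos hr]
  have := hθ (r * z) ⟨by rw [mem_ball_zero_iff, hn]; nlinarith, by rw [mem_ball_zero_iff, hn]; linarith⟩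
  rw [Pfun_smul hr.le] at this
  have e : rot θ (r * z) = aR r θ * z := by unfold rot aR; ring
  rw [e] at this
  have e2 : u (aR r θ * z) / r - Pfun z = (u (aR r θ * z) - r * Pfun z) / r := by field_simp
  rw [e2, abs_div, abs_of_pos hr, div_le_iff₀ hr]; exact this

theorem final_aux {K : ℝ} (hK : 0 < K) (hST : ∀ t : ℝ, ∃ m, HasDerivAt Real.smoothTransition m t ∧ |m| ≤ K ∧ (t ∉ Icc (0:ℝ) 1 → m = 0))
    {d ε : ℝ} {u : ℂ → ℝ} {f N : ℂ → ℂ} (O : Og d u f N) (hF : Fl d ε u) (hε : 0 < ε) (hb : bK * ε ≤ 1 / 1000) (hε' : ε ≤ 1 / 1000000)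
    (hC : 3000 * (C6 * ε) ≤ 1) (hb1 : bK * (C8 * ε) ≤ 1 / 1000) (h9 : C9 * ε ≤ 1 / 1000) :
    ∃ g : ℝ → ℝ, g 0 = 0 ∧ (∀ y, ∃ m, HasDerivAt g m y ∧ |m| ≤ 2 * (1 + 4 * K) * C9 * ε) ∧
      ∃ θ : ℝ, ∀ z : ℂ, 100000 * d < ‖z‖ → ‖z‖ < 1 / 100000 → (0 < u (aR 1 θ * z) ↔ g z.im < z.re) := by
  have hd := O.hd
  have hC8 := C8_ge
  have hC6 := C6_ge
  have hbK := bK_ge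
  have h90 : 0 ≤ C9 := by unfold C9; positivity
  obtain ⟨θ, hθ⟩ := fixed O hF hε hb hε' hC
  obtain ⟨G1, hG1⟩ := upper O hF hε hb hε' hC hb1 hθ
  have hθ' : ∀ R, 16384 * d ≤ R → R ≤ 1/8 → Flat d (C8 * ε) (fun z => u ((starRingEnd ℂ) z)) (aR R (-θ)) := by
    intro R h1 h2
    rw [← aR_conj]; exact (hθ R h1 h2).conj
  obtain ⟨G2, hG2⟩ := upper O.conj hF.conj hε hb hε' hC hb1 hθ'
  have hct : ∀ G : ℝ → ℝ, (∀ y, 3000 * d ≤ y → y ≤ 1/49 → |G y| ≤ C9 * ε * y ∧ ∃ m, HasDerivAt G m y ∧ |m| ≤ C9 * ε) → _ := fun G h =>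
    cut hK hST (α := 3000 * d) (β := 1/100) (C := C9 * ε) (G := G) (by positivity) (by norm_num) (by positivity)
      (fun y hy => h y hy.1 (by linarith [hy.2]))
  obtain ⟨E1, a1, a2, a3, a4⟩ := hct G1 (fun y h1 h2 => ⟨(hG1 y h1 h2).1, (hG1 y h1 h2).2.2⟩)
  obtain ⟨E2, b1, b2, b3, b4⟩ := hct G2 (fun y h1 h2 => ⟨(hG2 y h1 h2).1, (hG2 y h1 h2).2.2⟩)
  have hα : 0 ≤ 3000 * d := by positivity
  refine ⟨fun y => E1 y + E2 (-y), ?_, fun y => ?_, θ, fun z hz1 hz2 => ?_⟩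
  · simp only [neg_zero, a2 0 hα, b2 0 hα, add_zero]
  · obtain ⟨m1, c1, c2⟩ := a1 y
    obtain ⟨m2, c3, c4⟩ := b1 (-y)
    refine ⟨m1 + m2 * (-1), c1.add (HasDerivAt.comp (h₂ := E2) (h := fun y : ℝ => -y) y c3 (hasDerivAt_neg' y)), ?_⟩
    refine (abs_add_le _ _).trans ?_
    rw [abs_mul, abs_neg, abs_one, mul_one]
    linarith
  · have hz : z = ⟨z.re, z.im⟩ := rfl
    have hn := Complex.norm_le_abs_re_add_abs_im z
    have him := Complex.abs_im_le_norm z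
    by_cases h : |z.im| / 4 < |z.re|
    · rw [side O hε hb1 hθ (by linarith) (by linarith) h]
      have hg : |E1 z.im + E2 (-z.im)| < |z.re| := by
        refine (abs_add_le _ _).trans_lt ?_
        have q1 := a4 z.im
        have q2 := b4 (-z.im)
        rw [abs_neg] at q2
        have : C9 * ε * |z.im| ≤ 1 / 1000 * |z.im| := mul_le_mul_of_nonneg_right h9 (abs_nonneg _)
        linarith [abs_nonneg z.im]
      have hg' := abs_lt.1 hg
      rcases lt_trichotomy z.re 0 with h0 | h0 | h0
      · rw [abs_of_neg h0] at hg'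
        constructor <;> intro h1
        · linarith
        · change E1 z.im + E2 (-z.im) < z.re at h1; linarith [hg'.1]
      · rw [h0, abs_zero] at h; exact absurd h (not_lt.2 (by positivity))
      · rw [abs_of_pos h0] at hg'
        exact ⟨fun _ => hg'.2, fun _ => h0⟩
    · rw [not_lt] at h
      rcases lt_trichotomy z.im 0 with h0 | h0 | h0
      · rw [abs_of_neg h0] at h hn him
        have e1 : E1 z.im = 0 := a2 _ (by linarith)
        have e2 : E2 (-z.im) = G2 (-z.im) := b3 _ (by linarith) (by linarith)
        have := (hG2 (-z.im) (by linarith) (by linarith)).2.1 z.re h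
        have e3 : (starRingEnd ℂ) (aR 1 (-θ) * ⟨z.re, -z.im⟩) = aR 1 θ * z := by
          rw [map_mul, aR_conj, neg_neg]; congr 1
          apply Complex.ext <;> simp
        rw [e3] at this
        simp only [e1, e2, zero_add]; exact this
      · rw [h0, abs_zero] at h hn
        have := abs_nonneg z.re
        linarith
      · rw [abs_of_pos h0] at h hn him
        have e1 : E2 (-z.im) = 0 := b2 _ (by linarith)
        have e2 : E1 z.im = G1 z.im := a3 _ (by linarith) (by linarith)
        have := (hG1 z.im (by linarith) (by linarith)).2.1 z.re h
        simp only [e1, e2, add_zero]; exact this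

/-- "flat with a small hole implies Lipschitz". -/
theorem flat_with_small_hole_implies_lipschitz :
    ∃ ε₀ c : ℝ, 0 < ε₀ ∧ 0 < c ∧
    ∀ ε : ℝ, 0 < ε → ε < ε₀ → ∀ d : ℝ, 0 < d →
    ∀ u : ℂ → ℝ, IsClassicalSolution (ann d 1) u → ConditionA d 1 u →
    (∀ r : ℝ, d < r → r < 1 → ∃ θ : ℝ,
      ∀ x ∈ Metric.ball (0 : ℂ) r \ Metric.ball 0 d, |u (rot θ x) - Pfun x| ≤ ε * r) →
    ∃ g : ℝ → ℝ, g 0 = 0 ∧ DifferentiableOn ℝ g (Set.Icc (-1) 1) ∧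
      (∀ x ∈ Set.Icc (-1 : ℝ) 1, |derivWithin g (Set.Icc (-1) 1) x| ≤ c * ε) ∧
      ∃ θ : ℝ, ∀ z : ℂ, c * d < ‖z‖ → ‖z‖ < 1 / c →
        (rot θ z ∈ posSet (ann d 1) u ↔ g z.im < z.re) := by
  obtain ⟨K, hK, hST⟩ := exists_ST
  have hC8 := C8_ge
  have hC6 := C6_ge
  have hbK := bK_ge
  have h90 : 0 ≤ C9 := by unfold C9; positivity
  have hbC : 0 ≤ bK * C8 := by positivity
  set D : ℝ := bK * C8 + C9 + bK + C6 + 1 with hD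
  have hD1 : 1 ≤ D := by linarith
  have hT : 0 ≤ 2 * (1 + 4 * K) * C9 := by positivity
  refine ⟨1 / (1000000 * D), 100000 + 2 * (1 + 4 * K) * C9, by positivity, by positivity, ?_⟩
  intro ε hε hε0 d hd u hu hA hfl
  rw [lt_div_iff₀ (by positivity)] at hε0
  have hDe : D * ε < 1 / 1000000 := by linarith
  have k1 : 0 ≤ bK * C8 * ε := by positivity
  have k2 : 0 ≤ C9 * ε := by positivity
  have k3 : 0 ≤ bK * ε := by positivity
  have k4 : 0 ≤ C6 * ε := by positivity
  have hDs : bK * C8 * ε + C9 * ε + bK * ε + C6 * ε + ε < 1 / 1000000 := by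
    rw [hD] at hDe; linarith
  obtain ⟨f, N, O⟩ := og_of hd hu hA
  obtain ⟨g, g0, gd, θ, hθ⟩ := final_aux hK hST O (fl_of hd hfl) hε (by linarith) (by linarith) (by linarith) (by linarith) (by linarith)
  refine ⟨g, g0, fun y _ => (gd y).choose_spec.1.differentiableAt.differentiableWithinAt, fun y hy => ?_, θ, fun z h1 h2 => ?_⟩
  · obtain ⟨m, hm, hm'⟩ := gd y
    rw [hm.hasDerivWithinAt.derivWithin (uniqueDiffOn_Icc (by norm_num) y hy)]
    linarith
  · have hTd : 0 ≤ 2 * (1 + 4 * K) * C9 * d := by positivity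
    have h1' : 100000 * d < ‖z‖ := by linarith
    have h2' : ‖z‖ < 1 / 100000 := h2.trans_le (one_div_le_one_div_of_le (by norm_num) (by linarith))
    rw [← hθ z h1' h2']
    have e : rot θ z = aR 1 θ * z := by unfold rot aR; push_cast; ring
    have hn : ‖aR 1 θ * z‖ = ‖z‖ := by rw [norm_mul, aR_norm zero_le_one, one_mul]
    rw [e]
    constructor
    · exact fun h => h.2
    · intro h
      refine ⟨⟨?_, ?_⟩, h⟩
      · rw [hn]; linarith
      · rw [hn]; linarith
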